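/- Assume the standing assumptions in dimension n = 3, with u_k → u in L¹(Ω) where u takes only the values ±1 on Ω \ spt(μ) and is locally constant there, and let I be a nonempty compact subset of the open interval (−1,1). Then there exist a subsequence (k_j), a compact set K ⊆ closure(Ω), and finitely many points x₁, …, x_N ∈ Ω such that the closures of the level sets u_{k_j}^{-1}(I) converge to K in Hausdorff distance as j → ∞ and K ∩ Ω = (spt(μ) ∩ Ω) ∪ {x₁, …, x_N}. -/

import Mathlib

open MeasureTheory Filter Metric Set

noncomputable section

abbrev E (n : ℕ) : Type := EuclideanSpace ℝ (Fin n)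

def W (t : ℝ) : ℝ := (t ^ 2 - 1) ^ 2 / 4

def W' (t : ℝ) : ℝ := t ^ 3 - t

def c0 : ℝ := 2 * Real.sqrt 2 / 3

def lap {n : ℕ} (u : E n → ℝ) (x : E n) : ℝ :=
  ∑ i, (fderiv ℝ (fderiv ℝ u) x) (EuclideanSpace.single i 1) (EuclideanSpace.single i 1)

def areaDensity {n : ℕ} (ev : ℝ) (u : E n → ℝ) (x : E n) : ℝ :=
  ev / 2 * ‖fderiv ℝ u x‖ ^ 2 + (1 / ev) * W (u x)

def willDensity {n : ℕ} (ev : ℝ) (u : E n → ℝ) (x : E n) : ℝ :=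
  (ev * lap u x - (1 / ev) * W' (u x)) ^ 2

def Se {n : ℕ} (ev : ℝ) (Ω : Set (E n)) (u : E n → ℝ) : ℝ :=
  (1 / c0) * ∫ x in Ω, areaDensity ev u x

def We {n : ℕ} (ev : ℝ) (Ω : Set (E n)) (u : E n → ℝ) : ℝ :=
  (1 / (c0 * ev)) * ∫ x in Ω, willDensity ev u x

def mue {n : ℕ} (ev : ℝ) (Ω : Set (E n)) (u : E n → ℝ) (U : Set (E n)) : ℝ :=
  (1 / c0) * ∫ x in U ∩ Ω, areaDensity ev u x

def ale {n : ℕ} (ev : ℝ) (Ω : Set (E n)) (u : E n → ℝ) (U : Set (E n)) : ℝ :=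
  (1 / (c0 * ev)) * ∫ x in U ∩ Ω, willDensity ev u x

def xiPlus {n : ℕ} (ev : ℝ) (Ω : Set (E n)) (u : E n → ℝ) (U : Set (E n)) : ℝ :=
  ∫ x in U ∩ Ω, max (ev / 2 * ‖fderiv ℝ u x‖ ^ 2 - (1 / ev) * W (u x)) 0

def sptM {n : ℕ} (μ : Measure (E n)) : Set (E n) :=
  {x | ∀ r > 0, 0 < μ (ball x r)}

def weakConvA {n : ℕ} (Ω : Set (E n)) (ε : ℕ → ℝ) (u : ℕ → E n → ℝ)
    (μ : Measure (E n)) : Prop :=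
  ∀ φ : BoundedContinuousFunction (E n) ℝ,
    Tendsto (fun k => (1 / c0) * ∫ x in Ω, φ x * areaDensity (ε k) (u k) x) atTop
      (nhds (∫ x, φ x ∂μ))

def weakConvW {n : ℕ} (Ω : Set (E n)) (ε : ℕ → ℝ) (u : ℕ → E n → ℝ)
    (α : Measure (E n)) : Prop :=
  ∀ φ : BoundedContinuousFunction (E n) ℝ,
    Tendsto (fun k => (1 / (c0 * ε k)) * ∫ x in Ω, φ x * willDensity (ε k) (u k) x) atTop
      (nhds (∫ x, φ x ∂α))

/-! ### Partial derivatives -/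

/-- The `i`-th partial derivative. -/
def pd (i : Fin 3) (u : E 3 → ℝ) (x : E 3) : ℝ := fderiv ℝ u x (EuclideanSpace.single i 1)

/-- The Euclidean product of two gradients. -/
def gdot (u v : E 3 → ℝ) (x : E 3) : ℝ := ∑ i, pd i u x * pd i v x

/-- The squared length of the gradient. -/
def gsq (u : E 3 → ℝ) (x : E 3) : ℝ := ∑ i, pd i u x ^ 2

lemma gsq_nonneg (u : E 3 → ℝ) (x : E 3) : 0 ≤ gsq u x :=
  Finset.sum_nonneg fun _ _ => sq_nonneg _

lemma sum_three (f : Fin 3 → ℝ) : ∑ i, f i = f 0 + f 1 + f 2 := Fin.sum_univ_three f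

lemma gsq_eq_norm (u : E 3 → ℝ) (x : E 3) : gsq u x = ‖fderiv ℝ u x‖ ^ 2 := by
  have h1 : ‖(InnerProductSpace.toDual ℝ (E 3)).symm (fderiv ℝ u x)‖ = ‖fderiv ℝ u x‖ := by simp
  rw [← h1, EuclideanSpace.norm_sq_eq]
  refine Finset.sum_congr rfl fun i _ => ?_
  have : ((InnerProductSpace.toDual ℝ (E 3)).symm (fderiv ℝ u x)) i
      = inner ℝ ((InnerProductSpace.toDual ℝ (E 3)).symm (fderiv ℝ u x))
        (EuclideanSpace.single i (1 : ℝ)) := by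
    rw [EuclideanSpace.inner_single_right]; simp
  rw [InnerProductSpace.toDual_symm_apply] at this
  rw [this]; simp [pd]

lemma gdot_sq_le (u v : E 3 → ℝ) (x : E 3) : gdot u v x ^ 2 ≤ gsq u x * gsq v x := by
  unfold gdot gsq
  exact Finset.sum_mul_sq_le_sq_mul_sq _ _ _

lemma contDiff_pd {n : ℕ} {u : E 3 → ℝ} (hu : ContDiff ℝ (n + 1) u) (i : Fin 3) :
    ContDiff ℝ n (pd i u) := by
  have := hu.fderiv_right (m := n) le_rfl
  exact this.clm_apply contDiff_const

lemma contDiff_pd_one {u : E 3 → ℝ} (hu : ContDiff ℝ 2 u) (i : Fin 3) :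
    ContDiff ℝ 1 (pd i u) := by
  have h : ContDiff ℝ ((1 : ℕ) + 1) u := by norm_num; exact hu
  exact_mod_cast contDiff_pd h i

lemma continuous_pd {u : E 3 → ℝ} (hu : ContDiff ℝ 1 u) (i : Fin 3) :
    Continuous (pd i u) := by
  have h : ContDiff ℝ ((0 : ℕ) + 1) u := by norm_num; exact hu
  exact (contDiff_pd h i).continuous

lemma continuous_gsq {u : E 3 → ℝ} (hu : ContDiff ℝ 1 u) : Continuous (gsq u) :=
  continuous_finsetSum _ fun i _ => (continuous_pd hu i).pow 2

lemma continuous_gdot {u v : E 3 → ℝ} (hu : ContDiff ℝ 1 u) (hv : ContDiff ℝ 1 v) :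
    Continuous (gdot u v) :=
  continuous_finsetSum _ fun i _ => (continuous_pd hu i).mul (continuous_pd hv i)

section rules
variable {f g : E 3 → ℝ} {x : E 3} {i : Fin 3}

lemma pd_add (hf : DifferentiableAt ℝ f x) (hg : DifferentiableAt ℝ g x) :
    pd i (fun y => f y + g y) x = pd i f x + pd i g x := by
  simp [pd, fderiv_fun_add hf hg]

lemma pd_sub (hf : DifferentiableAt ℝ f x) (hg : DifferentiableAt ℝ g x) :
    pd i (fun y => f y - g y) x = pd i f x - pd i g x := by
  simp [pd, fderiv_fun_sub hf hg]

lemma pd_mul (hf : DifferentiableAt ℝ f x) (hg : DifferentiableAt ℝ g x) :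
    pd i (fun y => f y * g y) x = pd i f x * g x + f x * pd i g x := by
  simp [pd, fderiv_fun_mul hf hg]; ring

lemma pd_const_mul (c : ℝ) (hf : DifferentiableAt ℝ f x) :
    pd i (fun y => c * f y) x = c * pd i f x := by
  simp [pd, fderiv_const_mul hf c]

lemma pd_const (c : ℝ) : pd i (fun _ => c) x = 0 := by
  simp [pd]

lemma pd_neg : pd i (fun y => - f y) x = - pd i f x := by
  simp [pd, fderiv_fun_neg]

lemma pd_comp {k : ℝ → ℝ} {k' : ℝ} (hk : HasDerivAt k k' (f x)) (hf : DifferentiableAt ℝ f x) :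
    pd i (fun y => k (f y)) x = k' * pd i f x := by
  have := (hk.comp_hasFDerivAt x hf.hasFDerivAt).fderiv
  simp only [pd]
  rw [show (fun y => k (f y)) = k ∘ f from rfl, this]; simp

lemma pd_pow (n : ℕ) (hf : DifferentiableAt ℝ f x) :
    pd i (fun y => f y ^ n) x = n * f x ^ (n - 1) * pd i f x :=
  pd_comp (k := fun t => t ^ n) (hasDerivAt_pow n (f x)) hf

lemma pd_coord (j : Fin 3) : pd i (fun y : E 3 => y j) x = if i = j then 1 else 0 := by
  have : (fun y : E 3 => y j) = (EuclideanSpace.proj j : E 3 →L[ℝ] ℝ) := by ext y; simp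
  rw [pd, this, ContinuousLinearMap.fderiv]
  simp [eq_comm]

lemma pd_sum {ι : Type*} (s : Finset ι) {F : ι → E 3 → ℝ}
    (hF : ∀ j ∈ s, DifferentiableAt ℝ (F j) x) :
    pd i (fun y => ∑ j ∈ s, F j y) x = ∑ j ∈ s, pd i (F j) x := by
  simp only [pd]
  rw [fderiv_fun_sum hF]; simp

end rules

lemma contDiff_coord {n : WithTop ℕ∞} (j : Fin 3) : ContDiff ℝ n (fun y : E 3 => y j) := by
  have : (fun y : E 3 => y j) = (EuclideanSpace.proj j : E 3 →L[ℝ] ℝ) := by ext y; simp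
  rw [this]; exact ContinuousLinearMap.contDiff _

lemma pd_pd {u : E 3 → ℝ} {x : E 3} (hu : DifferentiableAt ℝ (fderiv ℝ u) x) (i j : Fin 3) :
    pd i (pd j u) x
      = fderiv ℝ (fderiv ℝ u) x (EuclideanSpace.single i 1) (EuclideanSpace.single j 1) := by
  have h : HasFDerivAt (pd j u) ((fderiv ℝ (fderiv ℝ u) x).flip (EuclideanSpace.single j 1)) x := by
    have := hu.hasFDerivAt.clm_apply (hasFDerivAt_const (EuclideanSpace.single j (1:ℝ)) x)
    simp only [ContinuousLinearMap.comp_zero, zero_add] at this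
    exact this
  rw [pd, h.fderiv]; simp

lemma differentiable_fderiv {u : E 3 → ℝ} (hu : ContDiff ℝ 2 u) :
    Differentiable ℝ (fderiv ℝ u) :=
  (hu.fderiv_right (m := 1) (by norm_num)).differentiable (by norm_num)

lemma lap_eq {u : E 3 → ℝ} (hu : ContDiff ℝ 2 u) (x : E 3) :
    lap u x = ∑ i, pd i (pd i u) x := by
  unfold lap
  exact Finset.sum_congr rfl fun i _ => (pd_pd (differentiable_fderiv hu x) i i).symm

lemma pd_comm {u : E 3 → ℝ} (hu : ContDiff ℝ 2 u) (i j : Fin 3) (x : E 3) :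
    pd i (pd j u) x = pd j (pd i u) x := by
  rw [pd_pd (differentiable_fderiv hu x), pd_pd (differentiable_fderiv hu x)]
  have : IsSymmSndFDerivAt ℝ u x := hu.contDiffAt.isSymmSndFDerivAt (by simp)
  exact this.eq _ _

lemma continuous_lap {u : E 3 → ℝ} (hu : ContDiff ℝ 2 u) : Continuous (lap u) := by
  rw [show lap u = fun x => ∑ i, pd i (pd i u) x from funext (lap_eq hu)]
  exact continuous_finsetSum _ fun i _ => continuous_pd (contDiff_pd_one hu i) i

/-! ### Integration by parts -/

lemma hasCompactSupport_pd {F : E 3 → ℝ} (hc : HasCompactSupport F) (i : Fin 3) :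
    HasCompactSupport (pd i F) := hc.fderiv_apply (𝕜 := ℝ) _

lemma integral_pd_eq_zero {F : E 3 → ℝ} (hF : ContDiff ℝ 1 F) (hc : HasCompactSupport F)
    (i : Fin 3) : ∫ x, pd i F x = 0 := by
  have h1 := integral_mul_fderiv_eq_neg_fderiv_mul_of_integrable (μ := (volume : Measure (E 3)))
    (𝕜 := ℝ) (f := fun _ : E 3 => (1 : ℝ)) (g := F) (v := EuclideanSpace.single i (1:ℝ))
  simp only [fderiv_fun_const, Pi.zero_apply, _root_.zero_apply, zero_mul,
    one_mul, integral_zero, neg_zero] at h1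
  refine h1 (integrable_zero _ _ _) ?_ ?_ ?_ ?_
  · exact (continuous_pd hF i).integrable_of_hasCompactSupport (hasCompactSupport_pd hc i)
  · exact hF.continuous.integrable_of_hasCompactSupport hc
  · exact fun y _ => differentiableAt_const (1 : ℝ)
  · exact fun y _ => hF.differentiable (by norm_num) y

/-! ### Energies -/

/-- The Allen–Cahn residual at unit scale. -/
def resid (u : E 3 → ℝ) (x : E 3) : ℝ := W' (u x) - lap u x

/-- The energy density at unit scale. -/
def eden (u : E 3 → ℝ) (x : E 3) : ℝ := gsq u x / 2 + W (u x)

/-- The discrepancy at unit scale. -/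
def disc (u : E 3 → ℝ) (x : E 3) : ℝ := gsq u x / 2 - W (u x)

/-- The energy in a ball. -/
def En (u : E 3 → ℝ) (p : E 3) (r : ℝ) : ℝ := ∫ x in ball p r, eden u x

/-- The squared residual in a ball. -/
def Fn (u : E 3 → ℝ) (p : E 3) (r : ℝ) : ℝ := ∫ x in ball p r, resid u x ^ 2

/-- The radial derivative with respect to `p`, times the radius. -/
def rad (p : E 3) (u : E 3 → ℝ) (x : E 3) : ℝ := ∑ i, (x i - p i) * pd i u x

lemma W_nonneg (t : ℝ) : 0 ≤ W t := by unfold W; positivity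

lemma hasDerivAt_W (t : ℝ) : HasDerivAt W (W' t) t := by
  unfold W W'
  have := ((((hasDerivAt_id t).pow 2).sub_const 1).pow 2).div_const 4
  refine this.congr_deriv ?_
  simp; ring

lemma contDiff_W {n : WithTop ℕ∞} : ContDiff ℝ n W := by unfold W; fun_prop

lemma contDiff_W' {n : WithTop ℕ∞} : ContDiff ℝ n W' := by unfold W'; fun_prop

lemma continuous_resid {u : E 3 → ℝ} (hu : ContDiff ℝ 2 u) : Continuous (resid u) :=
  ((contDiff_W' (n := 0)).continuous.comp hu.continuous).sub (continuous_lap hu)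

lemma contDiff_gsq {u : E 3 → ℝ} (hu : ContDiff ℝ 2 u) : ContDiff ℝ 1 (gsq u) :=
  ContDiff.sum fun i _ => (contDiff_pd_one hu i).pow 2

lemma contDiff_eden {u : E 3 → ℝ} (hu : ContDiff ℝ 2 u) : ContDiff ℝ 1 (eden u) :=
  ((contDiff_gsq hu).div_const 2).add
    (contDiff_W.comp (hu.of_le (by norm_num)))

lemma continuous_eden {u : E 3 → ℝ} (hu : ContDiff ℝ 2 u) : Continuous (eden u) :=
  (contDiff_eden hu).continuous

lemma continuous_disc {u : E 3 → ℝ} (hu : ContDiff ℝ 2 u) : Continuous (disc u) :=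
  ((contDiff_gsq hu).continuous.div_const 2).sub
    ((contDiff_W (n := 0)).continuous.comp hu.continuous)

lemma contDiff_rad {u : E 3 → ℝ} (hu : ContDiff ℝ 2 u) (p : E 3) : ContDiff ℝ 1 (rad p u) :=
  ContDiff.sum fun i _ => ((contDiff_coord i).sub contDiff_const).mul (contDiff_pd_one hu i)

lemma continuous_rad {u : E 3 → ℝ} (hu : ContDiff ℝ 1 u) (p : E 3) : Continuous (rad p u) :=
  continuous_finsetSum _ fun i _ =>
    ((contDiff_coord (n := 0) i).continuous.sub continuous_const).mul (continuous_pd hu i)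

lemma eden_nonneg (u : E 3 → ℝ) (x : E 3) : 0 ≤ eden u x := by
  have := gsq_nonneg u x; have := W_nonneg (u x); unfold eden; positivity

lemma rad_sq_le (p : E 3) (u : E 3 → ℝ) (x : E 3) : rad p u x ^ 2 ≤ ‖x - p‖ ^ 2 * gsq u x := by
  unfold rad gsq
  rw [EuclideanSpace.norm_sq_eq]
  simpa using Finset.sum_mul_sq_le_sq_mul_sq Finset.univ (fun i => x i - p i) (fun i => pd i u x)

lemma integrableOn_ball {f : E 3 → ℝ} (hf : Continuous f) (p : E 3) (r : ℝ) :
    IntegrableOn f (ball p r) :=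
  (hf.continuousOn.integrableOn_compact (isCompact_closedBall p r)).mono_set ball_subset_closedBall

lemma setIntegral_ball_mono {f : E 3 → ℝ} (hf : Continuous f) (h0 : ∀ x, 0 ≤ f x) {p q : E 3}
    {r s : ℝ} (h : ball p r ⊆ ball q s) : ∫ x in ball p r, f x ≤ ∫ x in ball q s, f x :=
  setIntegral_mono_set (integrableOn_ball hf q s) (ae_of_all _ h0) h.eventuallyLE

lemma En_mono {u : E 3 → ℝ} (hu : ContDiff ℝ 2 u) {p q : E 3} {r s : ℝ}
    (h : ball p r ⊆ ball q s) : En u p r ≤ En u q s :=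
  setIntegral_ball_mono (continuous_eden hu) (eden_nonneg u) h

lemma Fn_mono {u : E 3 → ℝ} (hu : ContDiff ℝ 2 u) {p q : E 3} {r s : ℝ}
    (h : ball p r ⊆ ball q s) : Fn u p r ≤ Fn u q s :=
  setIntegral_ball_mono ((continuous_resid hu).pow 2) (fun _ => sq_nonneg _) h

lemma En_nonneg (u : E 3 → ℝ) (p : E 3) (r : ℝ) : 0 ≤ En u p r :=
  setIntegral_nonneg measurableSet_ball fun x _ => eden_nonneg u x

lemma Fn_nonneg (u : E 3 → ℝ) (p : E 3) (r : ℝ) : 0 ≤ Fn u p r :=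
  setIntegral_nonneg measurableSet_ball fun _ _ => sq_nonneg _

/-- From an identity `∫ X = 0` with `X` supported in a ball to an inequality between integrals. -/
lemma setIntegral_ball_le_of_integral_eq_zero {X a b : E 3 → ℝ} {p : E 3} {r s : ℝ}
    (hX : IntegrableOn X (ball p s)) (hX0 : ∫ x, X x = 0) (ha : IntegrableOn a (ball p r))
    (hb : IntegrableOn b (ball p s)) (hrs : r ≤ s) (hXs : ∀ y, y ∉ ball p s → X y = 0)
    (h1 : ∀ y ∈ ball p r, a y ≤ X y + b y) (h2 : ∀ y ∈ ball p s, 0 ≤ X y + b y) :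
    ∫ x in ball p r, a x ≤ ∫ x in ball p s, b x := by
  have e1 : ∫ x in ball p s, X x = 0 := by
    rw [setIntegral_eq_integral_of_forall_compl_eq_zero hXs, hX0]
  have e2 : ∫ x in ball p s, b x = ∫ x in ball p s, (X x + b x) := by
    rw [integral_add hX hb, e1, zero_add]
  have hsub : ball p r ⊆ ball p s := ball_subset_ball hrs
  rw [e2]
  calc ∫ x in ball p r, a x ≤ ∫ x in ball p r, (X x + b x) :=
        setIntegral_mono_on ha ((hX.add hb).mono_set hsub) measurableSet_ball h1
    _ ≤ ∫ x in ball p s, (X x + b x) :=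
        setIntegral_mono_set (hX.add hb)
          ((ae_restrict_iff' measurableSet_ball).2 (ae_of_all _ h2)) hsub.eventuallyLE

/-! ### The two basic identities -/

/-- Testing the equation with `g(u) φ`. -/
lemma integral_test {u : E 3 → ℝ} (hu : ContDiff ℝ 2 u) {g g' : ℝ → ℝ}
    (hg : ∀ t, HasDerivAt g (g' t) t) (hg' : Continuous g') {φ : E 3 → ℝ}
    (hφ : ContDiff ℝ 1 φ) (hc : HasCompactSupport φ) :
    ∫ x, (φ x * (g' (u x) * gsq u x + g (u x) * W' (u x)) - φ x * (resid u x * g (u x))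
      + g (u x) * gdot u φ x) = 0 := by
  have hg1 : ContDiff ℝ 1 g := by
    rw [contDiff_one_iff_deriv]
    exact ⟨fun t => (hg t).differentiableAt, by
      rw [show deriv g = g' from funext fun t => (hg t).deriv]; exact hg'⟩
  have hu1 : ContDiff ℝ 1 u := hu.of_le (by norm_num)
  have hF : ∀ i, ContDiff ℝ 1 (fun x => g (u x) * pd i u x * φ x) := fun i =>
    ((hg1.comp hu1).mul (contDiff_pd_one hu i)).mul hφ
  have hFc : ∀ i, HasCompactSupport (fun x => g (u x) * pd i u x * φ x) := fun i => hc.mul_left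
  have hz : ∫ x, ∑ i, pd i (fun x => g (u x) * pd i u x * φ x) x = 0 := by
    rw [integral_finsetSum]
    · exact Finset.sum_eq_zero fun i _ => integral_pd_eq_zero (hF i) (hFc i) i
    · exact fun i _ => (continuous_pd (hF i) i).integrable_of_hasCompactSupport
        (hasCompactSupport_pd (hFc i) i)
  rw [← hz]
  congr 1; ext x
  have hud : DifferentiableAt ℝ u x := hu1.differentiable (by norm_num) x
  have hgd : DifferentiableAt ℝ (fun x => g (u x)) x :=
    (hg1.comp hu1).differentiable (by norm_num) x
  have hφd : DifferentiableAt ℝ φ x := hφ.differentiable (by norm_num) x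
  have hpd : ∀ i, DifferentiableAt ℝ (pd i u) x := fun i =>
    (contDiff_pd_one hu i).differentiable (by norm_num) x
  have : ∀ i, pd i (fun x => g (u x) * pd i u x * φ x) x
      = (g' (u x) * pd i u x * pd i u x + g (u x) * pd i (pd i u) x) * φ x
        + g (u x) * pd i u x * pd i φ x := fun i => by
    rw [pd_mul (hgd.fun_mul (hpd i)) hφd, pd_mul hgd (hpd i), pd_comp (hg _) hud]
  simp only [this, resid, lap_eq hu, gdot, gsq, sum_three]
  ring

/-- The inner-variation identity for the field `h(x) (x - p)`. -/
lemma integral_stationarity {u : E 3 → ℝ} (hu : ContDiff ℝ 2 u) (p : E 3) {h : E 3 → ℝ}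
    (hh : ContDiff ℝ 1 h) (hc : HasCompactSupport h) :
    ∫ x, (h x * (2 * eden u x - disc u x) + eden u x * rad p h x - rad p u x * gdot u h x
      + h x * (resid u x * rad p u x)) = 0 := by
  have hu1 : ContDiff ℝ 1 u := hu.of_le (by norm_num)
  have hF : ∀ i : Fin 3, ContDiff ℝ 1
      (fun x => h x * ((x i - p i) * eden u x - rad p u x * pd i u x)) := fun i =>
    hh.mul ((((contDiff_coord i).sub contDiff_const).mul (contDiff_eden hu)).sub
      ((contDiff_rad hu p).mul (contDiff_pd_one hu i)))
  have hFc : ∀ i : Fin 3, HasCompactSupport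
      (fun x => h x * ((x i - p i) * eden u x - rad p u x * pd i u x)) := fun i => hc.mul_right
  have hz : ∫ x, ∑ i, pd i (fun x => h x * ((x i - p i) * eden u x - rad p u x * pd i u x)) x
      = 0 := by
    rw [integral_finsetSum]
    · exact Finset.sum_eq_zero fun i _ => integral_pd_eq_zero (hF i) (hFc i) i
    · exact fun i _ => (continuous_pd (hF i) i).integrable_of_hasCompactSupport
        (hasCompactSupport_pd (hFc i) i)
  rw [← hz]
  congr 1; ext x
  have hud : DifferentiableAt ℝ u x := hu1.differentiable (by norm_num) x
  have hhd : DifferentiableAt ℝ h x := hh.differentiable (by norm_num) x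
  have hpd : ∀ i, DifferentiableAt ℝ (pd i u) x := fun i =>
    (contDiff_pd_one hu i).differentiable (by norm_num) x
  have hed : DifferentiableAt ℝ (eden u) x := (contDiff_eden hu).differentiable (by norm_num) x
  have hrd : DifferentiableAt ℝ (rad p u) x := (contDiff_rad hu p).differentiable (by norm_num) x
  have hxd : ∀ i : Fin 3, DifferentiableAt ℝ (fun y : E 3 => y i - p i) x := fun i =>
    ((contDiff_coord (n := 1) i).sub contDiff_const).differentiable (by norm_num) x
  have hcd : ∀ i j : Fin 3, pd i (fun y : E 3 => y j - p j) x = if i = j then 1 else 0 := by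
    intro i j
    rw [pd_sub ((contDiff_coord (n := 1) j).differentiable (by norm_num) x)
      (differentiableAt_const _), pd_const, pd_coord, sub_zero]
  have hge : ∀ i, pd i (eden u) x = ∑ j, pd j u x * pd i (pd j u) x + W' (u x) * pd i u x := by
    intro i
    have h2 : eden u = fun y => (∑ j, (1/2 : ℝ) * pd j u y ^ 2) + W (u y) := by
      ext y; simp only [eden, gsq, sum_three]; ring
    rw [h2, pd_add, pd_comp (hasDerivAt_W _) hud, pd_sum]
    · congr 1
      refine Finset.sum_congr rfl fun j _ => ?_
      rw [pd_const_mul _ ((hpd j).fun_pow 2), pd_pow 2 (hpd j)]; push_cast; ring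
    · exact fun j _ => ((hpd j).pow 2).const_mul _
    · exact DifferentiableAt.fun_sum fun j _ => ((hpd j).pow 2).const_mul _
    · exact (hasDerivAt_W _).differentiableAt.comp x hud
  have hgr : ∀ i, pd i (rad p u) x = pd i u x + ∑ j, (x j - p j) * pd i (pd j u) x := by
    intro i
    rw [show rad p u = fun y => ∑ j, (y j - p j) * pd j u y from rfl, pd_sum]
    · simp only [pd_mul (hxd _) (hpd _), hcd, Finset.sum_add_distrib]
      simp
    · exact fun j _ => (hxd j).mul (hpd j)
  have : ∀ i : Fin 3, pd i (fun x => h x * ((x i - p i) * eden u x - rad p u x * pd i u x)) x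
      = pd i h x * ((x i - p i) * eden u x - rad p u x * pd i u x)
        + h x * (eden u x + (x i - p i) * pd i (eden u) x
          - (pd i (rad p u) x * pd i u x + rad p u x * pd i (pd i u) x)) := fun i => by
    rw [pd_mul hhd (((hxd i).fun_mul hed).fun_sub (hrd.fun_mul (hpd i))),
      pd_sub ((hxd i).fun_mul hed) (hrd.fun_mul (hpd i)), pd_mul (hxd i) hed, pd_mul hrd (hpd i), hcd]
    simp
  simp only [this, hge, hgr]
  simp only [resid, lap_eq hu, gdot, disc, eden, gsq, rad, sum_three]
  rw [pd_comm hu 1 0, pd_comm hu 2 0, pd_comm hu 2 1]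
  ring

/-! ### Cut-off functions -/

lemma pd_comp_smul_sub {f : E 3 → ℝ} (c : ℝ) (p x : E 3) (i : Fin 3)
    (hf : DifferentiableAt ℝ f (c • (x - p))) :
    pd i (fun y => f (c • (y - p))) x = c * pd i f (c • (x - p)) := by
  have h : HasFDerivAt (fun y : E 3 => c • (y - p)) (c • ContinuousLinearMap.id ℝ (E 3)) x :=
    ((hasFDerivAt_id x).sub_const p).const_smul c
  have := (hf.hasFDerivAt.comp x h).fderiv
  simp only [pd]
  rw [show (fun y => f (c • (y - p))) = f ∘ (fun y : E 3 => c • (y - p)) from rfl, this]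
  simp

lemma pd_comp_add_smul {f : E 3 → ℝ} (c : ℝ) (p x : E 3) (i : Fin 3)
    (hf : DifferentiableAt ℝ f (p + c • x)) :
    pd i (fun y => f (p + c • y)) x = c * pd i f (p + c • x) := by
  have h : HasFDerivAt (fun y : E 3 => p + c • y) (c • ContinuousLinearMap.id ℝ (E 3)) x :=
    ((hasFDerivAt_id x).const_smul c).const_add p
  have := (hf.hasFDerivAt.comp x h).fderiv
  simp only [pd]
  rw [show (fun y => f (p + c • y)) = f ∘ (fun y : E 3 => p + c • y) from rfl, this]
  simp

/-- A fixed bump function. -/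
def bump : ContDiffBump (0 : E 3) := ⟨1, 2, one_pos, one_lt_two⟩

/-- A cut-off function that is one on `ball p R` and vanishes off `ball p (2 * R)`. -/
def cut (p : E 3) (R : ℝ) (y : E 3) : ℝ := bump (R⁻¹ • (y - p))

lemma contDiff_cut {n : ℕ∞} (p : E 3) (R : ℝ) : ContDiff ℝ n (cut p R) :=
  bump.contDiff.comp (contDiff_const.fun_smul (contDiff_id.sub contDiff_const))

lemma contDiff_cut_one (p : E 3) (R : ℝ) : ContDiff ℝ 1 (cut p R) := contDiff_cut (n := 1) p R

lemma cut_nonneg (p : E 3) (R : ℝ) (y : E 3) : 0 ≤ cut p R y := bump.nonneg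

lemma cut_le_one (p : E 3) (R : ℝ) (y : E 3) : cut p R y ≤ 1 := bump.le_one

lemma cut_eq_one {p : E 3} {R : ℝ} (hR : 0 < R) {y : E 3} (hy : y ∈ ball p R) :
    cut p R y = 1 := by
  apply bump.one_of_mem_closedBall
  rw [mem_ball, dist_eq_norm] at hy
  rw [mem_closedBall, dist_zero_right, norm_smul, norm_inv, Real.norm_of_nonneg hR.le,
    inv_mul_le_iff₀ hR]
  change ‖y - p‖ ≤ R * 1
  linarith

lemma cut_eq_zero {p : E 3} {R : ℝ} (hR : 0 < R) {y : E 3} (hy : y ∉ ball p (2 * R)) :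
    cut p R y = 0 := by
  apply bump.zero_of_le_dist
  rw [mem_ball, dist_eq_norm, not_lt] at hy
  rw [dist_zero_right, norm_smul, norm_inv, Real.norm_of_nonneg hR.le]
  change 2 ≤ R⁻¹ * ‖y - p‖
  rw [le_inv_mul_iff₀ hR]; linarith

lemma hasCompactSupport_cut {p : E 3} {R : ℝ} (hR : 0 < R) : HasCompactSupport (cut p R) :=
  HasCompactSupport.intro (isCompact_closedBall p (2 * R)) fun _ hy =>
    cut_eq_zero hR fun h => hy (ball_subset_closedBall h)

lemma pd_cut_eq_zero_of_notMem {p : E 3} {R : ℝ} (hR : 0 < R) {y : E 3}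
    (hy : y ∉ ball p (2 * R)) (i : Fin 3) : pd i (cut p R) y = 0 := by
  have : IsLocalMin (cut p R) y := Eventually.of_forall fun z => by
    rw [cut_eq_zero hR hy]; exact cut_nonneg p R z
  simp [pd, this.fderiv_eq_zero]

lemma pd_cut_eq_zero_of_mem {p : E 3} {R : ℝ} (hR : 0 < R) {y : E 3}
    (hy : y ∈ ball p R) (i : Fin 3) : pd i (cut p R) y = 0 := by
  have : IsLocalMax (cut p R) y := Eventually.of_forall fun z => by
    rw [cut_eq_one hR hy]; exact cut_le_one p R z
  simp [pd, this.fderiv_eq_zero]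

lemma exists_gsq_bump_le : ∃ C : ℝ, 1 ≤ C ∧ ∀ y, gsq bump y ≤ C := by
  have hb : ContDiff ℝ 1 bump := bump.contDiff (n := 1)
  have hc : HasCompactSupport (gsq bump) := by
    refine HasCompactSupport.intro bump.hasCompactSupport.isCompact fun y hy => ?_
    simp only [gsq, pd]
    rw [fderiv_of_notMem_tsupport ℝ hy]; simp
  obtain ⟨C, hC⟩ := (continuous_gsq hb).bounded_above_of_compact_support hc
  exact ⟨max C 1, le_max_right _ _, fun y => (le_abs_self _).trans ((hC y).trans (le_max_left _ _))⟩

/-- A bound for the squared gradient of the fixed bump function. -/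
def cutConst : ℝ := Classical.choose exists_gsq_bump_le

lemma one_le_cutConst : 1 ≤ cutConst := (Classical.choose_spec exists_gsq_bump_le).1

lemma gsq_cut_le {p : E 3} {R : ℝ} (y : E 3) : gsq (cut p R) y ≤ cutConst / R ^ 2 := by
  have hb : Differentiable ℝ bump := (bump.contDiff (n := 1)).differentiable (by norm_num)
  have : gsq (cut p R) y = gsq bump (R⁻¹ • (y - p)) / R ^ 2 := by
    simp only [gsq, Finset.sum_div]
    refine Finset.sum_congr rfl fun i _ => ?_
    rw [show cut p R = fun y => bump (R⁻¹ • (y - p)) from rfl, pd_comp_smul_sub _ _ _ _ (hb _), mul_pow, inv_pow]; ring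
  rw [this]
  gcongr
  exact (Classical.choose_spec exists_gsq_bump_le).2 _

lemma gdot_pow {u v : E 3 → ℝ} {x : E 3} (n : ℕ) (hv : DifferentiableAt ℝ v x) :
    gdot u (fun y => v y ^ n) x = n * v x ^ (n - 1) * gdot u v x := by
  simp only [gdot, pd_pow n hv, Finset.mul_sum]
  exact Finset.sum_congr rfl fun i _ => by ring

lemma gdot_cut_eq_zero {p : E 3} {R : ℝ} (hR : 0 < R) {y : E 3} (u : E 3 → ℝ)
    (hy : y ∉ ball p (2 * R)) : gdot u (cut p R) y = 0 := by
  simp [gdot, pd_cut_eq_zero_of_notMem hR hy]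

lemma gdot_cut_sq_le {p : E 3} {R : ℝ} (y : E 3) (u : E 3 → ℝ) :
    gdot u (cut p R) y ^ 2 ≤ cutConst / R ^ 2 * gsq u y := by
  refine (gdot_sq_le _ _ _).trans ?_
  rw [mul_comm]
  exact mul_le_mul_of_nonneg_right (gsq_cut_le y) (gsq_nonneg _ _)

lemma volume_real_ball (p : E 3) {r : ℝ} (hr : 0 ≤ r) :
    volume.real (ball p r) = r ^ 3 * (Real.pi * 4 / 3) := by
  rw [Measure.real, EuclideanSpace.volume_ball_fin_three, ENNReal.toReal_mul, ENNReal.toReal_pow,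
    ENNReal.toReal_ofReal hr, ENNReal.toReal_ofReal (by positivity)]

lemma setIntegral_ball_const (p : E 3) {r : ℝ} (hr : 0 ≤ r) (c : ℝ) :
    ∫ _ in ball p r, c = r ^ 3 * (Real.pi * 4 / 3) * c := by
  rw [setIntegral_const, volume_real_ball p hr, smul_eq_mul]

/-- `integral_test` with a power of a cut-off function, as an inequality between two balls. -/
lemma test_cut {u : E 3 → ℝ} (hu : ContDiff ℝ 2 u) {g g' : ℝ → ℝ}
    (hg : ∀ t, HasDerivAt g (g' t) t) (hg' : Continuous g') (p : E 3) {R : ℝ} (hR : 0 < R)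
    (n : ℕ) {a b : E 3 → ℝ} (ha : IntegrableOn a (ball p R)) (hb : IntegrableOn b (ball p (2 * R)))
    (h1 : ∀ y ∈ ball p R, a y ≤ (g' (u y) * gsq u y + g (u y) * W' (u y))
      - resid u y * g (u y) + b y)
    (h2 : ∀ y ∈ ball p (2 * R), 0 ≤ cut p R y ^ (n + 2) * (g' (u y) * gsq u y + g (u y) * W' (u y))
      - cut p R y ^ (n + 2) * (resid u y * g (u y))
      + g (u y) * ((n + 2) * cut p R y ^ (n + 1) * gdot u (cut p R) y) + b y) :
    ∫ x in ball p R, a x ≤ ∫ x in ball p (2 * R), b x := by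
  have hcut := contDiff_cut_one p R
  have hφ : ContDiff ℝ 1 (fun y => cut p R y ^ (n + 2)) := hcut.pow _
  have hc : HasCompactSupport (fun y => cut p R y ^ (n + 2)) :=
    (hasCompactSupport_cut hR).comp_left (g := fun t : ℝ => t ^ (n + 2)) (by simp)
  have htest := integral_test hu hg hg' hφ hc
  have hgc : Continuous g := continuous_iff_continuousAt.2 fun t => (hg t).continuousAt
  have hu1 : ContDiff ℝ 1 u := hu.of_le (by norm_num)
  have e : ∀ y, gdot u (fun y => cut p R y ^ (n + 2)) y
      = (n + 2) * cut p R y ^ (n + 1) * gdot u (cut p R) y := fun y => by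
    rw [gdot_pow _ (hcut.differentiable (by norm_num) y)]; push_cast; rfl
  refine setIntegral_ball_le_of_integral_eq_zero (integrableOn_ball ?_ _ _) htest ha hb
    (by linarith) ?_ ?_ ?_
  · have := continuous_gsq hu1
    have := continuous_gdot hu1 hφ
    have := continuous_resid hu
    have := hu1.continuous
    have := hφ.continuous
    have := (contDiff_W' (n := 0)).continuous
    fun_prop
  · intro y hy
    rw [e, gdot_cut_eq_zero hR u hy, cut_eq_zero hR hy]
    simp
  · intro y hy
    rw [e, cut_eq_one hR hy, show gdot u (cut p R) y = 0 by
      simp [gdot, pd_cut_eq_zero_of_mem hR hy]]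
    have := h1 y hy
    simp only [one_pow]
    linarith
  · intro y hy
    rw [e]
    exact h2 y hy

/-! ### Local a priori bounds -/

lemma young_six (L a : ℝ) (hL : 1 ≤ L) (ha : 0 ≤ a) :
    9 * L * a ^ 2 + 40 * L * a ≤ a ^ 3 / 4 + 10 ^ 6 * L ^ 3 := by
  rcases le_total a (80 * L) with h | h
  · have : 9 * L * a ^ 2 ≤ 9 * L * (80 * L) ^ 2 := by gcongr
    have h2 : 40 * L * a ≤ 40 * L * (80 * L) := by gcongr
    have h3 : L ^ 2 ≤ L ^ 3 := pow_le_pow_right₀ hL (by norm_num)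
    have h4 : 0 ≤ a ^ 3 := by positivity
    nlinarith
  · have h1 : 80 * L * a ^ 2 ≤ a * a ^ 2 := by gcongr
    have h2 : 80 * L * a ≤ a * a := by gcongr
    have h3 : 1 * a ^ 2 ≤ L * a ^ 2 := by gcongr
    have h4 : 0 ≤ L ^ 3 := by positivity
    nlinarith

lemma young_gdot {D L G : ℝ} (hD : D ^ 2 ≤ L * G) (hG : 0 ≤ G) (hL : 0 ≤ L) (a b : ℝ) :
    -(2 * a * b * D) ≤ a ^ 2 * G + b ^ 2 * L := by
  refine neg_le_of_neg_le (abs_le_of_sq_le_sq' ?_ (by positivity)).1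
  have h1 : (2 * a * b) ^ 2 * D ^ 2 ≤ (2 * a * b) ^ 2 * (L * G) := by gcongr
  nlinarith [sq_nonneg (a ^ 2 * G - b ^ 2 * L)]

/-- A priori bound for gradient and sixth power. -/
lemma exists_apriori : ∃ C : ℝ, 1 ≤ C ∧ ∀ (u : E 3 → ℝ), ContDiff ℝ 2 u → ∀ p,
    ∫ x in ball p 1, (gsq u x + u x ^ 6) ≤ C * (1 + Fn u p 2) := by
  set L := cutConst with hLdef
  have hL : 1 ≤ L := one_le_cutConst
  refine ⟨2 * (10 ^ 6 * L ^ 3 + 3) * (8 * (Real.pi * 4 / 3) + 1), ?_, ?_⟩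
  · have := Real.pi_pos
    have : 1 ≤ 2 * (10 ^ 6 * L ^ 3 + 3) := by nlinarith [pow_pos (by linarith : 0 < L) 3]
    have : 1 ≤ 8 * (Real.pi * 4 / 3) + 1 := by linarith
    nlinarith
  intro u hu p
  have hu1 : ContDiff ℝ 1 u := hu.of_le (by norm_num)
  have hgc := continuous_gsq hu1
  have hrc := continuous_resid hu
  have huc := hu1.continuous
  set B := 10 ^ 6 * L ^ 3 + 3 with hB
  have key : ∫ x in ball p 1, (1 / 2) * (gsq u x + u x ^ 6)
      ≤ ∫ x in ball p (2 * 1), B * (1 + resid u x ^ 2) := by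
    refine test_cut hu (g := fun t => t ^ 3 + t) (g' := fun t => 3 * t ^ 2 + 1) ?_ (by fun_prop)
      p one_pos 4 (integrableOn_ball (by fun_prop) _ _) (integrableOn_ball (by fun_prop) _ _) ?_ ?_
    · intro t
      exact ((hasDerivAt_pow 3 t).fun_add (hasDerivAt_id t)).congr_deriv (by norm_num)
    · intro y _
      have hG := gsq_nonneg u y
      set f := resid u y
      set t := u y
      set G := gsq u y
      have h1 := young_six L (t ^ 2) hL (by positivity)
      have h2 : f * (t ^ 3 + t) ≤ 2 * f ^ 2 + t ^ 6 / 8 + (f ^ 2 / 2 + t ^ 2 / 2) := by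
        nlinarith [sq_nonneg (4 * f - t ^ 3), sq_nonneg (f - t)]
      have h3 : 0 ≤ t ^ 2 * G := by positivity
      have h4 : 0 ≤ (L - 1) * t ^ 2 := mul_nonneg (by linarith) (by positivity)
      have h5 : 0 ≤ L * (t ^ 2) ^ 2 := by positivity
      have h6 : 0 ≤ L ^ 3 * f ^ 2 := by positivity
      simp only [W', hB]
      nlinarith [sq_nonneg t, sq_nonneg f, pow_nonneg (sq_nonneg t) 3]
    · intro y _
      have hG := gsq_nonneg u y
      have hD := gdot_cut_sq_le (p := p) (R := 1) y u
      have hz0 := cut_nonneg p 1 y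
      have hz1 := cut_le_one p 1 y
      norm_num at hD
      rw [← hLdef] at hD
      set f := resid u y
      set t := u y
      set G := gsq u y
      set D := gdot u (cut p 1) y
      set z := cut p 1 y
      have h1 := young_six L (z ^ 2 * t ^ 2) hL (by positivity)
      have h2 : f * (t ^ 3 + t) ≤ 2 * f ^ 2 + t ^ 6 / 8 + (f ^ 2 / 2 + t ^ 2 / 2) := by
        nlinarith [sq_nonneg (4 * f - t ^ 3), sq_nonneg (f - t)]
      have h2' : z ^ 6 * (f * (t ^ 3 + t)) ≤ z ^ 6 * (2 * f ^ 2 + t ^ 6 / 8 + (f ^ 2 / 2 + t ^ 2 / 2)) := by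
        gcongr
      have hzf : z ^ 6 * f ^ 2 ≤ 1 * f ^ 2 := by
        gcongr; exact pow_le_one₀ hz0 hz1
      have hzt : z ^ 6 * t ^ 2 ≤ z ^ 2 * t ^ 2 := by
        gcongr ?_ * _; exact pow_le_pow_of_le_one hz0 hz1 (by norm_num)
      have hzt4 : z ^ 4 * t ^ 2 ≤ z ^ 2 * t ^ 2 := by
        gcongr ?_ * _; exact pow_le_pow_of_le_one hz0 hz1 (by norm_num)
      have h3 := young_gdot hD hG (by linarith) (z ^ 3 * t) (3 * z ^ 2 * t ^ 2)
      have h4 := young_gdot hD hG (by linarith) (z ^ 3 / 2) (6 * z ^ 2 * t)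
      have h5 : L * (z ^ 4 * t ^ 2) ≤ L * (z ^ 2 * t ^ 2) := by gcongr
      have h6 : 0 ≤ L ^ 3 * f ^ 2 := by positivity
      have h7 : 0 ≤ (L - 1) * (z ^ 2 * t ^ 2) := mul_nonneg (by linarith) (by positivity)
      have h8 : 0 ≤ z ^ 6 * G := by positivity
      have h11 : 0 ≤ z ^ 2 * t ^ 2 := by positivity
      have h9 : 0 ≤ z ^ 6 * t ^ 2 * G := by positivity
      have h10 : 0 ≤ (z ^ 2 * t ^ 2) ^ 3 := by positivity
      simp only [W', hB]
      push_cast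
      linarith [sq_nonneg f, show z ^ 6 * ((3 * t ^ 2 + 1) * G + (t ^ 3 + t) * (t ^ 3 - t))
          = 3 * (z ^ 6 * t ^ 2 * G) + z ^ 6 * G + (z ^ 2 * t ^ 2) ^ 3 - z ^ 6 * t ^ 2 by ring,
        show z ^ 6 * (2 * f ^ 2 + t ^ 6 / 8 + (f ^ 2 / 2 + t ^ 2 / 2))
          = 5 / 2 * (z ^ 6 * f ^ 2) + (z ^ 2 * t ^ 2) ^ 3 / 8 + z ^ 6 * t ^ 2 / 2 by ring,
        show (t ^ 3 + t) * ((4 + 2) * z ^ 5 * D)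
          = 2 * (z ^ 3 * t) * (3 * z ^ 2 * t ^ 2) * D + 2 * (z ^ 3 / 2) * (6 * z ^ 2 * t) * D by ring,
        show (10 ^ 6 * L ^ 3 + 3) * (1 + f ^ 2)
          = 10 ^ 6 * L ^ 3 + 3 + 10 ^ 6 * (L ^ 3 * f ^ 2) + 3 * f ^ 2 by ring]
  have hBn : 0 ≤ B := by positivity
  rw [integral_const_mul, integral_const_mul, integral_add (integrableOn_ball continuous_const _ _)
    (integrableOn_ball (by fun_prop) _ _), setIntegral_ball_const _ (by norm_num)] at key
  have hF : ∫ x in ball p (2 * 1), resid u x ^ 2 = Fn u p 2 := by norm_num [Fn]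
  rw [hF] at key
  have hFn := Fn_nonneg u p 2
  have hpi := Real.pi_pos
  have : 0 ≤ B * (1 + Real.pi * Fn u p 2) := by positivity
  have h1 : 0 ≤ B * Real.pi := by positivity
  have h2 : 0 ≤ B * Real.pi * Fn u p 2 := by positivity
  nlinarith

/-! ### Gradient bound where `u` is close to the wells -/

/-- A smooth truncation used as a test function near the wells. -/
def wellTest (b t : ℝ) : ℝ := t * ((t ^ 2 - 1) + √((t ^ 2 - 1) ^ 2 + b ^ 2) - b)

/-- The derivative of `wellTest`. -/
def wellTest' (b t : ℝ) : ℝ :=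
  ((t ^ 2 - 1) + √((t ^ 2 - 1) ^ 2 + b ^ 2) - b)
    + 2 * t ^ 2 * (1 + (t ^ 2 - 1) / √((t ^ 2 - 1) ^ 2 + b ^ 2))

lemma hasDerivAt_wellTest {b : ℝ} (hb : 0 < b) (t : ℝ) :
    HasDerivAt (wellTest b) (wellTest' b t) t := by
  have hq : (t ^ 2 - 1) ^ 2 + b ^ 2 ≠ 0 := by positivity
  have h1 : HasDerivAt (fun t : ℝ => t ^ 2 - 1) (2 * t) t := by
    simpa using (hasDerivAt_pow 2 t).sub_const 1
  have h2 := ((h1.fun_pow 2).add_const (b ^ 2)).sqrt hq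
  have h3 := (hasDerivAt_id t).fun_mul ((h1.fun_add h2).sub_const b)
  refine h3.congr_deriv ?_
  have : √((t ^ 2 - 1) ^ 2 + b ^ 2) ≠ 0 := by positivity
  simp only [wellTest', id]
  field_simp
  push_cast
  ring

lemma continuous_wellTest' {b : ℝ} (hb : 0 < b) : Continuous (wellTest' b) := by
  unfold wellTest'
  refine Continuous.add (by fun_prop) (Continuous.mul (by fun_prop) (continuous_const.add ?_))
  exact Continuous.div (by fun_prop) (by fun_prop) fun t => by positivity

lemma wellTest_bounds {b : ℝ} (hb : 0 < b) (hb8 : b ≤ 1 / 8) (t : ℝ) :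
    0 ≤ wellTest b t * W' t ∧ wellTest b t ^ 2 ≤ 2 * (wellTest b t * W' t) ∧
      -b ≤ wellTest' b t ∧ (1 - b ≤ t ^ 2 → 1 / 4 ≤ wellTest' b t) := by
  set s := t ^ 2 - 1 with hs
  set q := √(s ^ 2 + b ^ 2) with hq
  have hq0 : 0 < q := by positivity
  have hqq : q ^ 2 = s ^ 2 + b ^ 2 := Real.sq_sqrt (by positivity)
  have hsq : |s| ≤ q := Real.abs_le_sqrt (by nlinarith)
  have hbq : b ≤ q := Real.le_sqrt_of_sq_le (by nlinarith)
  have hqb : q - b ≤ |s| := by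
    have : q ≤ |s| + b := by
      refine abs_le_of_sq_le_sq' ?_ (by positivity) |>.2
      nlinarith [abs_nonneg s, sq_abs s]
    linarith
  have h1 : 0 ≤ s * (s + q - b) := by
    rcases le_total 0 s with h | h
    · exact mul_nonneg h (by linarith)
    · rw [abs_of_nonpos h] at hqb
      exact mul_nonneg_of_nonpos_of_nonpos h (by linarith)
  have h2 : (s + q - b) ^ 2 ≤ 2 * (s * (s + q - b)) := by
    rcases le_total 0 s with h | h
    · rw [abs_of_nonneg h] at hqb; nlinarith
    · rw [abs_of_nonpos h] at hqb; nlinarith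
  have e : wellTest b t * W' t = t ^ 2 * (s * (s + q - b)) := by
    simp only [wellTest, W', ← hs, ← hq]; rw [hs]; ring
  have e2 : wellTest' b t = (s + q - b) + 2 * t ^ 2 * (1 + s / q) := rfl
  have hk : 0 ≤ 1 + s / q := by
    rw [show 1 + s / q = (q + s) / q by field_simp]
    exact div_nonneg (by linarith [neg_abs_le s]) hq0.le
  refine ⟨?_, ?_, ?_, ?_⟩
  · rw [e]; positivity
  · rw [e, show wellTest b t ^ 2 = t ^ 2 * (s + q - b) ^ 2 by simp only [wellTest, ← hs, ← hq]; ring]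
    nlinarith [sq_nonneg t]
  · rw [e2]
    have : 0 ≤ 2 * t ^ 2 * (1 + s / q) := by positivity
    linarith [neg_abs_le s]
  · intro ht
    rw [e2]
    have hsb : -b ≤ s := by rw [hs]; linarith
    have h5 : (29 : ℝ) / 100 ≤ 1 + s / q := by
      rw [show 1 + s / q = (q + s) / q by field_simp, le_div_iff₀ hq0]
      rcases le_total 0 s with h | h
      · linarith
      · have : -s ≤ 71 / 100 * q := by
          refine abs_le_of_sq_le_sq' ?_ (by positivity) |>.2
          nlinarith
        linarith
    have h6 : 2 * (7 / 8) * (29 / 100) ≤ 2 * t ^ 2 * (1 + s / q) := by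
      have : 7 / 8 ≤ t ^ 2 := by linarith
      gcongr
    have h7 : -(1/8) ≤ s + q - b := by linarith [neg_abs_le s]
    linarith

/-- The energy in the region where `u` is close to the wells is controlled up to a small factor. -/
lemma exists_gsq_near_wells : ∃ C : ℝ, 0 < C ∧ ∀ (u : E 3 → ℝ), ContDiff ℝ 2 u →
    ∀ p b r, 0 < b → b ≤ 1 / 8 → 1 / b ≤ r →
    ∫ x in ball p r, {x | 1 - b ≤ u x ^ 2}.indicator (gsq u) x
      ≤ C * (b * En u p (2 * r) + Fn u p (2 * r)) := by
  have hL := one_le_cutConst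
  set L := cutConst with hLdef
  refine ⟨4 * (8 * L + 4), by linarith, ?_⟩
  intro u hu p b r hb hb8 hr
  have hr0 : 0 < r := lt_of_lt_of_le (by positivity) hr
  have hu1 : ContDiff ℝ 1 u := hu.of_le (by norm_num)
  have hgc := continuous_gsq hu1
  have hrc := continuous_resid hu
  have huc := hu1.continuous
  have hS : MeasurableSet {x | 1 - b ≤ u x ^ 2} :=
    (isClosed_le continuous_const (by fun_prop)).measurableSet
  have hLr : L / r ^ 2 ≤ L * b := by
    have h1 : 1 ≤ r * b := (div_le_iff₀ hb).1 hr
    rw [div_le_iff₀ (by positivity)]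
    have : 1 ≤ r := le_trans (by rw [le_div_iff₀ hb]; linarith) hr
    have : 1 ≤ b * r ^ 2 := by nlinarith
    nlinarith
  have key : ∫ x in ball p r, (1 / 4) * {x | 1 - b ≤ u x ^ 2}.indicator (gsq u) x
      ≤ ∫ x in ball p (2 * r), (((4 * L + 1) * b) * gsq u x + resid u x ^ 2) := by
    refine test_cut hu (hasDerivAt_wellTest hb) (continuous_wellTest' hb) p hr0 0
      (((integrableOn_ball hgc _ _).indicator hS).const_mul _)
      (integrableOn_ball (by fun_prop) _ _) ?_ ?_
    · intro y _
      obtain ⟨h1, h2, h3, h4⟩ := wellTest_bounds hb hb8 (u y)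
      have hG := gsq_nonneg u y
      have h5 : resid u y * wellTest b (u y) ≤ resid u y ^ 2 + wellTest b (u y) ^ 2 / 4 := by
        nlinarith [sq_nonneg (resid u y - wellTest b (u y) / 2)]
      have hLb : 0 ≤ L * b * gsq u y := by positivity
      have h6 : 1 / 4 * {x | 1 - b ≤ u x ^ 2}.indicator (gsq u) y
          ≤ wellTest' b (u y) * gsq u y + b * gsq u y := by
        by_cases hy : y ∈ {x | 1 - b ≤ u x ^ 2}
        · rw [indicator_of_mem hy]; nlinarith [h4 hy]
        · rw [indicator_of_notMem hy]; nlinarith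
      nlinarith
    · intro y _
      obtain ⟨h1, h2, h3, -⟩ := wellTest_bounds hb hb8 (u y)
      have hG := gsq_nonneg u y
      have hD := gdot_cut_sq_le (p := p) (R := r) y u
      rw [← hLdef] at hD
      have hD' : gdot u (cut p r) y ^ 2 ≤ L * b * gsq u y :=
        hD.trans (mul_le_mul_of_nonneg_right hLr hG)
      have hz0 := cut_nonneg p r y
      have hz1 := cut_le_one p r y
      have hz2 : cut p r y ^ 2 ≤ 1 := pow_le_one₀ hz0 hz1
      set z := cut p r y
      set D := gdot u (cut p r) y
      set f := resid u y
      set g := wellTest b (u y)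
      set G := gsq u y
      have h5 : z ^ 2 * (f * g) ≤ z ^ 2 * (f ^ 2 + g ^ 2 / 4) := by
        gcongr; nlinarith [sq_nonneg (f - g / 2)]
      have h6 : -(g * (2 * z * D)) ≤ z ^ 2 * g ^ 2 / 4 + 4 * D ^ 2 := by
        nlinarith [sq_nonneg (z * g / 2 + 2 * D)]
      have h7 : z ^ 2 * g ^ 2 ≤ z ^ 2 * (2 * (g * W' (u y))) := by gcongr
      have h8 : z ^ 2 * (-b * G) ≤ z ^ 2 * (wellTest' b (u y) * G) := by gcongr
      have h9 : z ^ 2 * (b * G) ≤ 1 * (b * G) := by gcongr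
      have h10 : z ^ 2 * f ^ 2 ≤ 1 * f ^ 2 := by gcongr
      have h11 : z ^ (0 + 2) * (wellTest' b (u y) * G + g * W' (u y))
          = z ^ 2 * (wellTest' b (u y) * G) + z ^ 2 * (g * W' (u y)) := by ring
      have h12 : g * (((0 : ℕ) + 2) * z ^ (0 + 1) * D) = g * (2 * z * D) := by push_cast; ring
      rw [h11, h12, zero_add]
      linarith
  rw [integral_const_mul, integral_add (integrableOn_ball (by fun_prop) _ _)
    (integrableOn_ball (by fun_prop) _ _), integral_const_mul] at key
  have hE : ∫ x in ball p (2 * r), gsq u x ≤ 2 * En u p (2 * r) := by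
    rw [En, ← integral_const_mul]
    refine setIntegral_mono (integrableOn_ball hgc _ _)
      (integrableOn_ball ((continuous_eden hu).const_mul 2) _ _) fun x => ?_
    have := W_nonneg (u x)
    simp only [eden]; linarith
  have h1 : ((4 * L + 1) * b) * ∫ x in ball p (2 * r), gsq u x
      ≤ ((4 * L + 1) * b) * (2 * En u p (2 * r)) := by gcongr
  have hF : ∫ x in ball p (2 * r), resid u x ^ 2 = Fn u p (2 * r) := rfl
  rw [hF] at key
  have h2 := Fn_nonneg u p (2 * r)
  have h3 : 0 ≤ b * En u p (2 * r) := mul_nonneg hb.le (En_nonneg _ _ _)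
  nlinarith

/-! ### Averages against a kernel -/

/-- The average of `u` around `x` at scale `s` with kernel `k`. -/
def av (k u : E 3 → ℝ) (s : ℝ) (x : E 3) : ℝ := ∫ z, k z * u (x + s • z)

/-- Kernels: continuous functions vanishing off the unit ball. -/
structure IsKer (k : E 3 → ℝ) : Prop where
  cont : Continuous k
  zero : ∀ z, z ∉ ball (0 : E 3) 1 → k z = 0

lemma IsKer.hasCompactSupport {k : E 3 → ℝ} (hk : IsKer k) : HasCompactSupport k :=
  HasCompactSupport.intro (isCompact_closedBall 0 1) fun z hz =>
    hk.zero z fun h => hz (ball_subset_closedBall h)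

lemma IsKer.integrable_mul {k f : E 3 → ℝ} (hk : IsKer k) (hf : Continuous f) :
    Integrable fun z => k z * f z :=
  (hk.cont.mul hf).integrable_of_hasCompactSupport hk.hasCompactSupport.mul_right

lemma hasDerivAt_param {k : E 3 → ℝ} (hk : IsKer k) {G G' : ℝ → E 3 → ℝ}
    (hG : Continuous (Function.uncurry G)) (hG' : Continuous (Function.uncurry G'))
    (hd : ∀ s z, HasDerivAt (fun s => G s z) (G' s z) s) (s : ℝ) :
    HasDerivAt (fun s => ∫ z, k z * G s z) (∫ z, k z * G' s z) s := by
  have hcG : ∀ s, Continuous (G s) := fun s => hG.comp (by fun_prop : Continuous fun z => (s, z))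
  have hcG' : ∀ s, Continuous (G' s) := fun s => hG'.comp (by fun_prop : Continuous fun z => (s, z))
  obtain ⟨M, hM⟩ := ((isCompact_closedBall s 1).prod (isCompact_closedBall (0 : E 3) 1))
    |>.exists_bound_of_continuousOn hG'.continuousOn
  refine (hasDerivAt_integral_of_dominated_loc_of_deriv_le (s := ball s 1)
    (bound := fun z => |k z| * M) (F' := fun s z => k z * G' s z) (ball_mem_nhds s one_pos)
    ?_ ?_ ?_ ?_ ?_ ?_).2
  · exact Eventually.of_forall fun s => (hk.cont.mul (hcG s)).aestronglyMeasurable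
  · exact hk.integrable_mul (hcG s)
  · exact (hk.cont.mul (hcG' s)).aestronglyMeasurable
  · refine ae_of_all _ fun z s' hs' => ?_
    rw [Real.norm_eq_abs, abs_mul]
    by_cases hz : z ∈ ball (0 : E 3) 1
    · gcongr
      exact hM (s', z) ⟨ball_subset_closedBall hs', ball_subset_closedBall hz⟩
    · simp [hk.zero z hz]
  · exact (hk.cont.abs.integrable_of_hasCompactSupport
      (hk.hasCompactSupport.comp_left abs_zero)).mul_const M
  · exact ae_of_all _ fun z s' _ => (hd s' z).const_mul _

lemma av_zero {k u : E 3 → ℝ} (hk : ∫ z, k z = 1) (x : E 3) : av k u 0 x = u x := by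
  simp [av, integral_mul_const, hk]

lemma hasDerivAt_line {u : E 3 → ℝ} (hu : ContDiff ℝ 1 u) (x v : E 3) (t : ℝ) :
    HasDerivAt (fun t : ℝ => u (x + t • v)) (∑ i, v i * pd i u (x + t • v)) t := by
  have h1 : HasDerivAt (fun t : ℝ => x + t • v) v t := by
    simpa using ((hasDerivAt_id t).smul_const v).const_add x
  have h2 := ((hu.differentiable (by norm_num)) (x + t • v)).hasFDerivAt.comp_hasDerivAt t h1
  refine h2.congr_deriv ?_
  conv_lhs => rw [show v = ∑ i, v i • EuclideanSpace.single i (1 : ℝ) from by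
    ext j; simp [Finset.sum_apply, Pi.single_apply]]
  rw [map_sum]
  refine Finset.sum_congr rfl fun i _ => ?_
  rw [map_smul, smul_eq_mul, pd, ← show v = ∑ i, v i • EuclideanSpace.single i (1 : ℝ) from by
    ext j; simp [Finset.sum_apply, Pi.single_apply]]

lemma av_pd_eq {k u : E 3 → ℝ} (hk : IsKer k) (hk1 : ContDiff ℝ 1 k) (hu : ContDiff ℝ 1 u)
    (s : ℝ) (x : E 3) (i : Fin 3) : s * av k (pd i u) s x = - av (pd i k) u s x := by
  have hus : ContDiff ℝ 1 (fun z : E 3 => u (x + s • z)) :=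
    hu.comp (contDiff_const.add (contDiff_const.fun_smul contDiff_id))
  have h0 := integral_pd_eq_zero (hk1.mul hus) hk.hasCompactSupport.mul_right i
  have e : ∀ z, pd i (fun z => k z * u (x + s • z)) z
      = pd i k z * u (x + s • z) + s * (k z * pd i u (x + s • z)) := fun z => by
    rw [pd_mul (hk1.differentiable (by norm_num) z) (hus.differentiable (by norm_num) z),
      pd_comp_add_smul _ _ _ _ (hu.differentiable (by norm_num) _)]
    ring
  have hpc := continuous_pd hu i
  have huc := hu.continuous
  simp only [e] at h0
  rw [integral_add, integral_const_mul] at h0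
  · simp only [av]; linarith
  · exact ((continuous_pd hk1 i).mul (by fun_prop)).integrable_of_hasCompactSupport
      (hasCompactSupport_pd hk.hasCompactSupport i).mul_right
  · exact (hk.integrable_mul (by fun_prop)).const_mul s

lemma IsKer.pd {k : E 3 → ℝ} (hk : IsKer k) (hk1 : ContDiff ℝ 1 k) (hk0 : ∀ z, 0 ≤ k z)
    (i : Fin 3) : IsKer (pd i k) where
  cont := continuous_pd hk1 i
  zero z hz := by
    have : IsLocalMin k z := Eventually.of_forall fun y => by rw [hk.zero z hz]; exact hk0 y
    simp [_root_.pd, this.fderiv_eq_zero]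

lemma abs_av_le {k : E 3 → ℝ} (hk : IsKer k) {f : E 3 → ℝ} (hf : Continuous f) {s M : ℝ} (hs : 0 ≤ s)
    {x : E 3} (hM : ∀ y ∈ closedBall x s, |f y| ≤ M) : |av k f s x| ≤ (∫ z, |k z|) * M := by
  have hM' : ∀ z, |k z * f (x + s • z)| ≤ |k z| * M := fun z => by
    rw [abs_mul]
    by_cases hz : z ∈ ball (0 : E 3) 1
    · gcongr
      refine hM _ ?_
      rw [mem_closedBall, dist_eq_norm, add_sub_cancel_left, norm_smul, Real.norm_of_nonneg hs]
      rw [mem_ball, dist_zero_right] at hz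
      nlinarith
    · simp [hk.zero z hz]
  rw [← integral_mul_const]
  refine (abs_integral_le_integral_abs).trans (integral_mono ?_ ?_ hM')
  · exact (hk.integrable_mul (f := fun z => f (x + s • z)) (by fun_prop)).abs
  · exact (hk.cont.abs.integrable_of_hasCompactSupport
      (hk.hasCompactSupport.comp_left abs_zero)).mul_const M

lemma setIntegral_ball_comp_smul (f : E 3 → ℝ) {s : ℝ} (hs : 0 < s) (x : E 3) (r : ℝ) :
    ∫ z in ball (0 : E 3) r, f (x + s • z) = (s ^ 3)⁻¹ * ∫ y in ball x (s * r), f y := by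
  have h1 := Measure.integral_comp_smul (volume : Measure (E 3))
    (fun y => (ball x (s * r)).indicator f (x + y)) s
  have h2 : (fun z : E 3 => (ball x (s * r)).indicator f (x + s • z))
      = (ball (0 : E 3) r).indicator (fun z => f (x + s • z)) := by
    ext z
    have : x + s • z ∈ ball x (s * r) ↔ z ∈ ball (0 : E 3) r := by
      rw [mem_ball, dist_eq_norm, add_sub_cancel_left, norm_smul, Real.norm_of_nonneg hs.le,
        mem_ball, dist_zero_right, mul_lt_mul_iff_right₀ hs]
    by_cases hz : z ∈ ball (0 : E 3) r
    · rw [indicator_of_mem hz, indicator_of_mem (this.2 hz)]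
    · rw [indicator_of_notMem hz, indicator_of_notMem (fun h => hz (this.1 h))]
  rw [h2, integral_indicator measurableSet_ball,
    integral_add_left_eq_self (fun y => (ball x (s * r)).indicator f y) x,
    integral_indicator measurableSet_ball] at h1
  rw [h1]
  simp [abs_of_pos, hs]

lemma exists_abs_av_le_L2 {k : E 3 → ℝ} (hk : IsKer k) : ∃ C : ℝ, 1 ≤ C ∧ ∀ (f : E 3 → ℝ),
    Continuous f → ∀ q B x, 0 < q → 0 < B → ∫ y in ball x (q ^ 2), f y ^ 2 ≤ B ^ 2 →
    |av k f (q ^ 2) x| ≤ C * (B / q ^ 3) := by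
  set N := ∫ z in ball (0 : E 3) 1, k z ^ 2 with hN
  have hN0 : 0 ≤ N := setIntegral_nonneg measurableSet_ball fun z _ => sq_nonneg _
  refine ⟨N + 1, by linarith, fun f hf q B x hq hB h => ?_⟩
  have hs : 0 < q ^ 2 := by positivity
  set l := q ^ 3 / B with hl
  have hl0 : 0 < l := by positivity
  have e1 : av k f (q ^ 2) x = ∫ z in ball (0 : E 3) 1, k z * f (x + q ^ 2 • z) :=
    (setIntegral_eq_integral_of_forall_compl_eq_zero fun z hz => by simp [hk.zero z hz]).symm
  have e2 := setIntegral_ball_comp_smul (fun y => f y ^ 2) hs x 1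
  rw [mul_one] at e2
  have hkc := hk.cont
  have e3 : ∫ z in ball (0 : E 3) 1, |k z * f (x + q ^ 2 • z)|
      ≤ ∫ z in ball (0 : E 3) 1, (l⁻¹ * k z ^ 2 + l * f (x + q ^ 2 • z) ^ 2) := by
    refine setIntegral_mono (integrableOn_ball (by fun_prop) _ _)
      (integrableOn_ball (by fun_prop) _ _) fun z => ?_
    change |k z * f (x + q ^ 2 • z)| ≤ l⁻¹ * k z ^ 2 + l * f (x + q ^ 2 • z) ^ 2
    set a := k z
    set b := f (x + q ^ 2 • z)
    have h1 := sq_nonneg (|a| - l * |b|)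
    have h2 : l⁻¹ * a ^ 2 + l * b ^ 2 = l⁻¹ * (|a| ^ 2 + (l * |b|) ^ 2) := by
      rw [mul_pow, sq_abs, sq_abs]; field_simp
    have h3 : |a| * |b| = l⁻¹ * (|a| * (l * |b|)) := by field_simp
    rw [abs_mul, h2, h3]
    gcongr
    nlinarith [mul_nonneg (abs_nonneg a) (mul_nonneg hl0.le (abs_nonneg b))]
  rw [integral_add (integrableOn_ball (by fun_prop) _ _) (integrableOn_ball (by fun_prop) _ _),
    integral_const_mul, integral_const_mul, ← hN, e2] at e3
  rw [e1]
  refine (abs_integral_le_integral_abs).trans (e3.trans ?_)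
  calc l⁻¹ * N + l * (((q ^ 2) ^ 3)⁻¹ * ∫ y in ball x (q ^ 2), f y ^ 2)
      ≤ l⁻¹ * N + l * (((q ^ 2) ^ 3)⁻¹ * B ^ 2) := by gcongr
    _ = (N + 1) * (B / q ^ 3) := by rw [hl]; field_simp

lemma contDiff_av {k u : E 3 → ℝ} (hk : IsKer k) {n : ℕ∞} (hkn : ContDiff ℝ n k)
    (hu : Continuous u) {s : ℝ} (hs : 0 < s) : ContDiff ℝ n (av k u s) := by
  set K : E 3 → ℝ := fun t => (s ^ 3)⁻¹ * k ((-s)⁻¹ • t) with hK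
  have hKn : ContDiff ℝ n K :=
    contDiff_const.mul (hkn.comp (contDiff_const.fun_smul contDiff_id))
  have hKc : HasCompactSupport K :=
    (hk.hasCompactSupport.comp_smul (inv_ne_zero (neg_ne_zero.2 hs.ne'))).mul_left
  have e : av k u s = convolution K u (ContinuousLinearMap.mul ℝ ℝ) volume := by
    ext x
    have h1 := Measure.integral_comp_smul (volume : Measure (E 3))
      (fun t => k ((-s)⁻¹ • t) * u (x - t)) (-s)
    have h2 : |((-s) ^ Module.finrank ℝ (E 3))⁻¹| = (s ^ 3)⁻¹ := by
      rw [abs_inv, abs_pow, abs_neg, abs_of_pos hs]; simp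
    rw [h2] at h1
    simp only [convolution, hK, ContinuousLinearMap.mul_apply', mul_assoc]
    rw [integral_const_mul, ← smul_eq_mul, ← h1, av]
    congr 1; ext z
    rw [smul_smul, inv_mul_cancel₀ (neg_ne_zero.2 hs.ne')]
    simp
  rw [e]
  exact hKc.contDiff_convolution_left _ hKn hu.locallyIntegrable

lemma pd_av {k u : E 3 → ℝ} (hk : IsKer k) (hk1 : ContDiff ℝ 1 k) (hu : ContDiff ℝ 1 u)
    {s : ℝ} (hs : 0 < s) (i : Fin 3) (x : E 3) : pd i (av k u s) x = av k (pd i u) s x := by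
  have hd : DifferentiableAt ℝ (av k u s) x :=
    (contDiff_av hk (n := 1) hk1 hu.continuous hs).differentiable (by norm_num) x
  have h1 : HasDerivAt (fun t : ℝ => av k u s (x + t • EuclideanSpace.single i (1 : ℝ)))
      (pd i (av k u s) x) 0 := by
    have h0 : HasDerivAt (fun t : ℝ => x + t • EuclideanSpace.single i (1 : ℝ))
        (EuclideanSpace.single i (1 : ℝ)) 0 := by
      simpa using ((hasDerivAt_id (0 : ℝ)).smul_const (EuclideanSpace.single i (1 : ℝ))).const_add x
    have hd' : DifferentiableAt ℝ (av k u s) (x + (0 : ℝ) • EuclideanSpace.single i (1 : ℝ)) := by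
      simpa using hd
    have := hd'.hasFDerivAt.comp_hasDerivAt (0 : ℝ) h0
    simp only [zero_smul, add_zero] at this
    exact this
  have hpc := continuous_pd hu i
  have huc := hu.continuous
  have h2 := hasDerivAt_param hk
    (G := fun t z => u (x + t • EuclideanSpace.single i (1 : ℝ) + s • z))
    (G' := fun t z => pd i u (x + t • EuclideanSpace.single i (1 : ℝ) + s • z))
    (by simp only [Function.uncurry_def]; fun_prop)
    (by simp only [Function.uncurry_def]; fun_prop)
    (fun t z => by
      have := hasDerivAt_line hu (x + s • z) (EuclideanSpace.single i (1 : ℝ)) t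
      have e : ∀ t : ℝ, x + t • EuclideanSpace.single i (1 : ℝ) + s • z
        = x + s • z + t • EuclideanSpace.single i (1 : ℝ) := fun t => by abel
      simp only [e]
      refine this.congr_deriv ?_
      rw [Finset.sum_eq_single i]
      · simp
      · intro j _ hj; simp [hj]
      · simp) 0
  have := h1.unique h2
  simpa [av] using this

/-! ### The radial kernels -/

/-- The unnormalised kernel for the Laplacian. -/
def psi0 (z : E 3) : ℝ := expNegInvGlue (1 - ∑ i, z i ^ 2)

/-- The unnormalised averaging kernel. -/
def phi0 (z : E 3) : ℝ := 2 * deriv expNegInvGlue (1 - ∑ i, z i ^ 2)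

lemma contDiff_one_sub_sq {n : WithTop ℕ∞} : ContDiff ℝ n (fun z : E 3 => 1 - ∑ i, z i ^ 2) :=
  contDiff_const.sub (ContDiff.sum fun i _ => (contDiff_coord i).pow 2)

lemma contDiff_psi0 {n : ℕ∞} : ContDiff ℝ n psi0 :=
  expNegInvGlue.contDiff.comp contDiff_one_sub_sq

lemma contDiff_deriv_glue {n : ℕ} : ContDiff ℝ n (deriv expNegInvGlue) := by
  have h : ContDiff ℝ ((n + 1 : ℕ) : ℕ∞) expNegInvGlue := expNegInvGlue.contDiff
  have h' : ContDiff ℝ (n + 1) expNegInvGlue := by exact_mod_cast h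
  exact (contDiff_succ_iff_deriv.1 h').2.2

lemma contDiff_phi0 {n : ℕ} : ContDiff ℝ n phi0 :=
  contDiff_const.mul (contDiff_deriv_glue.comp contDiff_one_sub_sq)

lemma one_sub_sq_nonpos {z : E 3} (hz : z ∉ ball (0 : E 3) 1) : 1 - ∑ i, z i ^ 2 ≤ 0 := by
  rw [mem_ball, dist_zero_right, not_lt] at hz
  have h := EuclideanSpace.norm_sq_eq z
  simp only [Real.norm_eq_abs, sq_abs] at h
  rw [← h]; nlinarith

lemma deriv_glue_of_nonpos {t : ℝ} (ht : t ≤ 0) : deriv expNegInvGlue t = 0 := by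
  have : IsLocalMin expNegInvGlue t := Eventually.of_forall fun y => by
    rw [expNegInvGlue.zero_of_nonpos ht]; exact expNegInvGlue.nonneg y
  exact this.deriv_eq_zero

lemma deriv_glue_nonneg (t : ℝ) : 0 ≤ deriv expNegInvGlue t := expNegInvGlue.monotone.deriv_nonneg

lemma isKer_psi0 : IsKer psi0 where
  cont := (contDiff_psi0 (n := 0)).continuous
  zero _ hz := expNegInvGlue.zero_of_nonpos (one_sub_sq_nonpos hz)

lemma isKer_phi0 : IsKer phi0 where
  cont := (contDiff_phi0 (n := 0)).continuous
  zero z hz := by simp [phi0, deriv_glue_of_nonpos (one_sub_sq_nonpos hz)]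

lemma phi0_nonneg (z : E 3) : 0 ≤ phi0 z := mul_nonneg zero_le_two (deriv_glue_nonneg _)

lemma pd_psi0 (i : Fin 3) (z : E 3) : pd i psi0 z = - z i * phi0 z := by
  have hd : DifferentiableAt ℝ expNegInvGlue (1 - ∑ i, z i ^ 2) :=
    (expNegInvGlue.contDiff (n := 1)).differentiable (by norm_num) _
  have hc : ∀ j, DifferentiableAt ℝ (fun y : E 3 => y j) z := fun j =>
    (contDiff_coord (n := 1) j).differentiable (by norm_num) z
  have h := pd_comp (i := i) (x := z) (f := fun z : E 3 => 1 - ∑ i, z i ^ 2) hd.hasDerivAt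
    ((contDiff_one_sub_sq (n := 1)).differentiable (by norm_num) z)
  rw [show psi0 = fun z => expNegInvGlue (1 - ∑ i, z i ^ 2) from rfl, h,
    pd_sub (differentiableAt_const _) (DifferentiableAt.fun_sum fun j _ => (hc j).fun_pow 2),
    pd_const, pd_sum _ (fun j _ => (hc j).fun_pow 2)]
  simp only [pd_pow 2 (hc _), pd_coord, phi0]
  simp
  ring

lemma integral_phi0_pos : 0 < ∫ z, phi0 z := by
  obtain ⟨t, ht0, ht1, ht⟩ : ∃ t : ℝ, 0 < t ∧ t < 1 ∧ deriv expNegInvGlue t ≠ 0 := by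
    by_contra! h
    have hd := (expNegInvGlue.contDiff (n := 1)).differentiable (by norm_num)
    obtain ⟨c, hc, hc'⟩ := exists_deriv_eq_slope expNegInvGlue (a := 0) (b := 1) one_pos
      hd.continuous.continuousOn hd.differentiableOn
    rw [h c hc.1 hc.2, expNegInvGlue.zero] at hc'
    have := expNegInvGlue.pos_of_pos one_pos
    norm_num at hc'
    linarith
  refine isKer_phi0.cont.integral_pos_of_hasCompactSupport_nonneg_nonzero
    isKer_phi0.hasCompactSupport phi0_nonneg (x := EuclideanSpace.single 0 (√(1 - t))) ?_
  have : (1 : ℝ) - ∑ i : Fin 3, (EuclideanSpace.single (0 : Fin 3) (√(1 - t)) : E 3) i ^ 2 = t := by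
    rw [sum_three]; simp [Real.sq_sqrt (by linarith : 0 ≤ 1 - t)]
  simp only [phi0, this]
  simpa using ht

/-- The averaging kernel. -/
def phi (z : E 3) : ℝ := (∫ y, phi0 y)⁻¹ * phi0 z

/-- The kernel for the Laplacian. -/
def psi (z : E 3) : ℝ := (∫ y, phi0 y)⁻¹ * psi0 z

lemma isKer_phi : IsKer phi where
  cont := continuous_const.mul isKer_phi0.cont
  zero z hz := by simp [phi, isKer_phi0.zero z hz]

lemma isKer_psi : IsKer psi where
  cont := continuous_const.mul isKer_psi0.cont
  zero z hz := by simp [psi, isKer_psi0.zero z hz]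

lemma contDiff_phi {n : ℕ} : ContDiff ℝ n phi := contDiff_const.mul contDiff_phi0

lemma contDiff_psi {n : ℕ} : ContDiff ℝ n psi :=
  contDiff_const.mul (contDiff_psi0 (n := n))

lemma integral_phi : ∫ z, phi z = 1 := by
  simp only [phi]
  rw [integral_const_mul, inv_mul_cancel₀ integral_phi0_pos.ne']

lemma phi_nonneg (z : E 3) : 0 ≤ phi z :=
  mul_nonneg (inv_nonneg.2 integral_phi0_pos.le) (phi0_nonneg z)

lemma psi_nonneg (z : E 3) : 0 ≤ psi z :=
  mul_nonneg (inv_nonneg.2 integral_phi0_pos.le) (expNegInvGlue.nonneg _)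

lemma pd_psi (i : Fin 3) (z : E 3) : pd i psi z = - z i * phi z := by
  rw [show psi = fun z => (∫ y, phi0 y)⁻¹ * psi0 z from rfl,
    pd_const_mul _ ((contDiff_psi0 (n := 1)).differentiable (by norm_num) z), pd_psi0, phi]
  ring

lemma isKer_pd_phi (i : Fin 3) : IsKer (pd i phi) :=
  isKer_phi.pd (contDiff_phi (n := 1)) phi_nonneg i

lemma isKer_pd_psi (i : Fin 3) : IsKer (pd i psi) :=
  isKer_psi.pd (contDiff_psi (n := 1)) psi_nonneg i

/-- The derivative of the spherical average in the scale. -/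
lemma hasDerivAt_av {u : E 3 → ℝ} (hu : ContDiff ℝ 2 u) (x : E 3) (s : ℝ) :
    HasDerivAt (fun s => av phi u s x) (s * av psi (lap u) s x) s := by
  have hu1 : ContDiff ℝ 1 u := hu.of_le (by norm_num)
  have huc := hu1.continuous
  have hpc := fun i => continuous_pd hu1 i
  have hcc : ∀ i : Fin 3, Continuous fun z : E 3 => z i := fun i =>
    (contDiff_coord (n := 0) i).continuous
  have h := hasDerivAt_param isKer_phi (G := fun t z => u (x + t • z))
    (G' := fun t z => ∑ i, z i * pd i u (x + t • z))
    (by simp only [Function.uncurry_def]; fun_prop)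
    (by
      simp only [Function.uncurry_def]
      exact continuous_finsetSum _ fun i _ =>
        ((hcc i).comp continuous_snd).mul ((hpc i).comp (by fun_prop)))
    (fun t z => hasDerivAt_line hu1 x z t) s
  refine h.congr_deriv ?_
  have e1 : ∀ z, phi z * ∑ i, z i * pd i u (x + s • z)
      = ∑ i, - (pd i psi z * pd i u (x + s • z)) := fun z => by
    rw [Finset.mul_sum]
    exact Finset.sum_congr rfl fun i _ => by rw [pd_psi]; ring
  have e2 : ∀ z, psi z * lap u (x + s • z) = ∑ i, psi z * pd i (pd i u) (x + s • z) := fun z => by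
    rw [lap_eq hu, Finset.mul_sum]
  simp only [av, e1, e2]
  rw [integral_finsetSum, integral_finsetSum, Finset.mul_sum]
  · refine Finset.sum_congr rfl fun i _ => ?_
    rw [integral_neg]
    exact (av_pd_eq isKer_psi (contDiff_psi (n := 1)) (contDiff_pd_one hu i) s x i).symm
  · intro i _
    exact isKer_psi.integrable_mul
      ((continuous_pd (contDiff_pd_one hu i) i).comp (by fun_prop : Continuous fun z : E 3 => x + s • z))
  · intro i _
    exact ((isKer_pd_psi i).integrable_mul
      ((hpc i).comp (by fun_prop : Continuous fun z : E 3 => x + s • z))).neg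

lemma exists_av_sub_le : ∃ C : ℝ, 1 ≤ C ∧ ∀ (u : E 3 → ℝ), ContDiff ℝ 2 u → ∀ (g f : E 3 → ℝ),
    Continuous g → Continuous f → (∀ y, lap u y = g y + f y) → ∀ x q A B, 0 < q → 0 ≤ A → 0 < B →
    (∀ y ∈ closedBall x (q ^ 2), |g y| ≤ A) → ∫ y in ball x (q ^ 2), f y ^ 2 ≤ B ^ 2 →
    |av phi u (q ^ 2) x - u x| ≤ C * (A * q ^ 4 + B * q) := by
  obtain ⟨C2, hC2, hL2⟩ := exists_abs_av_le_L2 isKer_psi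
  set C1 := ∫ z, |psi z| with hC1
  have hC10 : 0 ≤ C1 := integral_nonneg fun z => abs_nonneg _
  refine ⟨2 * (C1 + C2), by linarith, ?_⟩
  intro u hu g f hg hf hl x q A B hq hA hB hgA hfB
  have hder : ∀ t : ℝ, HasDerivAt (fun t => av phi u (t ^ 2) x)
      (t ^ 2 * av psi (lap u) (t ^ 2) x * (2 * t)) t := fun t => by
    have h := (hasDerivAt_av hu x (t ^ 2)).comp t (hasDerivAt_pow 2 t)
    refine h.congr_deriv (by push_cast; ring)
  have hsplit : ∀ s, av psi (lap u) s x = av psi g s x + av psi f s x := fun s => by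
    simp only [av]
    rw [← integral_add (isKer_psi.integrable_mul (by fun_prop))
      (isKer_psi.integrable_mul (by fun_prop))]
    congr 1; ext z; rw [hl]; ring
  have hb : ∀ t ∈ Icc (0 : ℝ) q, ‖t ^ 2 * av psi (lap u) (t ^ 2) x * (2 * t)‖
      ≤ 2 * (C1 + C2) * (A * q ^ 3 + B) := by
    intro t ht
    rcases eq_or_lt_of_le ht.1 with h0 | h0
    · rw [← h0]; simp; positivity
    have htq : t ^ 2 ≤ q ^ 2 := by gcongr; exact ht.2
    have b1 : |av psi g (t ^ 2) x| ≤ C1 * A :=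
      abs_av_le isKer_psi hg (by positivity) fun y hy => hgA y (closedBall_subset_closedBall htq hy)
    have b2 : |av psi f (t ^ 2) x| ≤ C2 * (B / t ^ 3) := by
      refine hL2 f hf t B x h0 hB (le_trans ?_ hfB)
      exact setIntegral_ball_mono (by fun_prop) (fun _ => sq_nonneg _) (ball_subset_ball htq)
    rw [Real.norm_eq_abs, abs_mul, abs_mul, abs_of_pos (by positivity : 0 < t ^ 2),
      abs_of_pos (by positivity : 0 < 2 * t), hsplit]
    calc t ^ 2 * |av psi g (t ^ 2) x + av psi f (t ^ 2) x| * (2 * t)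
        ≤ t ^ 2 * (C1 * A + C2 * (B / t ^ 3)) * (2 * t) := by
          gcongr
          exact (abs_add_le _ _).trans (add_le_add b1 b2)
      _ = 2 * (C1 * (A * t ^ 3) + C2 * B) := by field_simp
      _ ≤ 2 * (C1 * (A * q ^ 3) + C2 * B) := by gcongr; exact ht.2
      _ ≤ 2 * (C1 + C2) * (A * q ^ 3 + B) := by
          have : 0 ≤ C1 * B := by positivity
          have : 0 ≤ C2 * (A * q ^ 3) := by positivity
          nlinarith
  have := (convex_Icc (0 : ℝ) q).norm_image_sub_le_of_norm_hasDerivWithin_le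
    (fun t _ => (hder t).hasDerivWithinAt) hb (left_mem_Icc.2 hq.le) (right_mem_Icc.2 hq.le)
  simp only [ne_eq, OfNat.ofNat_ne_zero, not_false_eq_true, zero_pow, sub_zero, Real.norm_eq_abs,
    av_zero integral_phi, abs_of_pos hq] at this
  refine this.trans (le_of_eq (by ring))

/-- Interior gradient estimate for the Poisson equation. -/
lemma exists_pd_le : ∃ C : ℝ, 1 ≤ C ∧ ∀ (v : E 3 → ℝ), ContDiff ℝ 3 v → ∀ x A B,
    (∀ y ∈ closedBall x 1, |v y| ≤ A) → (∀ y ∈ closedBall x 1, |lap v y| ≤ B) →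
    ∀ i, |pd i v x| ≤ C * (A + B) := by
  set C1 := ∑ i, ∫ z, |pd i phi z| with hC1
  set C2 := ∑ i, ∫ z, |pd i psi z| with hC2
  have h1 : ∀ i, ∫ z, |pd i phi z| ≤ C1 := fun i =>
    Finset.single_le_sum (f := fun i => ∫ z, |pd i phi z|)
      (fun i _ => integral_nonneg fun z => abs_nonneg _) (Finset.mem_univ i)
  have h2 : ∀ i, ∫ z, |pd i psi z| ≤ C2 := fun i =>
    Finset.single_le_sum (f := fun i => ∫ z, |pd i psi z|)
      (fun i _ => integral_nonneg fun z => abs_nonneg _) (Finset.mem_univ i)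
  have hC10 : 0 ≤ C1 := (integral_nonneg fun z => abs_nonneg _).trans (h1 0)
  have hC20 : 0 ≤ C2 := (integral_nonneg fun z => abs_nonneg _).trans (h2 0)
  refine ⟨C1 + C2 + 1, by linarith, ?_⟩
  intro v hv x A B hA hB i
  have hA0 : 0 ≤ A := (abs_nonneg _).trans (hA x (by simp))
  have hB0 : 0 ≤ B := (abs_nonneg _).trans (hB x (by simp))
  have hv2 : ContDiff ℝ 2 v := hv.of_le (by norm_num)
  have hv1 : ContDiff ℝ 1 v := hv.of_le (by norm_num)
  have hpd : ∀ j, ContDiff ℝ 2 (pd j v) := fun j => contDiff_pd (n := 2) (by norm_num; exact hv) j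
  have hlapC : ContDiff ℝ 1 (lap v) := by
    rw [show lap v = fun x => ∑ i, pd i (pd i v) x from funext (lap_eq hv2)]
    exact ContDiff.sum fun j _ => contDiff_pd_one (hpd j) j
  have hlap : ∀ y, lap (pd i v) y = pd i (lap v) y := fun y => by
    rw [lap_eq (hpd i), show lap v = fun x => ∑ i, pd i (pd i v) x from funext (lap_eq hv2),
      pd_sum _ fun j _ => (contDiff_pd_one (hpd j) j).differentiable (by norm_num) y]
    refine Finset.sum_congr rfl fun j _ => ?_
    rw [show pd j (pd i v) = pd i (pd j v) from funext (pd_comm hv2 j i), pd_comm (hpd j)]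
  have hder : ∀ s : ℝ, HasDerivAt (fun s => av phi (pd i v) s x) (- av (pd i psi) (lap v) s x) s :=
    fun s => by
    have := hasDerivAt_av (hpd i) x s
    rwa [show lap (pd i v) = pd i (lap v) from funext hlap,
      av_pd_eq isKer_psi (contDiff_psi (n := 1)) hlapC s x i] at this
  have hb : ∀ s ∈ Icc (0 : ℝ) 1, ‖- av (pd i psi) (lap v) s x‖ ≤ C2 * B := fun s hs => by
    rw [norm_neg, Real.norm_eq_abs]
    refine (abs_av_le (isKer_pd_psi i) hlapC.continuous hs.1 fun y hy =>
      hB y (closedBall_subset_closedBall hs.2 hy)).trans ?_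
    gcongr; exact h2 i
  have := (convex_Icc (0 : ℝ) 1).norm_image_sub_le_of_norm_hasDerivWithin_le
    (fun t _ => (hder t).hasDerivWithinAt) hb (left_mem_Icc.2 zero_le_one)
    (right_mem_Icc.2 zero_le_one)
  rw [av_zero integral_phi, Real.norm_eq_abs, sub_zero, norm_one, mul_one] at this
  have h3 : |av phi (pd i v) 1 x| ≤ C1 * A := by
    have e := av_pd_eq isKer_phi (contDiff_phi (n := 1)) hv1 1 x i
    rw [one_mul] at e
    rw [e, abs_neg]
    refine (abs_av_le (isKer_pd_phi i) hv.continuous zero_le_one hA).trans ?_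
    gcongr; exact h1 i
  have h4 : |pd i v x| ≤ C2 * B + C1 * A := by
    rw [abs_le] at *; constructor <;> linarith
  nlinarith [mul_nonneg hC10 hB0, mul_nonneg hC20 hA0]

/-! ### Pointwise bounds -/

lemma setIntegral_ball_le {f g : E 3 → ℝ} (hf : Continuous f) (hg : Continuous g) {p : E 3} {r : ℝ}
    (h : ∀ x ∈ ball p r, f x ≤ g x) : ∫ x in ball p r, f x ≤ ∫ x in ball p r, g x :=
  setIntegral_mono_on (integrableOn_ball hf p r) (integrableOn_ball hg p r) measurableSet_ball h

/-- A pointwise bound where the residual is small. -/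
lemma exists_abs_le : ∃ M : ℝ, 1 ≤ M ∧ ∀ (u : E 3 → ℝ), ContDiff ℝ 2 u → ∀ y,
    Fn u y 2 ≤ 1 → |u y| ≤ M := by
  obtain ⟨C1, hC1, h1⟩ := exists_apriori
  obtain ⟨C2, hC2, h2⟩ := exists_av_sub_le
  obtain ⟨C3, hC3, h3⟩ := exists_abs_av_le_L2 isKer_phi
  set V : ℝ := Real.pi * 4 / 3 with hV
  have hV0 : 0 < V := by positivity
  set T : ℝ := 16 * C1 + 4 * V + 2 with hT
  have hT1 : 1 ≤ T := by linarith
  refine ⟨C2 * T + C3 * T, by nlinarith, fun u hu y hF => ?_⟩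
  have huc := hu.continuous
  have hg := continuous_gsq (hu.of_le (by norm_num) : ContDiff ℝ 1 u)
  have hap := h1 u hu y
  have hvol : ∀ c : ℝ, ∫ _ in ball y 1, c = V * c := fun c => by
    rw [setIntegral_ball_const y zero_le_one]; ring
  have h6 : ∫ x in ball y 1, u x ^ 6 ≤ 2 * C1 := by
    refine le_trans (setIntegral_ball_le (by fun_prop) (by fun_prop) fun x _ => ?_)
      (hap.trans (by nlinarith))
    have := gsq_nonneg u x
    linarith
  have h60 : 0 ≤ ∫ x in ball y 1, u x ^ 6 :=
    setIntegral_nonneg measurableSet_ball fun x _ => by positivity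
  have hrc := continuous_resid hu
  have hlc := continuous_lap hu
  have i6 := integrableOn_ball (f := fun x => u x ^ 6) (by fun_prop) y 1
  have ir := integrableOn_ball (f := fun x => resid u x ^ 2) (by fun_prop) y 1
  have ic : ∀ c : ℝ, IntegrableOn (fun _ => c) (ball y 1) := fun c =>
    integrableOn_ball continuous_const y 1
  have hF1 : ∫ x in ball y 1, resid u x ^ 2 ≤ 1 :=
    (Fn_mono hu (ball_subset_ball (by norm_num))).trans hF
  have hu2 : ∫ x in ball y (1 ^ 2), u x ^ 2 ≤ T ^ 2 := by
    rw [one_pow]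
    calc ∫ x in ball y 1, u x ^ 2 ≤ ∫ x in ball y 1, (u x ^ 6 + 1) := by
            refine setIntegral_ball_le (by fun_prop) (by fun_prop) fun x _ => ?_
            nlinarith [sq_nonneg (u x ^ 2 - 1), sq_nonneg (u x), mul_nonneg (sq_nonneg (u x))
              (sq_nonneg (u x ^ 2 - 1))]
      _ = (∫ x in ball y 1, u x ^ 6) + V * 1 := by rw [integral_add i6 (ic 1), hvol]
      _ ≤ T ^ 2 := by nlinarith
  have hl2 : ∫ x in ball y (1 ^ 2), lap u x ^ 2 ≤ T ^ 2 := by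
    rw [one_pow]
    calc ∫ x in ball y 1, lap u x ^ 2
        ≤ ∫ x in ball y 1, (8 * u x ^ 6 + (2 * resid u x ^ 2 + 4)) := by
              refine setIntegral_ball_le (by fun_prop) (by fun_prop) fun x _ => ?_
              have e : lap u x = W' (u x) - resid u x := by simp [resid]
              have h3 : u x ^ 2 ≤ u x ^ 6 + 1 := by
                nlinarith [sq_nonneg (u x ^ 2 - 1), sq_nonneg (u x), mul_nonneg (sq_nonneg (u x))
                  (sq_nonneg (u x ^ 2 - 1))]
              have h4 : W' (u x) ^ 2 ≤ 4 * u x ^ 6 + 2 := by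
                unfold W'; nlinarith [sq_nonneg (u x ^ 3 + u x)]
              rw [e]; nlinarith [sq_nonneg (W' (u x) + resid u x)]
      _ = 8 * (∫ x in ball y 1, u x ^ 6) + (2 * (∫ x in ball y 1, resid u x ^ 2) + V * 4) := by
          rw [integral_add (i6.const_mul 8)
              (g := fun x => 2 * resid u x ^ 2 + 4) ((ir.const_mul 2).add (ic 4)),
            integral_add (ir.const_mul 2) (ic 4), hvol, integral_const_mul, integral_const_mul]
      _ ≤ T ^ 2 := by nlinarith
  have a1 := h2 u hu (fun _ => 0) (lap u) continuous_const (continuous_lap hu) (fun y => by simp)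
    y 1 0 T one_pos le_rfl (by linarith) (fun y _ => by simp) hl2
  have a2 := h3 u huc 1 T y one_pos (by linarith) hu2
  norm_num at a1 a2
  rw [abs_le] at *
  constructor <;> linarith [a1.1, a1.2, a2.1, a2.2]

lemma norm_fderiv_le_of_pd {v : E 3 → ℝ} {x : E 3} {c : ℝ} (hc : 0 ≤ c)
    (h : ∀ i, |pd i v x| ≤ c) : ‖fderiv ℝ v x‖ ≤ 2 * c := by
  have h1 := gsq_eq_norm v x
  have h2 : gsq v x ≤ 3 * c ^ 2 := by
    unfold gsq; rw [sum_three]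
    have := fun i => sq_le_sq' (abs_le.1 (h i)).1 (abs_le.1 (h i)).2
    linarith [this 0, this 1, this 2]
  refine le_of_sq_le_sq ?_ (by positivity)
  nlinarith

lemma abs_sub_le_of_pd {v : E 3 → ℝ} (hv : ContDiff ℝ 1 v) {x : E 3} {r c : ℝ} (hc : 0 ≤ c)
    (h : ∀ y ∈ closedBall x r, ∀ i, |pd i v y| ≤ c) {y : E 3} (hy : y ∈ closedBall x r) :
    |v y - v x| ≤ 2 * c * ‖y - x‖ := by
  have hr : 0 ≤ r := dist_nonneg.trans hy
  exact (convex_closedBall x r).norm_image_sub_le_of_norm_fderiv_le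
    (fun z _ => hv.differentiable (by norm_num) z)
    (fun z hz => norm_fderiv_le_of_pd hc (h z hz)) (mem_closedBall_self hr) hy

lemma exists_integral_abs_pd_phi_le : ∃ C : ℝ, 1 ≤ C ∧ (∀ i, ∫ z, |pd i phi z| ≤ C) := by
  refine ⟨1 + ∑ i, ∫ z, |pd i phi z|, ?_, fun i => ?_⟩
  · have : 0 ≤ ∑ i, ∫ z, |pd i phi z| :=
      Finset.sum_nonneg fun i _ => integral_nonneg fun z => abs_nonneg _
    linarith
  · have := Finset.single_le_sum (f := fun i => ∫ z, |pd i phi z|)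
      (fun i _ => integral_nonneg fun z => abs_nonneg _) (Finset.mem_univ i)
    linarith

lemma integral_abs_phi : ∫ z, |phi z| = 1 := by
  rw [← integral_phi]; congr 1; ext z; exact abs_of_nonneg (phi_nonneg z)

lemma abs_W'_le {t M : ℝ} (hM : 1 ≤ M) (h : |t| ≤ M) : |W' t| ≤ 2 * M ^ 3 := by
  have h3 : |t| ^ 3 ≤ M ^ 3 := by gcongr
  have h1 : M ≤ M ^ 3 := le_self_pow₀ hM (by norm_num)
  unfold W'
  calc |t ^ 3 - t| ≤ |t ^ 3| + |t| := abs_sub _ _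
    _ ≤ 2 * M ^ 3 := by rw [abs_pow]; linarith

lemma lap_eq_W'_add (u : E 3 → ℝ) (y : E 3) : lap u y = W' (u y) + -resid u y := by simp [resid]

/-- A Hölder bound where the residual is small. -/
lemma exists_holder : ∃ C : ℝ, 1 ≤ C ∧ ∀ (u : E 3 → ℝ), ContDiff ℝ 2 u → ∀ x,
    Fn u x 4 ≤ 1 → ∀ q, 0 < q → q ≤ 1 → ∀ y ∈ closedBall x (q ^ 4), |u y - u x| ≤ C * q := by
  obtain ⟨M, hM, h1⟩ := exists_abs_le
  obtain ⟨C2, hC2, h2⟩ := exists_av_sub_le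
  obtain ⟨C3, hC3, h3⟩ := exists_integral_abs_pd_phi_le
  refine ⟨2 * C2 * (2 * M ^ 3 + 1) + 2 * (C3 * M), ?_, fun u hu x hF q hq hq1 y hy => ?_⟩
  · have : 1 ≤ M ^ 3 := one_le_pow₀ hM
    nlinarith
  have hu1 : ContDiff ℝ 1 u := hu.of_le (by norm_num)
  have hM3 : 1 ≤ M ^ 3 := one_le_pow₀ hM
  have hq4 : q ^ 4 ≤ q := pow_le_of_le_one hq.le hq1 (by norm_num)
  have hq2 : q ^ 2 ≤ 1 := pow_le_one₀ hq.le hq1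
  have hs : 0 < q ^ 2 := by positivity
  have hb : ∀ z, dist z x ≤ 2 → |u z| ≤ M := fun z hz =>
    h1 u hu z ((Fn_mono hu (ball_subset_ball' (by linarith))).trans hF)
  have near : ∀ z, dist z x ≤ 1 → |av phi u (q ^ 2) z - u z| ≤ C2 * ((2 * M ^ 3) * q ^ 4 + 1 * q) :=
    fun z hz => by
      refine h2 u hu (fun y => W' (u y)) (fun y => - resid u y)
        ((contDiff_W' (n := 0)).continuous.comp hu.continuous) (continuous_resid hu).neg
        (lap_eq_W'_add u) z q _ 1 hq (by positivity) one_pos (fun w hw => ?_) ?_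
      · rw [mem_closedBall] at hw
        exact abs_W'_le hM (hb w (by linarith [dist_triangle w z x]))
      · simp only [neg_sq, one_pow]
        refine (Fn_mono hu (ball_subset_ball' ?_)).trans hF
        linarith
  have near' : ∀ z, dist z x ≤ 1 → |av phi u (q ^ 2) z - u z| ≤ C2 * (2 * M ^ 3 + 1) * q :=
    fun z hz => (near z hz).trans (by
      rw [mul_assoc C2]; refine mul_le_mul_of_nonneg_left ?_ (zero_le_one.trans hC2); nlinarith)
  have hyx : dist y x ≤ 1 := by rw [mem_closedBall] at hy; linarith
  have hav : |av phi u (q ^ 2) y - av phi u (q ^ 2) x| ≤ 2 * (C3 * M / q ^ 2) * ‖y - x‖ := by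
    refine abs_sub_le_of_pd (r := q ^ 4)
      (contDiff_av isKer_phi (n := 1) (contDiff_phi (n := 1)) hu.continuous hs) (by positivity)
      (fun z hz i => ?_) hy
    rw [mem_closedBall] at hz
    rw [pd_av isKer_phi (contDiff_phi (n := 1)) hu1 hs]
    have e := av_pd_eq isKer_phi (contDiff_phi (n := 1)) hu1 (q ^ 2) z i
    have b := abs_av_le (isKer_pd_phi i) hu.continuous hs.le (x := z) (M := M) fun w hw => by
      rw [mem_closedBall] at hw
      exact hb w (by linarith [dist_triangle w z x])
    rw [le_div_iff₀ hs, mul_comm, ← abs_of_pos hs, ← abs_mul, abs_of_pos hs, e, abs_neg]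
    exact b.trans (by gcongr; exact h3 i)
  have hav' : |av phi u (q ^ 2) y - av phi u (q ^ 2) x| ≤ 2 * (C3 * M) * q := by
    refine hav.trans ?_
    have hn : ‖y - x‖ ≤ q ^ 4 := by rw [← dist_eq_norm]; exact hy
    calc 2 * (C3 * M / q ^ 2) * ‖y - x‖ ≤ 2 * (C3 * M / q ^ 2) * q ^ 4 := by gcongr
      _ = 2 * (C3 * M) * q ^ 2 := by field_simp
      _ ≤ 2 * (C3 * M) * q := by gcongr; nlinarith
  have n1 := near' y hyx
  have n2 := near' x (by simp)
  rw [abs_le] at *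
  constructor <;> linarith [hav'.1, hav'.2, n1.1, n1.2, n2.1, n2.2]

/-- A lower energy bound at points away from the wells. -/
lemma exists_energy_lower : ∃ c : ℝ, 0 < c ∧ ∀ (u : E 3 → ℝ), ContDiff ℝ 2 u → ∀ x,
    Fn u x 4 ≤ 1 → ∀ β, 0 < β → β ≤ 1 → |u x| ≤ 1 - β → c * β ^ 14 ≤ En u x 1 := by
  obtain ⟨C, hC, h⟩ := exists_holder
  refine ⟨(Real.pi * 4 / 3) / 16 / (2 * C) ^ 12, by positivity,
    fun u hu x hF β hβ hβ1 hx => ?_⟩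
  set q := β / (2 * C) with hq
  have hq0 : 0 < q := by positivity
  have hq1 : q ≤ 1 := by rw [hq, div_le_one (by positivity)]; linarith
  have hq4 : q ^ 4 ≤ 1 := pow_le_one₀ hq0.le hq1
  have hle : ∀ y ∈ ball x (q ^ 4), β ^ 2 / 16 ≤ eden u y := fun y hy => by
    have h1 := h u hu x hF q hq0 hq1 y (ball_subset_closedBall hy)
    have h2 : C * q = β / 2 := by rw [hq]; field_simp
    rw [h2] at h1
    have h3 : |u y| ≤ 1 - β / 2 := by
      rw [abs_le] at *; constructor <;> linarith [h1.1, h1.2, hx.1, hx.2]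
    have h4 : u y ^ 2 ≤ (1 - β / 2) ^ 2 := by rw [← sq_abs]; gcongr
    have h5 : u y ^ 2 ≤ 1 - β / 2 := by nlinarith
    have := gsq_nonneg u y
    unfold eden W; nlinarith
  calc _ = ∫ _ in ball x (q ^ 4), β ^ 2 / 16 := by
        rw [setIntegral_ball_const x (by positivity), hq]; field_simp
    _ ≤ ∫ y in ball x (q ^ 4), eden u y :=
        setIntegral_ball_le continuous_const (continuous_eden hu) hle
    _ ≤ En u x 1 := En_mono hu (ball_subset_ball hq4)

/-! ### Mollification -/

lemma av_add {k f g : E 3 → ℝ} (hk : IsKer k) (hf : Continuous f) (hg : Continuous g) (s : ℝ)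
    (x : E 3) : av k (fun y => f y + g y) s x = av k f s x + av k g s x := by
  unfold av
  rw [← integral_add (hk.integrable_mul (by fun_prop)) (hk.integrable_mul (by fun_prop))]
  congr 1; ext z; ring

lemma av_const_mul (k f : E 3 → ℝ) (c s : ℝ) (x : E 3) :
    av k (fun y => c * f y) s x = c * av k f s x := by
  unfold av
  rw [← integral_const_mul]
  congr 1; ext z; ring

lemma av_const (k : E 3 → ℝ) (c s : ℝ) (x : E 3) : av k (fun _ => c) s x = (∫ z, k z) * c := by
  simp [av, integral_mul_const]

lemma av_lap {k u : E 3 → ℝ} (hk : IsKer k) (hu : ContDiff ℝ 2 u) (s : ℝ) (x : E 3) :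
    av k (lap u) s x = ∑ i, av k (pd i (pd i u)) s x := by
  have hc := fun i : Fin 3 => continuous_pd (contDiff_pd_one hu i) i
  have e : lap u = fun y => pd 0 (pd 0 u) y + (pd 1 (pd 1 u) y + pd 2 (pd 2 u) y) := by
    ext y; rw [lap_eq hu, sum_three]; ring
  rw [e, av_add hk (hc 0) (g := fun y => pd 1 (pd 1 u) y + pd 2 (pd 2 u) y) ((hc 1).add (hc 2)), av_add hk (hc 1) (hc 2), sum_three]; ring

lemma contDiff_mol {u : E 3 → ℝ} (hu : Continuous u) {s : ℝ} (hs : 0 < s) (n : ℕ) :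
    ContDiff ℝ n (av phi u s) :=
  contDiff_av isKer_phi (n := n) (contDiff_phi (n := n)) hu hs

lemma pd_mol {u : E 3 → ℝ} (hu : ContDiff ℝ 1 u) {s : ℝ} (hs : 0 < s) (i : Fin 3) :
    pd i (av phi u s) = av phi (pd i u) s :=
  funext fun x => pd_av isKer_phi (contDiff_phi (n := 1)) hu hs i x

lemma lap_mol {u : E 3 → ℝ} (hu : ContDiff ℝ 2 u) {s : ℝ} (hs : 0 < s) :
    lap (av phi u s) = av phi (lap u) s := by
  ext x
  rw [lap_eq (contDiff_mol hu.continuous hs 2), av_lap isKer_phi hu]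
  refine Finset.sum_congr rfl fun i _ => ?_
  rw [pd_mol (hu.of_le (by norm_num)) hs, pd_mol (contDiff_pd_one hu i) hs]

/-- The gradient of the mollified Laplacian, with the derivative on the kernel. -/
lemma pd_lap_mol {u : E 3 → ℝ} (hu : ContDiff ℝ 2 u) {s : ℝ} (hs : 0 < s) (j : Fin 3) (x : E 3) :
    s * pd j (av phi (lap u) s) x = - av (pd j phi) (lap u) s x := by
  have hk := contDiff_phi (n := 2)
  have hk1 := contDiff_phi (n := 1)
  have hu1 : ContDiff ℝ 1 u := hu.of_le (by norm_num)
  have e1 : av phi (lap u) s = fun y => ∑ i, (-s⁻¹) * av (pd i phi) (pd i u) s y := by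
    ext y
    rw [av_lap isKer_phi hu]
    refine Finset.sum_congr rfl fun i _ => ?_
    have := av_pd_eq isKer_phi hk1 (contDiff_pd_one hu i) s y i
    field_simp; linarith
  have hd : ∀ i, Differentiable ℝ (av (pd i phi) (pd i u) s) := fun i =>
    (contDiff_av (isKer_pd_phi i) (n := 1) (contDiff_pd_one hk i) (continuous_pd hu1 i)
      hs).differentiable (by norm_num)
  have hker : ∀ i j, IsKer (pd j (pd i phi)) := fun i j =>
    { cont := continuous_pd (contDiff_pd_one hk i) j
      zero := fun z hz => by
        by_cases h1 : z ∈ closedBall (0 : E 3) 1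
        · have h2 : z ∈ closure (closedBall (0 : E 3) 1)ᶜ := by
            rw [closure_compl, interior_closedBall _ one_ne_zero]; exact hz
          refine (isClosed_singleton.preimage
            (continuous_pd (contDiff_pd_one hk i) j)).closure_subset_iff.2 ?_ h2
          intro w hw
          have : pd i phi =ᶠ[nhds w] fun _ => 0 := by
            filter_upwards [isClosed_closedBall.isOpen_compl.mem_nhds hw] with v hv
            exact (isKer_pd_phi i).zero v fun h => hv (ball_subset_closedBall h)
          simp [_root_.pd, this.fderiv_eq]
        · have : pd i phi =ᶠ[nhds z] fun _ => 0 := by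
            filter_upwards [isClosed_closedBall.isOpen_compl.mem_nhds h1] with v hv
            exact (isKer_pd_phi i).zero v fun h => hv (ball_subset_closedBall h)
          simp [_root_.pd, this.fderiv_eq] }
  have e2 : ∀ i, pd j (av (pd i phi) (pd i u) s) x = -s⁻¹ * av (pd i (pd j phi)) (pd i u) s x := by
    intro i
    rw [pd_av (isKer_pd_phi i) (contDiff_pd_one hk i) (contDiff_pd_one hu i) hs]
    have := av_pd_eq (isKer_pd_phi i) (contDiff_pd_one hk i) (contDiff_pd_one hu i) s x j
    have e : pd i (pd j phi) = pd j (pd i phi) := funext fun z => (pd_comm hk i j z)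
    rw [e]; field_simp; linarith
  have e3 : ∀ i, av (pd i (pd j phi)) (pd i u) s x = - s * av (pd j phi) (pd i (pd i u)) s x := by
    intro i
    have := av_pd_eq (isKer_pd_phi j) (contDiff_pd_one hk j) (contDiff_pd_one hu i) s x i
    linarith
  rw [e1, pd_sum _ fun i _ => ((hd i).const_mul _) x, av_lap (isKer_pd_phi j) hu,
    Finset.mul_sum, ← Finset.sum_neg_distrib]
  refine Finset.sum_congr rfl fun i _ => ?_
  rw [pd_const_mul _ (hd i x), e2, e3]; field_simp

lemma integral_pd_phi (i : Fin 3) : ∫ z, pd i phi z = 0 :=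
  integral_pd_eq_zero (contDiff_phi (n := 1)) isKer_phi.hasCompactSupport i

/-- Properties of the mollification at a point: closeness to `u`, bounds, and smallness of the
residual and of its gradient. -/
structure MolBound (C s : ℝ) (u : E 3 → ℝ) (x : E 3) : Prop where
  close : |u x - av phi u (s ^ 6) x| ≤ C * s ^ 12
  bdd : |av phi u (s ^ 6) x| ≤ C
  grad : ∀ i, |pd i (av phi u (s ^ 6)) x| ≤ C
  res : |resid (av phi u (s ^ 6)) x| ≤ C * s ^ 6
  dres : ∀ i, |pd i (resid (av phi u (s ^ 6))) x| ≤ C * s ^ 6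

lemma hasDerivAt_W' (t : ℝ) : HasDerivAt W' (3 * t ^ 2 - 1) t := by
  unfold W'
  refine (((hasDerivAt_id t).pow 3).sub (hasDerivAt_id t)).congr_deriv ?_
  simp

lemma abs_W'_sub_le {a b M : ℝ} (hM : 1 ≤ M) (ha : |a| ≤ M) (hb : |b| ≤ M) :
    |W' a - W' b| ≤ 4 * M ^ 2 * |a - b| := by
  have e : W' a - W' b = (a ^ 2 + a * b + b ^ 2 - 1) * (a - b) := by unfold W'; ring
  rw [e, abs_mul]
  gcongr
  have h1 : |a| * |a| ≤ M * M := by gcongr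
  have h2 : |a| * |b| ≤ M * M := by gcongr
  have h3 : |b| * |b| ≤ M * M := by gcongr
  rw [← abs_mul] at h1 h2 h3
  rw [abs_le] at *
  constructor <;> nlinarith [h1.1, h1.2, h2.1, h2.2, h3.1, h3.2]

lemma exists_abs_av_pd_phi_le_L2 : ∃ C : ℝ, 1 ≤ C ∧ ∀ (i : Fin 3) (f : E 3 → ℝ),
    Continuous f → ∀ q B x, 0 < q → 0 < B → ∫ y in ball x (q ^ 2), f y ^ 2 ≤ B ^ 2 →
    |av (pd i phi) f (q ^ 2) x| ≤ C * (B / q ^ 3) := by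
  choose C hC h using fun i => exists_abs_av_le_L2 (isKer_pd_phi i)
  have hle : ∀ i, C i ≤ ∑ j, C j := fun i =>
    Finset.single_le_sum (f := C) (fun j _ => zero_le_one.trans (hC j)) (Finset.mem_univ i)
  refine ⟨∑ i, C i, (hC 0).trans (hle 0), fun i f hf q B x hq hB hi => ?_⟩
  exact (h i f hf q B x hq hB hi).trans (by gcongr; exact hle i)

set_option maxHeartbeats 1000000 in
lemma exists_molBound : ∃ C : ℝ, 1 ≤ C ∧ ∀ (u : E 3 → ℝ), ContDiff ℝ 2 u → ∀ x s, 0 < s → s ≤ 1 →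
    Fn u x 8 ≤ s ^ 48 → MolBound C s u x := by
  obtain ⟨M, hM, h1⟩ := exists_abs_le
  obtain ⟨C2, hC2, h2⟩ := exists_av_sub_le
  obtain ⟨C3, hC3, h3⟩ := exists_integral_abs_pd_phi_le
  obtain ⟨C4, hC4, h4⟩ := exists_abs_av_le_L2 isKer_phi
  obtain ⟨C5, hC5, h5⟩ := exists_abs_av_pd_phi_le_L2
  obtain ⟨C6, hC6, h6⟩ := exists_pd_le
  have hM3 : 1 ≤ M ^ 3 := one_le_pow₀ hM
  set K1 := C2 * (2 * M ^ 3 + 1) with hK1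
  set G := C6 * (M + (2 * M ^ 3 + C4)) with hG
  set D := K1 + 2 * G with hD
  have hK10 : 0 ≤ K1 := by positivity
  have hG0 : 0 ≤ G := by positivity
  have hD0 : 0 ≤ D := by positivity
  refine ⟨M + K1 + G + (4 * M ^ 2 * D + C4) + (C3 * (3 * M * D ^ 2) + C5), ?_,
    fun u hu x s hs hs1 hF => ?_⟩
  · have : 0 ≤ (4 * M ^ 2 * D + C4) + (C3 * (3 * M * D ^ 2) + C5) := by positivity
    linarith
  have hp1 : 0 ≤ 4 * M ^ 2 * D + C4 := by positivity
  have hp2 : 0 ≤ C3 * (3 * M * D ^ 2) + C5 := by positivity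
  have hs6 : 0 < s ^ 6 := by positivity
  have hs61 : s ^ 6 ≤ 1 := pow_le_one₀ hs.le hs1
  have hs48 : s ^ 48 ≤ 1 := pow_le_one₀ hs.le hs1
  have hs15 : s ^ 15 ≤ s ^ 6 := pow_le_pow_of_le_one hs.le hs1 (by norm_num)
  have hq : (s ^ 3) ^ 2 = s ^ 6 := by ring
  have hdiv : s ^ 24 / (s ^ 3) ^ 3 = s ^ 15 := by
    field_simp
  have huc := hu.continuous
  have hu1 : ContDiff ℝ 1 u := hu.of_le (by norm_num)
  have hWc : Continuous fun y => W' (u y) := (contDiff_W' (n := 0)).continuous.comp huc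
  have hrc : Continuous fun y => - resid u y := (continuous_resid hu).neg
  have hb : ∀ z, dist z x ≤ 6 → |u z| ≤ M := fun z hz =>
    h1 u hu z ((Fn_mono hu (ball_subset_ball' (by linarith))).trans (hF.trans hs48))
  have hFs : ∀ z, dist z x ≤ 4 → ∫ y in ball z ((s ^ 3) ^ 2), (- resid u y) ^ 2 ≤ (s ^ 24) ^ 2 :=
    fun z hz => by
      simp only [neg_sq]
      refine (Fn_mono hu (ball_subset_ball' ?_)).trans (hF.trans (by rw [← pow_mul]))
      rw [hq]; linarith
  set v := av phi u (s ^ 6) with hv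
  have hvn : ∀ n : ℕ, ContDiff ℝ n v := contDiff_mol huc hs6
  have ha : ∀ z, dist z x ≤ 4 → |v z - u z| ≤ K1 * s ^ 12 := fun z hz => by
    have := h2 u hu (fun y => W' (u y)) (fun y => - resid u y) hWc hrc (lap_eq_W'_add u) z
      (s ^ 3) (2 * M ^ 3) (s ^ 24) (by positivity) (by positivity) (by positivity)
      (fun w hw => by
        rw [mem_closedBall, hq] at hw
        exact abs_W'_le hM (hb w (by linarith [dist_triangle w z x]))) (hFs z hz)
    rw [hq] at this
    refine this.trans ?_
    have e : s ^ 24 * s ^ 3 ≤ s ^ 12 := by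
      rw [← pow_add]; exact pow_le_pow_of_le_one hs.le hs1 (by norm_num)
    rw [hK1, mul_assoc C2]; refine mul_le_mul_of_nonneg_left ?_ (zero_le_one.trans hC2)
    nlinarith
  have hvb : ∀ z, dist z x ≤ 4 → |v z| ≤ M := fun z hz => by
    have := abs_av_le isKer_phi huc hs6.le (x := z) (M := M) fun w hw => by
      rw [mem_closedBall] at hw
      exact hb w (by linarith [dist_triangle w z x])
    rwa [integral_abs_phi, one_mul] at this
  have hlapv : ∀ z, lap v z
      = av phi (fun y => W' (u y)) (s ^ 6) z + av phi (fun y => - resid u y) (s ^ 6) z :=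
    fun z => by
      rw [hv, lap_mol hu hs6, ← av_add isKer_phi hWc hrc]
      exact congrArg (fun f => av phi f (s ^ 6) z) (funext (lap_eq_W'_add u))
  have hrv : ∀ z, dist z x ≤ 4 → |av phi (fun y => - resid u y) (s ^ 6) z| ≤ C4 * s ^ 15 :=
    fun z hz => by
      have := h4 _ hrc (s ^ 3) (s ^ 24) z (by positivity) (by positivity) (hFs z hz)
      rwa [hq, hdiv] at this
  have hlb : ∀ z, dist z x ≤ 4 → |lap v z| ≤ 2 * M ^ 3 + C4 := fun z hz => by
    rw [hlapv]
    refine (abs_add_le _ _).trans (add_le_add ?_ ((hrv z hz).trans ?_))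
    · have := abs_av_le isKer_phi hWc hs6.le (x := z) (M := 2 * M ^ 3) fun w hw => by
        rw [mem_closedBall] at hw
        exact abs_W'_le hM (hb w (by linarith [dist_triangle w z x]))
      rwa [integral_abs_phi, one_mul] at this
    · exact mul_le_of_le_one_right (by linarith) (hs15.trans hs61)
  have hgb : ∀ z, dist z x ≤ 1 → ∀ i, |pd i v z| ≤ G := fun z hz i =>
    h6 v (hvn 3) z M _ (fun w hw => hvb w (by
        rw [mem_closedBall] at hw; linarith [dist_triangle w z x]))
      (fun w hw => hlb w (by rw [mem_closedBall] at hw; linarith [dist_triangle w z x])) i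
  have hx4 : dist x x ≤ 4 := by simp
  have hosc : ∀ z ∈ closedBall x (s ^ 6), |u z - v x| ≤ D * s ^ 6 := fun z hz => by
    have a1 := ha z (by rw [mem_closedBall] at hz; linarith)
    have a2 := abs_sub_le_of_pd (r := 1) (hvn 1) hG0 (fun y hy => hgb y hy)
      (closedBall_subset_closedBall hs61 hz)
    have a3 : ‖z - x‖ ≤ s ^ 6 := by rw [← dist_eq_norm]; exact hz
    have a4 : 2 * G * ‖z - x‖ ≤ 2 * G * s ^ 6 := by gcongr
    have a5 : K1 * s ^ 12 ≤ K1 * s ^ 6 := by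
      gcongr ?_ * ?_; exact pow_le_pow_of_le_one hs.le hs1 (by norm_num)
    have a6 : D * s ^ 6 = K1 * s ^ 6 + 2 * G * s ^ 6 := by rw [hD]; ring
    rw [a6]
    rw [abs_le] at *
    constructor <;> linarith [a1.1, a1.2, a2.1, a2.2]
  have hres : |resid v x| ≤ (4 * M ^ 2 * D + C4) * s ^ 6 := by
    have e1 : av phi (fun y => W' (u y) + -W' (v x)) (s ^ 6) x
        = av phi (fun y => W' (u y)) (s ^ 6) x - W' (v x) := by
      rw [av_add isKer_phi hWc continuous_const, av_const, integral_phi]; ring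
    have e2 : |av phi (fun y => W' (u y) + -W' (v x)) (s ^ 6) x| ≤ 4 * M ^ 2 * (D * s ^ 6) := by
      have := abs_av_le isKer_phi (f := fun y => W' (u y) + -W' (v x)) (by fun_prop) hs6.le (x := x)
        (M := 4 * M ^ 2 * (D * s ^ 6)) fun w hw => by
          have hw' := hw
          rw [mem_closedBall] at hw'
          rw [← sub_eq_add_neg]
          refine (abs_W'_sub_le hM (hb w (by linarith)) (hvb x hx4)).trans ?_
          gcongr; exact hosc w hw
      rwa [integral_abs_phi, one_mul] at this
    have e3 := hrv x hx4
    have e4 : C4 * s ^ 15 ≤ C4 * s ^ 6 := by gcongr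
    have e5 : resid v x = -(av phi (fun y => W' (u y) + -W' (v x)) (s ^ 6) x)
        - av phi (fun y => - resid u y) (s ^ 6) x := by
      rw [e1]; simp only [resid, hlapv]; ring
    rw [e5]
    have e6 : (4 * M ^ 2 * D + C4) * s ^ 6 = 4 * M ^ 2 * (D * s ^ 6) + C4 * s ^ 6 := by ring
    rw [e6]
    rw [abs_le] at *
    constructor <;> linarith [e2.1, e2.2, e3.1, e3.2]
  have hdres : ∀ j, |pd j (resid v) x| ≤ (C3 * (3 * M * D ^ 2) + C5) * s ^ 6 := fun j => by
    have hd1 : DifferentiableAt ℝ v x := (hvn 1).differentiable (by norm_num) x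
    have hd2 : DifferentiableAt ℝ (lap v) x := by
      rw [hv, lap_mol hu hs6]
      exact (contDiff_mol (continuous_lap hu) hs6 1).differentiable (by norm_num) x
    have e1 : pd j (resid v) x = (3 * v x ^ 2 - 1) * pd j v x - pd j (lap v) x := by
      have : resid v = fun y => W' (v y) - lap v y := rfl
      rw [this, pd_sub (f := fun y => W' (v y))
        ((hasDerivAt_W' (v x)).differentiableAt.comp x hd1) hd2,
        pd_comp (hasDerivAt_W' _) hd1]
    have e2 : s ^ 6 * pd j v x = - av (pd j phi) u (s ^ 6) x := by
      rw [hv, pd_mol hu1 hs6, av_pd_eq isKer_phi (contDiff_phi (n := 1)) hu1]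
    have e3 : s ^ 6 * pd j (lap v) x = - av (pd j phi) (lap u) (s ^ 6) x := by
      rw [hv, lap_mol hu hs6, pd_lap_mol hu hs6]
    have e4 : av (pd j phi) (lap u) (s ^ 6) x = av (pd j phi) (fun y => W' (u y)) (s ^ 6) x
        + av (pd j phi) (fun y => - resid u y) (s ^ 6) x := by
      rw [← av_add (isKer_pd_phi j) hWc hrc]
      exact congrArg (fun f => av (pd j phi) f (s ^ 6) x) (funext (lap_eq_W'_add u))
    set a := v x with hadef
    have e5 : av (pd j phi) (fun y => W' (u y) + (-(3 * a ^ 2 - 1) * u y + 2 * a ^ 3)) (s ^ 6) x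
        = av (pd j phi) (fun y => W' (u y)) (s ^ 6) x
          - (3 * a ^ 2 - 1) * av (pd j phi) u (s ^ 6) x := by
      rw [av_add (isKer_pd_phi j) hWc (g := fun y => -(3 * a ^ 2 - 1) * u y + 2 * a ^ 3)
        (by fun_prop), av_add (isKer_pd_phi j) (f := fun y => -(3 * a ^ 2 - 1) * u y) (by fun_prop)
        continuous_const, av_const, integral_pd_phi, av_const_mul]; ring
    have e6 : |av (pd j phi) (fun y => W' (u y) + (-(3 * a ^ 2 - 1) * u y + 2 * a ^ 3)) (s ^ 6) x|
        ≤ C3 * ((D * s ^ 6) ^ 2 * (3 * M)) := by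
      refine (abs_av_le (isKer_pd_phi j) (by fun_prop) hs6.le (x := x)
        (M := (D * s ^ 6) ^ 2 * (3 * M)) fun w hw => ?_).trans (by gcongr; exact h3 j)
      have hw' := hw
      rw [mem_closedBall] at hw'
      have b1 := hb w (by linarith)
      have b2 := hvb x hx4
      have b3 := hosc w hw
      have : W' (u w) + (-(3 * a ^ 2 - 1) * u w + 2 * a ^ 3)
          = (u w - a) ^ 2 * (u w + 2 * a) := by unfold W'; ring
      rw [this, abs_mul, abs_pow]
      gcongr
      rw [abs_le] at *
      constructor <;> linarith [b1.1, b1.2, b2.1, b2.2]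
    have e7 := h5 j _ hrc (s ^ 3) (s ^ 24) x (by positivity) (by positivity) (hFs x hx4)
    rw [hq, hdiv] at e7
    have e8 : s ^ 6 * pd j (resid v) x
        = av (pd j phi) (fun y => W' (u y) + (-(3 * a ^ 2 - 1) * u y + 2 * a ^ 3)) (s ^ 6) x
          + av (pd j phi) (fun y => - resid u y) (s ^ 6) x := by
      rw [e5, e1, mul_sub, e3, e4, mul_left_comm, e2]; ring
    have e9 : s ^ 6 * |pd j (resid v) x| ≤ s ^ 6 * ((C3 * (3 * M * D ^ 2) + C5) * s ^ 6) := by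
      rw [← abs_of_pos hs6, ← abs_mul, abs_of_pos hs6, e8]
      refine (abs_add_le _ _).trans ((add_le_add e6 e7).trans ?_)
      have : s ^ 15 ≤ s ^ 12 := pow_le_pow_of_le_one hs.le hs1 (by norm_num)
      calc C3 * ((D * s ^ 6) ^ 2 * (3 * M)) + C5 * s ^ 15
          ≤ C3 * ((D * s ^ 6) ^ 2 * (3 * M)) + C5 * s ^ 12 := by gcongr
        _ = s ^ 6 * ((C3 * (3 * M * D ^ 2) + C5) * s ^ 6) := by ring
    exact le_of_mul_le_mul_left e9 hs6
  have hs12 : 0 ≤ s ^ 12 := by positivity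
  refine ⟨?_, (hvb x hx4).trans (by linarith), fun i => (hgb x (by simp) i).trans (by linarith),
    hres.trans ?_, fun j => (hdres j).trans ?_⟩
  · rw [abs_sub_comm]
    exact (ha x hx4).trans (by gcongr; linarith)
  · exact mul_le_mul_of_nonneg_right (by linarith) hs6.le
  · exact mul_le_mul_of_nonneg_right (by linarith) hs6.le

/-! ### Maximum principles -/

lemma IsLocalMax.pd_eq_zero {Q : E 3 → ℝ} {x : E 3} (h : IsLocalMax Q x) (i : Fin 3) :
    pd i Q x = 0 := by
  simp [pd, h.fderiv_eq_zero]

lemma IsLocalMax.pd_pd_nonpos {Q : E 3 → ℝ} (hQ : ContDiff ℝ 2 Q) {x : E 3} (h : IsLocalMax Q x)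
    (i : Fin 3) : pd i (pd i Q) x ≤ 0 := by
  set e : E 3 := EuclideanSpace.single i 1 with he
  have hsum : ∀ g : Fin 3 → ℝ, ∑ j, e j * g j = g i := fun g => by
    simp [he]
  have hQ1 : ContDiff ℝ 1 Q := hQ.of_le (by norm_num)
  have d1 : deriv (fun t : ℝ => Q (x + t • e)) = fun t => pd i Q (x + t • e) := funext fun t => by
    have := (hasDerivAt_line hQ1 x e t).deriv
    rwa [hsum fun j => pd j Q (x + t • e)] at this
  have d2 : deriv (deriv (fun t : ℝ => Q (x + t • e))) 0 = pd i (pd i Q) x := by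
    rw [d1]
    have := (hasDerivAt_line (contDiff_pd_one hQ i) x e 0).deriv
    rw [hsum fun j => pd j (pd i Q) (x + (0 : ℝ) • e)] at this
    simpa using this
  have hc : Continuous fun t : ℝ => x + t • e := by fun_prop
  by_contra! hpos
  have hmin : IsLocalMin (fun t : ℝ => Q (x + t • e)) 0 := by
    refine isLocalMin_of_deriv_deriv_pos (by rw [d2]; exact hpos) ?_
      (hQ.continuous.comp hc).continuousAt
    rw [d1]; simpa using h.pd_eq_zero i
  have hmax : IsLocalMax (fun t : ℝ => Q (x + t • e)) 0 := by
    have h' : IsLocalMax Q (x + (0 : ℝ) • e) := by simpa using h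
    exact (hc.tendsto 0).eventually h'
  have hcst : (fun t : ℝ => Q (x + t • e)) =ᶠ[nhds 0] fun _ => Q (x + (0 : ℝ) • e) := by
    filter_upwards [hmin, hmax] with t h1 h2
    exact le_antisymm h2 h1
  have : deriv (deriv (fun t : ℝ => Q (x + t • e))) 0 = 0 := by
    rw [hcst.deriv.deriv_eq]; simp
  rw [d2] at this
  exact hpos.ne' this

/-- The squared distance to `z`. -/
def sqd (z x : E 3) : ℝ := ∑ i, (x i - z i) ^ 2

lemma sqd_eq (z x : E 3) : sqd z x = dist x z ^ 2 := by
  rw [EuclideanSpace.dist_eq, Real.sq_sqrt (by positivity)]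
  simp [sqd, Real.dist_eq]

lemma sqd_self (z : E 3) : sqd z z = 0 := by simp [sqd]

lemma sqd_nonneg (z x : E 3) : 0 ≤ sqd z x := by rw [sqd_eq]; positivity

lemma contDiff_sqd {n : WithTop ℕ∞} (z : E 3) : ContDiff ℝ n (sqd z) :=
  ContDiff.sum fun i _ => ((contDiff_coord i).sub contDiff_const).pow 2

lemma pd_sqd (z x : E 3) (i : Fin 3) : pd i (sqd z) x = 2 * (x i - z i) := by
  have hd : ∀ j, DifferentiableAt ℝ (fun y : E 3 => y j - z j) x := fun j =>
    (((contDiff_coord (n := 1) j).sub contDiff_const).differentiable (by norm_num)) x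
  have hc : ∀ j, DifferentiableAt ℝ (fun y : E 3 => y j) x := fun j =>
    (contDiff_coord (n := 1) j).differentiable (by norm_num) x
  have : sqd z = fun y => ∑ j, (y j - z j) ^ 2 := rfl
  rw [this, pd_sum _ fun j _ => (hd j).fun_pow 2]
  simp only [pd_pow 2 (hd _), pd_sub (hc _) (differentiableAt_const _), pd_coord, pd_const]
  simp

lemma pd_pd_sqd (z x : E 3) (i : Fin 3) : pd i (pd i (sqd z)) x = 2 := by
  have : pd i (sqd z) = fun y => 2 * (y i - z i) := funext fun y => pd_sqd z y i
  have hc : DifferentiableAt ℝ (fun y : E 3 => y i) x :=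
    (contDiff_coord (n := 1) i).differentiable (by norm_num) x
  rw [this, pd_const_mul _ (hc.fun_sub (differentiableAt_const _)),
    pd_sub hc (differentiableAt_const _), pd_coord, pd_const]
  simp

/-- A continuous function on a closed ball whose boundary values do not exceed the value at the
centre has an interior local maximum. -/
lemma exists_isLocalMax_of_boundary_le {Q : E 3 → ℝ} (hQ : Continuous Q) {z : E 3} {R : ℝ}
    (hR : 0 < R) (hb : ∀ x, dist x z = R → Q x ≤ Q z) :
    ∃ x ∈ ball z R, IsLocalMax Q x ∧ Q z ≤ Q x := by
  obtain ⟨x, hx, hmax⟩ := (isCompact_closedBall z R).exists_isMaxOn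
    ⟨z, mem_closedBall_self hR.le⟩ hQ.continuousOn
  have hloc : ∀ w ∈ ball z R, (∀ y ∈ closedBall z R, Q y ≤ Q w) → IsLocalMax Q w :=
    fun w hw h => by
      filter_upwards [isOpen_ball.mem_nhds hw] with y hy
      exact h y (ball_subset_closedBall hy)
  rcases lt_or_eq_of_le (mem_closedBall.1 hx) with h | h
  · exact ⟨x, h, hloc x h hmax, hmax (mem_closedBall_self hR.le)⟩
  · exact ⟨z, mem_ball_self hR, hloc z (mem_ball_self hR) fun y hy => (hmax hy).trans (hb x h),
      le_rfl⟩

lemma le_one_add_of_resid {v : E 3 → ℝ} (hv : ContDiff ℝ 2 v) {z : E 3} {R M κ b : ℝ} (hR : 0 < R)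
    (hM : ∀ x ∈ closedBall z R, |v x| ≤ M) (hκ : ∀ x ∈ closedBall z R, |resid v x| ≤ κ)
    (hb0 : 0 ≤ b) (hb : 2 * M ≤ b * R ^ 2) : v z ≤ 1 + (6 * b + κ) / 2 := by
  have hz := mem_closedBall_self (x := z) hR.le
  have hκ0 : 0 ≤ κ := (abs_nonneg _).trans (hκ z hz)
  have hq : ContDiff ℝ 2 fun x => v x - b * sqd z x :=
    hv.sub (contDiff_const.mul (contDiff_sqd z))
  obtain ⟨x, hx, hmax, hle⟩ := exists_isLocalMax_of_boundary_le hq.continuous hR fun x hx => by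
    have h1 := (abs_le.1 (hM x (mem_closedBall.2 hx.le))).2
    have h2 := (abs_le.1 (hM z hz)).1
    simp only [sqd_self, sqd_eq z x, hx]
    linarith
  have h2 : ∀ i, pd i (pd i v) x ≤ 2 * b := fun i => by
    have h := hmax.pd_pd_nonpos hq i
    have hs1 : ContDiff ℝ 1 (sqd z) := contDiff_sqd z
    have e : pd i (fun x => v x - b * sqd z x) = fun x => pd i v x - b * pd i (sqd z) x :=
      funext fun y => by
        have hsd : DifferentiableAt ℝ (sqd z) y := hs1.differentiable (by norm_num) y
        rw [pd_sub (hv.differentiable (by norm_num) y) (hsd.const_mul b), pd_const_mul _ hsd]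
    have hd : DifferentiableAt ℝ (pd i (sqd z)) x :=
      (contDiff_pd_one (contDiff_sqd z) i).differentiable (by norm_num) x
    rw [e, pd_sub ((contDiff_pd_one hv i).differentiable (by norm_num) x) (hd.const_mul b),
      pd_const_mul _ hd, pd_pd_sqd] at h
    linarith
  have hl : lap v x ≤ 6 * b := by
    rw [lap_eq hv, sum_three]; linarith [h2 0, h2 1, h2 2]
  have hr := (abs_le.1 (hκ x (ball_subset_closedBall hx))).2
  have hs := sqd_nonneg z x
  have hvz : v z ≤ v x := by
    simp only [sqd_self] at hle
    nlinarith
  refine hvz.trans ?_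
  by_contra! hcon
  have h1 : 1 < v x := by linarith
  unfold resid W' at hr
  nlinarith [mul_pos (sub_pos.2 h1) (sub_pos.2 h1)]

lemma pd_neg_fun (v : E 3 → ℝ) (i : Fin 3) : pd i (fun y => - v y) = fun y => - pd i v y :=
  funext fun _ => pd_neg

lemma lap_neg {v : E 3 → ℝ} (hv : ContDiff ℝ 2 v) (x : E 3) : lap (fun y => - v y) x = - lap v x := by
  rw [lap_eq hv, lap_eq hv.neg]
  simp only [pd_neg_fun, Finset.sum_neg_distrib]

lemma resid_neg {v : E 3 → ℝ} (hv : ContDiff ℝ 2 v) (x : E 3) :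
    resid (fun y => - v y) x = - resid v x := by
  simp only [resid, lap_neg hv, W']; ring

lemma abs_le_one_add_of_resid {v : E 3 → ℝ} (hv : ContDiff ℝ 2 v) {z : E 3} {R M κ b : ℝ}
    (hR : 0 < R) (hM : ∀ x ∈ closedBall z R, |v x| ≤ M)
    (hκ : ∀ x ∈ closedBall z R, |resid v x| ≤ κ) (hb0 : 0 ≤ b) (hb : 2 * M ≤ b * R ^ 2) :
    |v z| ≤ 1 + (6 * b + κ) / 2 := by
  refine abs_le.2 ⟨?_, le_one_add_of_resid hv hR hM hκ hb0 hb⟩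
  have := le_one_add_of_resid (v := fun y => - v y) hv.neg hR (fun x hx => by
    rw [abs_neg]; exact hM x hx) (fun x hx => by rw [resid_neg hv, abs_neg]; exact hκ x hx) hb0 hb
  linarith

/-- The inequality at an interior maximum of Modica's function. -/
lemma modica_at_max {v : E 3 → ℝ} (hv : ContDiff ℝ 3 v) {y x : E 3} {a b : ℝ}
    (hmax : IsLocalMax (fun x => gsq v x / 2 - W (v x) - a * (2 - v x ^ 2) - b * sqd y x) x) :
    gsq v x * (2 * a * (gsq v x - v x ^ 4 + v x ^ 2))
      ≤ gsq v x * (gdot v (resid v) x - (W' (v x) - 2 * a * v x) * resid v x + 6 * b)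
        - 4 * b * (W' (v x) - 2 * a * v x) * rad y v x := by
  have hv2 : ContDiff ℝ 2 v := hv.of_le (by norm_num)
  have hp2 : ∀ i, ContDiff ℝ 2 (pd i v) := fun i => by
    have h : ContDiff ℝ ((2 : ℕ) + 1) v := by norm_num; exact hv
    exact_mod_cast contDiff_pd h i
  have hp1 : ∀ i j, ContDiff ℝ 1 (pd i (pd j v)) := fun i j => contDiff_pd_one (hp2 j) i
  have hdv : Differentiable ℝ v := hv2.differentiable (by norm_num)
  have hdp : ∀ i, Differentiable ℝ (pd i v) := fun i => (hp2 i).differentiable (by norm_num)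
  have hdpp : ∀ i j, Differentiable ℝ (pd i (pd j v)) := fun i j =>
    (hp1 i j).differentiable (by norm_num)
  have hds : Differentiable ℝ (sqd y) := (contDiff_sqd (n := 1) y).differentiable (by norm_num)
  have hdps : ∀ i, Differentiable ℝ (pd i (sqd y)) := fun i =>
    (contDiff_pd_one (contDiff_sqd y) i).differentiable (by norm_num)
  set Φ : ℝ → ℝ := fun t => - W t - a * (2 - t ^ 2) with hΦ
  have hΦd : ∀ t, HasDerivAt Φ (-(W' t - 2 * a * t)) t := fun t => by
    refine ((hasDerivAt_W t).neg.sub ((((hasDerivAt_id t).pow 2).const_sub 2).const_mul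
      a)).congr_deriv ?_
    simp; ring
  have hΦd2 : ∀ t, HasDerivAt (fun t => -(W' t - 2 * a * t)) (-(3 * t ^ 2 - 1 - 2 * a)) t :=
    fun t => by
      refine ((hasDerivAt_W' t).sub ((hasDerivAt_id t).const_mul (2 * a))).neg.congr_deriv ?_
      simp
  have hcΦ : ContDiff ℝ 2 Φ := by
    exact (contDiff_W.neg).sub (contDiff_const.mul (contDiff_const.sub (contDiff_id.pow 2)))
  set Q : E 3 → ℝ := fun x => ((1 / 2) * ∑ j, pd j v x ^ 2 + Φ (v x)) - b * sqd y x with hQ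
  have hmaxQ : IsLocalMax Q x := by
    have : Q = fun x => gsq v x / 2 - W (v x) - a * (2 - v x ^ 2) - b * sqd y x := by
      ext z; simp only [hQ, hΦ, gsq]; ring
    rw [this]; exact hmax
  have hQ2 : ContDiff ℝ 2 Q :=
    ((contDiff_const.mul (ContDiff.sum fun i _ => (hp2 i).pow 2)).add (hcΦ.comp hv2)).sub
      (contDiff_const.mul (contDiff_sqd y))
  have d1 : ∀ i, pd i Q = fun z => (∑ j, pd j v z * pd i (pd j v) z
      + -(W' (v z) - 2 * a * v z) * pd i v z) - b * pd i (sqd y) z := fun i => funext fun z => by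
    have s1 : DifferentiableAt ℝ (fun z => ∑ j, pd j v z ^ 2) z :=
      (DifferentiableAt.fun_sum fun j _ => (hdp j z).fun_pow 2)
    have s2 : DifferentiableAt ℝ (fun z => Φ (v z)) z :=
      (hΦd (v z)).differentiableAt.comp z (hdv z)
    simp only [hQ]
    rw [pd_sub ((s1.const_mul _).fun_add s2) ((hds z).const_mul b), pd_add (s1.const_mul _) s2,
      pd_const_mul _ s1, pd_const_mul _ (hds z), pd_comp (hΦd _) (hdv z),
      pd_sum _ fun j _ => (hdp j z).fun_pow 2, Finset.mul_sum]
    congr 2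
    refine Finset.sum_congr rfl fun j _ => ?_
    rw [pd_pow 2 (hdp j z)]; push_cast; ring
  have d2 : ∀ i, pd i (pd i Q) x = (∑ j, (pd i (pd j v) x ^ 2 + pd j v x * pd i (pd i (pd j v)) x)
      + (-(3 * v x ^ 2 - 1 - 2 * a) * pd i v x * pd i v x
        + -(W' (v x) - 2 * a * v x) * pd i (pd i v) x)) - b * 2 := fun i => by
    have s1 : ∀ j, DifferentiableAt ℝ (fun z => pd j v z * pd i (pd j v) z) x := fun j =>
      (hdp j x).fun_mul (hdpp i j x)
    have s1' : DifferentiableAt ℝ (fun z => ∑ j, pd j v z * pd i (pd j v) z) x :=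
      DifferentiableAt.fun_sum fun j _ => s1 j
    have s2 : DifferentiableAt ℝ (fun z => -(W' (v z) - 2 * a * v z)) x :=
      (hΦd2 (v x)).differentiableAt.comp x (hdv x)
    rw [d1, pd_sub (s1'.fun_add (s2.fun_mul (hdp i x))) ((hdps i x).const_mul b),
      pd_add s1' (s2.fun_mul (hdp i x)), pd_const_mul _ (hdps i x), pd_pd_sqd,
      pd_mul s2 (hdp i x), pd_comp (k := fun t => -(W' t - 2 * a * t)) (hΦd2 _) (hdv x),
      pd_sum _ fun j _ => s1 j]
    congr 2
    refine Finset.sum_congr rfl fun j _ => ?_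
    rw [pd_mul (hdp j x) (hdpp i j x)]; ring
  have hlapd : ∀ z, DifferentiableAt ℝ (lap v) z := fun z => by
    have : lap v = fun z => ∑ i, pd i (pd i v) z := funext fun z => lap_eq hv2 z
    rw [this]; exact DifferentiableAt.fun_sum fun i _ => hdpp i i z
  have third : ∀ j, ∑ i, pd i (pd i (pd j v)) x = (3 * v x ^ 2 - 1) * pd j v x - pd j (resid v) x :=
    fun j => by
      have e1 : ∀ i, pd i (pd i (pd j v)) x = pd j (pd i (pd i v)) x := fun i => by
        have : pd i (pd j v) = pd j (pd i v) := funext fun z => pd_comm hv2 i j z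
        rw [this, pd_comm (hp2 i)]
      have e2 : pd j (lap v) x = ∑ i, pd j (pd i (pd i v)) x := by
        have : lap v = fun z => ∑ i, pd i (pd i v) z := funext fun z => lap_eq hv2 z
        rw [this, pd_sum _ fun i _ => hdpp i i x]
      have e3 : pd j (resid v) x = (3 * v x ^ 2 - 1) * pd j v x - pd j (lap v) x := by
        have : resid v = fun y => W' (v y) - lap v y := rfl
        rw [this, pd_sub (f := fun y => W' (v y))
          ((hasDerivAt_W' (v x)).differentiableAt.comp x (hdv x)) (hlapd x),
          pd_comp (hasDerivAt_W' _) (hdv x)]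
      rw [e3, e2, Finset.sum_congr rfl fun i _ => e1 i]; ring
  have hL : ∑ i, pd i (pd i v) x = W' (v x) - resid v x := by
    rw [← lap_eq hv2]; simp [resid]
  have first : ∀ i, ∑ j, pd j v x * pd i (pd j v) x
      = (W' (v x) - 2 * a * v x) * pd i v x + 2 * b * (x i - y i) := fun i => by
    have := hmaxQ.pd_eq_zero i
    rw [d1] at this
    simp only [pd_sqd] at this
    linarith
  have second := fun i => (d2 i).symm.trans_le (hmaxQ.pd_pd_nonpos hQ2 i)
  have CS : ∀ i, (∑ j, pd j v x * pd i (pd j v) x) ^ 2 ≤ gsq v x * ∑ j, pd i (pd j v) x ^ 2 :=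
    fun i => Finset.sum_mul_sq_le_sq_mul_sq _ _ _
  have c0 := CS 0
  have c1 := CS 1
  have c2 := CS 2
  rw [first] at c0 c1 c2
  have t0 := third 0
  have t1 := third 1
  have t2 := third 2
  have f0 := second 0
  have f1 := second 1
  have f2 := second 2
  simp only [sum_three] at t0 t1 t2 f0 f1 f2 hL c0 c1 c2
  set S := (pd 0 (pd 0 v) x ^ 2 + pd 0 (pd 1 v) x ^ 2 + pd 0 (pd 2 v) x ^ 2)
    + (pd 1 (pd 0 v) x ^ 2 + pd 1 (pd 1 v) x ^ 2 + pd 1 (pd 2 v) x ^ 2)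
    + (pd 2 (pd 0 v) x ^ 2 + pd 2 (pd 1 v) x ^ 2 + pd 2 (pd 2 v) x ^ 2) with hS
  set P := gsq v x with hP
  have hPe : P = pd 0 v x ^ 2 + pd 1 v x ^ 2 + pd 2 v x ^ 2 := by rw [hP, gsq, sum_three]
  have hP0 : 0 ≤ P := gsq_nonneg v x
  have gd : gdot v (resid v) x = pd 0 v x * pd 0 (resid v) x + pd 1 v x * pd 1 (resid v) x
      + pd 2 v x * pd 2 (resid v) x := by rw [gdot, sum_three]
  have rd : rad y v x = (x 0 - y 0) * pd 0 v x + (x 1 - y 1) * pd 1 v x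
      + (x 2 - y 2) * pd 2 v x := by rw [rad, sum_three]
  set f := resid v x
  set F := W' (v x) - 2 * a * v x with hF
  have hS1 : S ≤ - 2 * a * P + gdot v (resid v) x + F * (W' (v x) - f) + 6 * b := by
    have k0 : pd 0 v x * (pd 0 (pd 0 (pd 0 v)) x + pd 1 (pd 1 (pd 0 v)) x + pd 2 (pd 2 (pd 0 v)) x)
      = pd 0 v x * ((3 * v x ^ 2 - 1) * pd 0 v x - pd 0 (resid v) x) := by rw [t0]
    have k1 : pd 1 v x * (pd 0 (pd 0 (pd 1 v)) x + pd 1 (pd 1 (pd 1 v)) x + pd 2 (pd 2 (pd 1 v)) x)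
      = pd 1 v x * ((3 * v x ^ 2 - 1) * pd 1 v x - pd 1 (resid v) x) := by rw [t1]
    have k2 : pd 2 v x * (pd 0 (pd 0 (pd 2 v)) x + pd 1 (pd 1 (pd 2 v)) x + pd 2 (pd 2 (pd 2 v)) x)
      = pd 2 v x * ((3 * v x ^ 2 - 1) * pd 2 v x - pd 2 (resid v) x) := by rw [t2]
    have k3 : F * (pd 0 (pd 0 v) x + pd 1 (pd 1 v) x + pd 2 (pd 2 v) x) = F * (W' (v x) - f) := by
      rw [hL]
    rw [hPe, gd, hS]
    linarith
  have hS2 : F ^ 2 * P + 4 * b * F * rad y v x ≤ P * S := by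
    have n0 := sq_nonneg (2 * b * (x 0 - y 0))
    have n1 := sq_nonneg (2 * b * (x 1 - y 1))
    have n2 := sq_nonneg (2 * b * (x 2 - y 2))
    have : F ^ 2 * P = F ^ 2 * (pd 0 v x ^ 2 + pd 1 v x ^ 2 + pd 2 v x ^ 2) := by rw [hPe]
    rw [this, rd, hS]
    linarith
  have hS3 := mul_le_mul_of_nonneg_left hS1 hP0
  have hG : 0 ≤ P * (4 * a ^ 2 * v x ^ 2) := by positivity
  have hFW : F ^ 2 * P - P * (F * W' (v x)) = P * (-2 * a * v x ^ 2 * (v x ^ 2 - 1))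
      + P * (4 * a ^ 2 * v x ^ 2) := by
    rw [hF]; unfold W'; ring
  linarith

/-! ### A Modica-type estimate -/

set_option maxHeartbeats 1000000 in
lemma modica {M s : ℝ} (hM : 1 ≤ M) (hs : 0 < s) (hsM : s ≤ 1 / (6 * M)) {v : E 3 → ℝ}
    (hv : ContDiff ℝ 3 v) {y : E 3} (h1 : ∀ x ∈ closedBall y (2 / s ^ 8), |v x| ≤ M)
    (h2 : ∀ x ∈ closedBall y (2 / s ^ 8), ∀ i, |pd i v x| ≤ M)
    (h3 : ∀ x ∈ closedBall y (2 / s ^ 8), |resid v x| ≤ M * s ^ 6)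
    (h4 : ∀ x ∈ closedBall y (2 / s ^ 8), ∀ i, |pd i (resid v) x| ≤ M * s ^ 6) :
    disc v y ≤ 3 * s ^ 2 := by
  have hv2 : ContDiff ℝ 2 v := hv.of_le (by norm_num)
  set R := 1 / s ^ 8 with hR
  have hR0 : 0 < R := by positivity
  have hRR : 2 / s ^ 8 = R + R := by rw [hR]; ring
  have hsM' : s * (6 * M) ≤ 1 := by rwa [le_div_iff₀ (by positivity)] at hsM
  have hs1 : s ≤ 1 / 6 := by nlinarith
  have hs2 : s ^ 2 * (36 * M ^ 2) ≤ 1 := by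
    have : (s * (6 * M)) ^ 2 ≤ 1 := pow_le_one₀ (by positivity) hsM'
    nlinarith
  have hM2 : M ≤ M ^ 2 := le_self_pow₀ hM (by norm_num)
  have hs2M : s ^ 2 * (36 * M) ≤ 1 := le_trans (by gcongr) hs2
  have hs16 : s ^ 16 ≤ s ^ 6 := pow_le_pow_of_le_one hs.le (by linarith) (by norm_num)
  have hs7 : s ^ 7 ≤ s ^ 6 := pow_le_pow_of_le_one hs.le (by linarith) (by norm_num)
  have hs6p : 0 < s ^ 6 := by positivity
  have sup : ∀ x ∈ closedBall y R, |v x| ≤ 1 + 7 * M * s ^ 6 := fun x hx => by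
    have hsub : closedBall x R ⊆ closedBall y (2 / s ^ 8) := by
      rw [hRR]; exact closedBall_subset_closedBall' (by rw [mem_closedBall] at hx; linarith)
    have := abs_le_one_add_of_resid (b := 2 * M * s ^ 16) hv2 hR0 (fun z hz => h1 z (hsub hz))
      (fun z hz => h3 z (hsub hz)) (by positivity) (by rw [hR]; field_simp; rfl)
    refine this.trans ?_
    nlinarith
  have hsubR : closedBall y R ⊆ closedBall y (2 / s ^ 8) := by
    rw [hRR]; exact closedBall_subset_closedBall (by linarith)
  have e0 : 7 * M * s ^ 6 ≤ (7 / 36) * s ^ 4 := by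
    have : s ^ 6 * (36 * M) ≤ s ^ 4 * 1 := by
      calc s ^ 6 * (36 * M) = s ^ 4 * (s ^ 2 * (36 * M)) := by ring
        _ ≤ s ^ 4 * 1 := by gcongr
    nlinarith
  have hs4 : s ^ 4 ≤ s ^ 2 / 36 := by
    have : s ^ 2 ≤ 1 / 36 := by nlinarith
    nlinarith [sq_nonneg s]
  have hsq : s ^ 2 ≤ 1 / 36 := by nlinarith
  have sup2 : ∀ x ∈ closedBall y R, v x ^ 2 ≤ 1 + s ^ 2 / 16 := fun x hx => by
    have k1 : |v x| ≤ 1 + s ^ 2 / 100 := (sup x hx).trans (by nlinarith [sq_nonneg s])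
    have k2 : v x ^ 2 ≤ (1 + s ^ 2 / 100) ^ 2 := by rw [← sq_abs]; gcongr
    nlinarith [sq_nonneg s]
  have gb : ∀ x ∈ closedBall y R, gsq v x ≤ 3 * M ^ 2 := fun x hx => by
    unfold gsq; rw [sum_three]
    have := fun i => sq_le_sq' (abs_le.1 (h2 x (hsubR hx) i)).1 (abs_le.1 (h2 x (hsubR hx) i)).2
    linarith [this 0, this 1, this 2]
  by_contra! hcon
  set b := 2 * M ^ 2 * s ^ 16 with hb
  set Q : E 3 → ℝ := fun x => gsq v x / 2 - W (v x) - s ^ 2 * (2 - v x ^ 2) - b * sqd y x with hQ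
  have hQy : s ^ 2 < Q y := by
    unfold disc at hcon
    simp only [hQ, sqd_self]
    nlinarith [sq_nonneg (v y), mul_nonneg (sq_nonneg s) (sq_nonneg (v y))]
  have hQc : Continuous Q := by
    have c1 := (contDiff_gsq hv2).continuous
    have c2 := (contDiff_W (n := 0)).continuous.comp hv.continuous
    have c3 := hv.continuous
    have c4 := (contDiff_sqd (n := 0) y).continuous
    exact (((c1.div_const 2).sub c2).sub (continuous_const.mul
      (continuous_const.sub (c3.pow 2)))).sub (continuous_const.mul c4)
  obtain ⟨x, hx, hmax, hle⟩ := exists_isLocalMax_of_boundary_le hQc hR0 fun x hx => by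
    have hx' : x ∈ closedBall y R := mem_closedBall.2 hx.le
    have k1 := gb x hx'
    have k2 := sup2 x hx'
    have k3 := W_nonneg (v x)
    have k4 : b * R ^ 2 = 2 * M ^ 2 := by rw [hb, hR]; field_simp
    refine le_trans ?_ hQy.le
    simp only [hQ, sqd_eq y x, hx]
    rw [k4]
    have : 0 ≤ s ^ 2 * (2 - v x ^ 2) := mul_nonneg (sq_nonneg s) (by linarith)
    nlinarith
  have hx' : x ∈ closedBall y R := ball_subset_closedBall hx
  have hQx : s ^ 2 < Q x := hQy.trans_le hle
  have main := modica_at_max hv hmax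
  have m1 := sup2 x hx'
  have m2 := W_nonneg (v x)
  have m3 := sqd_nonneg y x
  have hP : 2 * W (v x) + 2 * s ^ 2 ≤ gsq v x := by
    simp only [hQ] at hQx
    have : 0 ≤ s ^ 2 * (2 - v x ^ 2) := mul_nonneg (sq_nonneg s) (by linarith)
    have : 0 ≤ b * sqd y x := by positivity
    linarith
  set P := gsq v x with hPdef
  have hP0 : s ^ 2 ≤ P := by nlinarith [sq_nonneg s]
  have hPpos : 0 < P := lt_of_lt_of_le (by positivity) hP0
  have hrad : |rad y v x| ≤ R * P / s := by
    refine abs_le_of_sq_le_sq ?_ (by positivity)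
    have r1 := rad_sq_le y v x
    have r2 : ‖x - y‖ ^ 2 ≤ R ^ 2 := by
      rw [← dist_eq_norm]; gcongr; exact hx'
    calc rad y v x ^ 2 ≤ ‖x - y‖ ^ 2 * P := r1
      _ ≤ R ^ 2 * P := by gcongr
      _ ≤ (R * P / s) ^ 2 := by
        rw [show (R * P / s) ^ 2 = R ^ 2 * P ^ 2 / s ^ 2 by rw [div_pow, mul_pow],
          le_div_iff₀ (by positivity)]
        calc R ^ 2 * P * s ^ 2 ≤ R ^ 2 * P * P := by gcongr
          _ = R ^ 2 * P ^ 2 := by ring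
  have hF : |W' (v x) - 2 * s ^ 2 * v x| ≤ 5 := by
    have e : W' (v x) - 2 * s ^ 2 * v x = v x * (v x ^ 2 - 1 - 2 * s ^ 2) := by unfold W'; ring
    rw [e, abs_mul]
    have a1 : |v x| ≤ 2 := abs_le_of_sq_le_sq (by linarith) (by norm_num)
    have a2 : |v x ^ 2 - 1 - 2 * s ^ 2| ≤ 2 := by
      rw [abs_le]; constructor <;> linarith [sq_nonneg (v x), sq_nonneg s]
    calc |v x| * |v x ^ 2 - 1 - 2 * s ^ 2| ≤ 2 * 2 := by gcongr
      _ ≤ 5 := by norm_num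
  have hgd : gdot v (resid v) x ≤ 3 * M ^ 2 * s ^ 6 := by
    have : ∀ i, pd i v x * pd i (resid v) x ≤ M * (M * s ^ 6) := fun i => by
      refine (le_abs_self _).trans ?_
      rw [abs_mul]
      exact mul_le_mul (h2 x (hsubR hx') i) (h4 x (hsubR hx') i) (abs_nonneg _) (by positivity)
    unfold gdot; rw [sum_three]
    linarith [this 0, this 1, this 2]
  have hFf : |(W' (v x) - 2 * s ^ 2 * v x) * resid v x| ≤ 5 * (M * s ^ 6) := by
    rw [abs_mul]; exact mul_le_mul hF (h3 x (hsubR hx')) (abs_nonneg _) (by norm_num)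
  have hFr : |4 * b * (W' (v x) - 2 * s ^ 2 * v x) * rad y v x| ≤ P * (40 * M ^ 2 * s ^ 7) := by
    rw [abs_mul, abs_mul, abs_of_nonneg (by positivity : 0 ≤ 4 * b)]
    calc 4 * b * |W' (v x) - 2 * s ^ 2 * v x| * |rad y v x| ≤ 4 * b * 5 * (R * P / s) := by gcongr
      _ = P * (40 * M ^ 2 * s ^ 7) := by rw [hb, hR]; field_simp; ring
  have hlow : 2 * s ^ 4 ≤ 2 * s ^ 2 * (P - v x ^ 4 + v x ^ 2) := by
    have : s ^ 2 ≤ P - v x ^ 4 + v x ^ 2 := by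
      unfold W at hP
      have : v x ^ 4 ≤ (1 + s ^ 2 / 16) ^ 2 := by
        calc v x ^ 4 = (v x ^ 2) ^ 2 := by ring
          _ ≤ _ := by gcongr
      nlinarith
    calc 2 * s ^ 4 = 2 * s ^ 2 * s ^ 2 := by ring
      _ ≤ _ := by gcongr
  have key : P * (2 * s ^ 4) ≤ P * (60 * M ^ 2 * s ^ 6) := by
    have c1 := mul_le_mul_of_nonneg_left hlow hPpos.le
    have c2 : gdot v (resid v) x - (W' (v x) - 2 * s ^ 2 * v x) * resid v x + 6 * b
        ≤ 20 * M ^ 2 * s ^ 6 := by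
      have d1 := (abs_le.1 hFf).1
      have d2 : M * s ^ 6 ≤ M ^ 2 * s ^ 6 := by gcongr
      have d3 : M ^ 2 * s ^ 16 ≤ M ^ 2 * s ^ 6 := by gcongr
      rw [hb]; linarith
    have c3 := mul_le_mul_of_nonneg_left c2 hPpos.le
    have c4 := (abs_le.1 hFr).1
    have c5 : P * (40 * M ^ 2 * s ^ 7) ≤ P * (40 * M ^ 2 * s ^ 6) := by gcongr
    linarith
  have key2 := le_of_mul_le_mul_left key hPpos
  have : 60 * M ^ 2 * s ^ 6 ≤ (60 / 36) * s ^ 4 := by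
    calc 60 * M ^ 2 * s ^ 6 = (60 / 36) * s ^ 4 * (s ^ 2 * (36 * M ^ 2)) := by ring
      _ ≤ (60 / 36) * s ^ 4 * 1 := by gcongr
      _ = _ := by ring
  have : 0 < s ^ 4 := by positivity
  linarith

/-! ### The positive part of the discrepancy for small residual -/

lemma gsq_le_of_lap {w : E 3 → ℝ} (hw : ContDiff ℝ 2 w) (p : E 3) {a : ℝ} {c : E 3 → ℝ}
    (hc : Continuous c) (h1 : ∀ y ∈ ball p 2, |w y| ≤ a) (h2 : ∀ y ∈ ball p 2, |lap w y| ≤ c y) :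
    ∫ x in ball p 1, gsq w x ≤ ∫ x in ball p 2, (a * c x + cutConst * a ^ 2) := by
  have hL := one_le_cutConst
  have hw1 : ContDiff ℝ 1 w := hw.of_le (by norm_num)
  have hb : ∀ y ∈ ball p 2, |w y * lap w y| ≤ a * c y := fun y hy => by
    rw [abs_mul]
    exact mul_le_mul (h1 y hy) (h2 y hy) (abs_nonneg _) ((abs_nonneg _).trans (h1 y hy))
  have e : ∀ y, w y * W' (w y) - resid w y * w y = w y * lap w y := fun y => by
    unfold resid; ring
  have := test_cut hw (g := fun t => t) (g' := fun _ => 1) (fun t => hasDerivAt_id t)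
    continuous_const p one_pos 0 (a := gsq w) (b := fun x => a * c x + cutConst * a ^ 2)
    (integrableOn_ball (continuous_gsq hw1) _ _) (integrableOn_ball (by fun_prop) _ _)
    (fun y hy => by
      have := (abs_le.1 (hb y (ball_subset_ball (by norm_num) hy))).1
      have : 0 ≤ cutConst * a ^ 2 := by positivity
      linarith [e y]) (fun y hy => by
      have hy' : y ∈ ball p 2 := by simpa using hy
      have k1 := (abs_le.1 (hb y hy')).1
      have k0 : 0 ≤ a * c y := (abs_nonneg _).trans (hb y hy')
      have hG := gsq_nonneg w y
      have k2 := young_gdot (D := gdot w (cut p 1) y) (L := cutConst) (G := gsq w y)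
        (by simpa using gdot_cut_sq_le (p := p) (R := 1) y w) hG (by linarith) (cut p 1 y) (w y)
      have k3 : w y ^ 2 ≤ a ^ 2 := by rw [← sq_abs]; gcongr; exact h1 y hy'
      have k4 : w y ^ 2 * cutConst ≤ a ^ 2 * cutConst := by gcongr
      have hz0 := cut_nonneg p 1 y
      have hz2 : cut p 1 y ^ 2 ≤ 1 := pow_le_one₀ hz0 (cut_le_one p 1 y)
      have k5 : cut p 1 y ^ 2 * -(a * c y) ≤ cut p 1 y ^ 2 * (w y * lap w y) := by gcongr
      have k6 : cut p 1 y ^ 2 * (a * c y) ≤ 1 * (a * c y) := by gcongr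
      have k7 : cut p 1 y ^ (0 + 2) * (1 * gsq w y + w y * W' (w y))
          - cut p 1 y ^ (0 + 2) * (resid w y * w y)
          = cut p 1 y ^ 2 * gsq w y + cut p 1 y ^ 2 * (w y * lap w y) := by
        rw [← e y]; ring
      have k8 : w y * ((((0 : ℕ) : ℝ) + 2) * cut p 1 y ^ (0 + 1) * gdot w (cut p 1) y)
          = 2 * cut p 1 y * w y * gdot w (cut p 1) y := by push_cast; ring
      rw [k7, k8]
      linarith)
  simpa using this

lemma abs_W_sub_le {a b M : ℝ} (hM : 1 ≤ M) (ha : |a| ≤ M) (hb : |b| ≤ M) :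
    |W a - W b| ≤ 2 * M ^ 3 * |a - b| := by
  have e : W a - W b = ((a + b) * ((a ^ 2 + b ^ 2 - 2) / 4)) * (a - b) := by unfold W; ring
  rw [e, abs_mul]
  gcongr
  have h1 : |a + b| ≤ 2 * M := (abs_add_le _ _).trans (by linarith)
  have h2 : |(a ^ 2 + b ^ 2 - 2) / 4| ≤ M ^ 2 := by
    have k1 : a ^ 2 ≤ M ^ 2 := by rw [← sq_abs]; gcongr
    have k2 : b ^ 2 ≤ M ^ 2 := by rw [← sq_abs]; gcongr
    have k3 : 1 ≤ M ^ 2 := one_le_pow₀ hM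
    rw [abs_le]; constructor <;> linarith [sq_nonneg a, sq_nonneg b]
  rw [abs_mul]
  calc |a + b| * |(a ^ 2 + b ^ 2 - 2) / 4| ≤ 2 * M * M ^ 2 := by gcongr
    _ = _ := by ring

lemma gsq_add_le {v w : E 3 → ℝ} {x : E 3} (hv : DifferentiableAt ℝ v x)
    (hw : DifferentiableAt ℝ w x) {t : ℝ} (ht : 0 < t) :
    gsq (fun y => v y + w y) x ≤ (1 + t) * gsq v x + (1 + 1 / t) * gsq w x := by
  have : ∀ a b : ℝ, (a + b) ^ 2 ≤ (1 + t) * a ^ 2 + (1 + 1 / t) * b ^ 2 := fun a b => by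
    have e : (1 + t) * a ^ 2 + (1 + 1 / t) * b ^ 2 - (a + b) ^ 2 = (t * a - b) ^ 2 / t := by
      field_simp; ring
    have : 0 ≤ (t * a - b) ^ 2 / t := by positivity
    linarith
  simp only [gsq, sum_three, pd_add hv hw]
  linarith [this (pd 0 v x) (pd 0 w x), this (pd 1 v x) (pd 1 w x), this (pd 2 v x) (pd 2 w x)]

set_option maxHeartbeats 1000000 in
/-- The positive part of the discrepancy is small where the residual is very small. -/
lemma exists_disc_le : ∃ C : ℝ, 1 ≤ C ∧ ∀ (u : E 3 → ℝ), ContDiff ℝ 2 u → ∀ x s, 0 < s →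
    s ≤ 1 / C → Fn u x (C / s ^ 8) ≤ s ^ 48 → ∫ y in ball x 1, max (disc u y) 0 ≤ C * s ^ 2 := by
  obtain ⟨M, hM, hmol⟩ := exists_molBound
  have hL := one_le_cutConst
  set L := cutConst with hLdef
  set V : ℝ := Real.pi * 4 / 3 with hV
  have hV0 : 0 < V := by positivity
  set K := M * ((18 * M ^ 3 + 1 + L * M) * (8 * V) + 1) with hK
  have hK0 : 0 < K := by positivity
  set D := V * (3 + 3 * M ^ 2 + 16 * M ^ 4) with hD
  have hD0 : 0 < D := by positivity
  refine ⟨D + K + 12 * M, by linarith, fun u hu x s hs hsC hF => ?_⟩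
  set C := D + K + 12 * M with hC
  have hsM : s ≤ 1 / (6 * M) := hsC.trans (by gcongr; linarith)
  have hs1 : s ≤ 1 := hsM.trans (by rw [div_le_one (by positivity)]; linarith)
  have hs8 : s ^ 8 ≤ 1 := pow_le_one₀ hs.le hs1
  have hs6 : s ^ 6 ≤ 1 := pow_le_one₀ hs.le hs1
  have hs12 : s ^ 12 ≤ 1 := pow_le_one₀ hs.le hs1
  have hi8 : 1 ≤ 1 / s ^ 8 := by rw [le_div_iff₀ (by positivity)]; linarith
  have hC8 : 12 * (1 / s ^ 8) ≤ C / s ^ 8 := by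
    rw [mul_one_div]; gcongr; linarith
  have mb : ∀ z ∈ closedBall x (2 + 2 / s ^ 8), MolBound M s u z := fun z hz => by
    refine hmol u hu z s hs hs1 (le_trans (Fn_mono hu (ball_subset_ball' ?_)) hF)
    rw [mem_closedBall] at hz
    have : 2 / s ^ 8 = 2 * (1 / s ^ 8) := by ring
    linarith
  have mb2 : ∀ z ∈ ball x 2, MolBound M s u z := fun z hz =>
    mb z (mem_closedBall.2 (by rw [mem_ball] at hz; have : 0 < 2 / s ^ 8 := by positivity
                               linarith))
  have hs6p : 0 < s ^ 6 := by positivity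
  set v := av phi u (s ^ 6) with hv
  have hv3 : ContDiff ℝ 3 v := contDiff_mol hu.continuous hs6p 3
  have hv2 : ContDiff ℝ 2 v := hv3.of_le (by norm_num)
  set w : E 3 → ℝ := fun y => u y - v y with hw
  have hw2 : ContDiff ℝ 2 w := hu.sub hv2
  have hrc := continuous_resid hu
  have ub : ∀ z ∈ ball x 2, |u z| ≤ 2 * M := fun z hz => by
    have h1 := (mb2 z hz).close
    have h2 := (mb2 z hz).bdd
    have h3 : |u z| ≤ |u z - v z| + |v z| := by simpa using abs_add_le (u z - v z) (v z)
    have h4 : M * s ^ 12 ≤ M * 1 := by gcongr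
    linarith
  have vb : ∀ z ∈ ball x 2, |v z| ≤ 2 * M := fun z hz => (mb2 z hz).bdd.trans (by linarith)
  have lapw : ∀ z ∈ ball x 2, |lap w z| ≤ 18 * M ^ 3 + 1 + resid u z ^ 2 := fun z hz => by
    have e : lap w z = (W' (u z) - W' (v z)) + resid v z - resid u z := by
      have : lap w z = lap u z - lap v z := by
        rw [lap_eq hw2, lap_eq hu, lap_eq hv2, ← Finset.sum_sub_distrib]
        refine Finset.sum_congr rfl fun i _ => ?_
        have : pd i w = fun y => pd i u y - pd i v y := funext fun y =>
          pd_sub ((hu.differentiable (by norm_num)) y) ((hv2.differentiable (by norm_num)) y)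
        rw [this]
        exact pd_sub (((contDiff_pd_one hu i).differentiable (by norm_num)) z)
          (((contDiff_pd_one hv2 i).differentiable (by norm_num)) z)
      rw [this]; unfold resid; ring
    have h1 := abs_W'_sub_le (by linarith) (ub z hz) (vb z hz)
    have h2 := (mb2 z hz).res
    have h3 : |resid u z| ≤ 1 + resid u z ^ 2 := by
      rw [← sq_abs]; nlinarith [sq_nonneg (|resid u z| - 1), abs_nonneg (resid u z)]
    have h4 : 4 * (2 * M) ^ 2 * |u z - v z| ≤ 4 * (2 * M) ^ 2 * (M * s ^ 12) := by
      gcongr; exact (mb2 z hz).close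
    have h5 : 4 * (2 * M) ^ 2 * (M * s ^ 12) ≤ 4 * (2 * M) ^ 2 * (M * 1) := by gcongr
    have h6 : M * s ^ 6 ≤ M * 1 := by gcongr
    have h7 : M ≤ M ^ 3 := le_self_pow₀ hM (by norm_num)
    have h8 : |lap w z| ≤ |W' (u z) - W' (v z)| + |resid v z| + |resid u z| := by
      rw [e]; exact (abs_sub _ _).trans (by gcongr; exact abs_add_le _ _)
    have h9 : 4 * (2 * M) ^ 2 * (M * 1) = 16 * M ^ 3 := by ring
    linarith
  have hgw : ∫ y in ball x 1, gsq w y ≤ K * s ^ 12 := by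
    refine (gsq_le_of_lap hw2 x (a := M * s ^ 12)
      (c := fun z => 18 * M ^ 3 + 1 + resid u z ^ 2) (by fun_prop)
      (fun y hy => (mb2 y hy).close) lapw).trans ?_
    have e : ∫ z in ball x 2, (M * s ^ 12 * (18 * M ^ 3 + 1 + resid u z ^ 2)
          + cutConst * (M * s ^ 12) ^ 2)
        ≤ ∫ z in ball x 2, (M * s ^ 12 * (18 * M ^ 3 + 1 + L * M)
          + M * s ^ 12 * resid u z ^ 2) := by
      refine setIntegral_ball_le (by fun_prop) (by fun_prop) fun z _ => ?_
      have : L * (M * s ^ 12) ^ 2 ≤ L * (M * s ^ 12) * (M * 1) := by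
        calc L * (M * s ^ 12) ^ 2 = L * (M * s ^ 12) * (M * s ^ 12) := by ring
          _ ≤ _ := by gcongr
      rw [← hLdef]
      linarith
    refine e.trans ?_
    rw [integral_add (f := fun _ => M * s ^ 12 * (18 * M ^ 3 + 1 + L * M))
      (g := fun z => M * s ^ 12 * resid u z ^ 2)
      (integrableOn_ball (by fun_prop) _ _) (integrableOn_ball (by fun_prop) _ _),
      setIntegral_ball_const x (by norm_num), integral_const_mul]
    have hFn : Fn u x 2 ≤ 1 := by
      refine (Fn_mono hu (ball_subset_ball ?_)).trans (hF.trans (pow_le_one₀ hs.le hs1))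
      linarith
    unfold Fn at hFn
    have : M * s ^ 12 * ∫ z in ball x 2, resid u z ^ 2 ≤ M * s ^ 12 * 1 := by gcongr
    rw [hK]
    calc _ ≤ 2 ^ 3 * V * (M * s ^ 12 * (18 * M ^ 3 + 1 + L * M)) + M * s ^ 12 * 1 := by
          gcongr
      _ = _ := by ring
  have hpt : ∀ y ∈ ball x 1, max (disc u y) 0
      ≤ (3 + 3 * M ^ 2 + 16 * M ^ 4) * s ^ 2 + 1 / s ^ 2 * gsq w y := fun y hy => by
    have hy2 : y ∈ ball x 2 := ball_subset_ball (by norm_num) hy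
    have hsub : closedBall y (2 / s ^ 8) ⊆ closedBall x (2 + 2 / s ^ 8) :=
      closedBall_subset_closedBall' (by rw [mem_ball] at hy; linarith)
    have hm : disc v y ≤ 3 * s ^ 2 := modica hM hs hsM hv3
      (fun z hz => (mb z (hsub hz)).bdd) (fun z hz => (mb z (hsub hz)).grad)
      (fun z hz => (mb z (hsub hz)).res) (fun z hz => (mb z (hsub hz)).dres)
    have hG := gsq_nonneg w y
    have hG1 := gsq_nonneg v y
    have hs2 : s ^ 2 ≤ 1 := pow_le_one₀ hs.le hs1
    have hi2 : 1 ≤ 1 / s ^ 2 := by rw [le_div_iff₀ (by positivity)]; linarith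
    have g1 : gsq u y ≤ (1 + s ^ 2) * gsq v y + (1 + 1 / s ^ 2) * gsq w y := by
      have : u = fun y => v y + w y := by funext y; simp [hw]
      conv_lhs => rw [this]
      exact gsq_add_le ((hv2.differentiable (by norm_num)) y)
        ((hw2.differentiable (by norm_num)) y) (by positivity)
    have g2 : gsq v y ≤ 3 * M ^ 2 := by
      unfold gsq; rw [sum_three]
      have := fun i => sq_le_sq' (abs_le.1 ((mb2 y hy2).grad i)).1 (abs_le.1 ((mb2 y hy2).grad i)).2
      linarith [this 0, this 1, this 2]
    have g3 : s ^ 2 * gsq v y ≤ s ^ 2 * (3 * M ^ 2) := by gcongr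
    have g4 : (1 + 1 / s ^ 2) * gsq w y ≤ (1 / s ^ 2 + 1 / s ^ 2) * gsq w y := by gcongr
    have g5 := abs_W_sub_le (by linarith) (ub y hy2) (vb y hy2)
    have g6 : 2 * (2 * M) ^ 3 * |u y - v y| ≤ 2 * (2 * M) ^ 3 * (M * s ^ 2) := by
      gcongr
      refine (mb2 y hy2).close.trans ?_
      exact mul_le_mul_of_nonneg_left (pow_le_pow_of_le_one hs.le hs1 (by norm_num)) (by linarith)
    have g7 := (abs_le.1 g5).1
    have g8 : 0 ≤ s ^ 2 * (3 * M ^ 2) := by positivity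
    refine max_le ?_ (by positivity)
    unfold disc at hm ⊢
    linarith
  calc ∫ y in ball x 1, max (disc u y) 0
      ≤ ∫ y in ball x 1, ((3 + 3 * M ^ 2 + 16 * M ^ 4) * s ^ 2 + 1 / s ^ 2 * gsq w y) :=
        setIntegral_ball_le ((continuous_disc hu).max continuous_const)
          (by have := continuous_gsq (hw2.of_le (by norm_num : (1 : WithTop ℕ∞) ≤ 2)); fun_prop) hpt
    _ = V * ((3 + 3 * M ^ 2 + 16 * M ^ 4) * s ^ 2) + 1 / s ^ 2 * ∫ y in ball x 1, gsq w y := by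
        have := continuous_gsq (hw2.of_le (by norm_num : (1 : WithTop ℕ∞) ≤ 2))
        rw [integral_add (f := fun _ => (3 + 3 * M ^ 2 + 16 * M ^ 4) * s ^ 2)
          (g := fun z => 1 / s ^ 2 * gsq w z)
          (integrableOn_ball (by fun_prop) _ _) (integrableOn_ball (by fun_prop) _ _),
          setIntegral_ball_const x (by norm_num), integral_const_mul]
        ring
    _ ≤ V * ((3 + 3 * M ^ 2 + 16 * M ^ 4) * s ^ 2) + 1 / s ^ 2 * (K * s ^ 12) := by gcongr
    _ = D * s ^ 2 + K * (s ^ 10) := by rw [hD]; field_simp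
    _ ≤ D * s ^ 2 + K * s ^ 2 := by
        have : s ^ 10 ≤ s ^ 2 := pow_le_pow_of_le_one hs.le hs1 (by norm_num)
        gcongr
    _ ≤ C * s ^ 2 := by
        rw [hC]
        have : 0 ≤ 12 * M * s ^ 2 := by positivity
        linarith

open scoped ENNReal

/-! ### Averaging estimates over balls of fixed radius -/

lemma lintegral_ball_eq (g : E 3 → ℝ≥0∞) (x : E 3) (r : ℝ) :
    ∫⁻ y in ball x r, g y
      = ∫⁻ y, {q : E 3 × E 3 | dist q.2 q.1 < r}.indicator (fun q => g q.2) (x, y) := by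
  rw [← lintegral_indicator measurableSet_ball]
  rfl

lemma measurable_indicator_dist {g : E 3 → ℝ≥0∞} (hg : Measurable g) (r : ℝ) :
    Measurable ({q : E 3 × E 3 | dist q.2 q.1 < r}.indicator (fun q => g q.2)) :=
  (hg.comp measurable_snd).indicator
    (isOpen_lt (continuous_snd.dist continuous_fst) continuous_const).measurableSet

lemma measurable_lintegral_ball {g : E 3 → ℝ≥0∞} (hg : Measurable g) (r : ℝ) :
    Measurable fun x => ∫⁻ y in ball x r, g y := by
  simp only [lintegral_ball_eq]
  exact (measurable_indicator_dist hg r).lintegral_prod_right'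

lemma lintegral_lintegral_ball {g : E 3 → ℝ≥0∞} (hg : Measurable g) (p : E 3) (a r : ℝ) :
    ∫⁻ x in ball p a, ∫⁻ y in ball x r, g y
      = ∫⁻ y, g y * volume (ball p a ∩ ball y r) := by
  simp only [lintegral_ball_eq g _ r]
  rw [lintegral_lintegral_swap (f := fun x y =>
    {q : E 3 × E 3 | dist q.2 q.1 < r}.indicator (fun q => g q.2) (x, y))
    (measurable_indicator_dist hg r).aemeasurable]
  refine lintegral_congr fun y => ?_
  have e : ∀ x, {q : E 3 × E 3 | dist q.2 q.1 < r}.indicator (fun q => g q.2) (x, y)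
      = (ball y r).indicator (fun _ => g y) x := fun x => by
    simp [indicator, dist_comm]
  simp only [e]
  rw [lintegral_indicator measurableSet_ball, setLIntegral_const,
    Measure.restrict_apply measurableSet_ball, inter_comm]

lemma le_lintegral_lintegral_ball {g : E 3 → ℝ≥0∞} (hg : Measurable g) (p : E 3) (a r : ℝ) :
    volume (ball (0 : E 3) r) * ∫⁻ y in ball p a, g y
      ≤ ∫⁻ x in ball p (a + r), ∫⁻ y in ball x r, g y := by
  rw [lintegral_lintegral_ball hg, ← lintegral_const_mul _ hg,
    ← lintegral_indicator measurableSet_ball]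
  refine lintegral_mono fun y => ?_
  by_cases hy : y ∈ ball p a
  · rw [indicator_of_mem hy, inter_eq_self_of_subset_right, mul_comm,
      Measure.addHaar_ball_center volume y r]
    exact ball_subset_ball' (by rw [mem_ball] at hy; linarith)
  · rw [indicator_of_notMem hy]; exact zero_le

lemma lintegral_lintegral_ball_le {g : E 3 → ℝ≥0∞} (hg : Measurable g) (p : E 3) (a r : ℝ) :
    ∫⁻ x in ball p a, ∫⁻ y in ball x r, g y
      ≤ volume (ball (0 : E 3) r) * ∫⁻ y in ball p (a + r), g y := by
  rw [lintegral_lintegral_ball hg, ← lintegral_const_mul _ hg,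
    ← lintegral_indicator measurableSet_ball]
  refine lintegral_mono fun y => ?_
  by_cases hy : y ∈ ball p (a + r)
  · rw [indicator_of_mem hy, mul_comm, ← Measure.addHaar_ball_center volume y r]
    gcongr; exact inter_subset_right
  · rw [indicator_of_notMem hy, (disjoint_iff_inter_eq_empty).1, measure_empty, mul_zero]
    refine ball_disjoint_ball ?_
    rw [mem_ball, not_lt] at hy
    rwa [dist_comm]

lemma volume_ball_eq_ofReal (r : ℝ) (hr : 0 ≤ r) :
    volume (ball (0 : E 3) r) = ENNReal.ofReal (r ^ 3 * (Real.pi * 4 / 3)) := by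
  rw [← volume_real_ball 0 hr, Measure.real, ENNReal.ofReal_toReal measure_ball_lt_top.ne]

/-- An inequality between integrals over balls of fixed radii can be averaged. -/
lemma setIntegral_ball_le_of_forall {g e f : E 3 → ℝ} (hgm : Measurable g) (hg0 : ∀ x, 0 ≤ g x)
    (hgi : ∀ p r, IntegrableOn g (ball p r)) (he : Continuous e) (he0 : ∀ x, 0 ≤ e x)
    (hf : Continuous f) (hf0 : ∀ x, 0 ≤ f x) {A B ρ : ℝ} (hA : 0 ≤ A) (hB : 0 ≤ B) (hρ : 0 ≤ ρ)
    (h : ∀ x, ∫ y in ball x 1, g y ≤ A * (∫ y in ball x 2, e y) + B * ∫ y in ball x ρ, f y)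
    (p : E 3) (r : ℝ) :
    ∫ y in ball p r, g y ≤ 8 * A * (∫ y in ball p (r + 3), e y)
      + ρ ^ 3 * B * ∫ y in ball p (r + 1 + ρ), f y := by
  have conv : ∀ {k : E 3 → ℝ}, (∀ p r, IntegrableOn k (ball p r)) → (∀ x, 0 ≤ k x) → ∀ q t,
      ENNReal.ofReal (∫ y in ball q t, k y) = ∫⁻ y in ball q t, ENNReal.ofReal (k y) :=
    fun hk hk0 q t => ofReal_integral_eq_lintegral_ofReal (hk q t) (ae_of_all _ hk0)
  have hV : 0 < Real.pi * 4 / 3 := by positivity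
  have mg := hgm.ennreal_ofReal
  have me := he.measurable.ennreal_ofReal
  have mf := hf.measurable.ennreal_ofReal
  have cg := conv hgi hg0
  have ce := conv (integrableOn_ball he) he0
  have cf := conv (integrableOn_ball hf) hf0
  have Ie : ∀ q t, 0 ≤ ∫ y in ball q t, e y := fun q t => integral_nonneg he0
  have If : ∀ q t, 0 ≤ ∫ y in ball q t, f y := fun q t => integral_nonneg hf0
  have step : ∀ x, ∫⁻ y in ball x 1, ENNReal.ofReal (g y)
      ≤ ENNReal.ofReal A * (∫⁻ y in ball x 2, ENNReal.ofReal (e y))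
        + ENNReal.ofReal B * ∫⁻ y in ball x ρ, ENNReal.ofReal (f y) := fun x => by
    rw [← cg, ← ce, ← cf, ← ENNReal.ofReal_mul hA, ← ENNReal.ofReal_mul hB,
      ← ENNReal.ofReal_add (mul_nonneg hA (Ie _ _)) (mul_nonneg hB (If _ _))]
    exact ENNReal.ofReal_le_ofReal (h x)
  have main : volume (ball (0 : E 3) 1) * ∫⁻ y in ball p r, ENNReal.ofReal (g y)
      ≤ ENNReal.ofReal A * (volume (ball (0 : E 3) 2)
          * ∫⁻ y in ball p (r + 1 + 2), ENNReal.ofReal (e y))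
        + ENNReal.ofReal B * (volume (ball (0 : E 3) ρ)
          * ∫⁻ y in ball p (r + 1 + ρ), ENNReal.ofReal (f y)) := by
    refine (le_lintegral_lintegral_ball mg p r 1).trans ?_
    refine (lintegral_mono step).trans ?_
    rw [lintegral_add_left ((measurable_lintegral_ball me 2).const_mul _),
      lintegral_const_mul _ (measurable_lintegral_ball me 2),
      lintegral_const_mul _ (measurable_lintegral_ball mf ρ)]
    gcongr
    · exact lintegral_lintegral_ball_le me p (r + 1) 2
    · exact lintegral_lintegral_ball_le mf p (r + 1) ρ
  rw [← cg, ← ce, ← cf, volume_ball_eq_ofReal 1 (by norm_num), volume_ball_eq_ofReal 2 (by norm_num),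
    volume_ball_eq_ofReal ρ hρ, ← ENNReal.ofReal_mul (by positivity),
    ← ENNReal.ofReal_mul (by positivity), ← ENNReal.ofReal_mul (by positivity),
    ← ENNReal.ofReal_mul (by positivity), ← ENNReal.ofReal_mul hB,
    ← ENNReal.ofReal_add (by have := Ie p (r + 1 + 2); positivity)
      (by have := If p (r + 1 + ρ); positivity),
    ENNReal.ofReal_le_ofReal_iff (by
      have := Ie p (r + 1 + 2); have := If p (r + 1 + ρ); positivity)] at main
  rw [show r + 1 + 2 = r + 3 by ring] at main
  refine le_of_mul_le_mul_left ?_ hV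
  linarith

/-! ### The positive part of the discrepancy -/

/-- The integral of the positive part of the discrepancy in a ball. -/
def Pp (u : E 3 → ℝ) (p : E 3) (r : ℝ) : ℝ := ∫ y in ball p r, max (disc u y) 0

lemma max_disc_le (u : E 3 → ℝ) (y : E 3) : max (disc u y) 0 ≤ gsq u y / 2 := by
  have := gsq_nonneg u y
  have := W_nonneg (u y)
  exact max_le (by unfold disc; linarith) (by linarith)

set_option maxHeartbeats 1000000 in
lemma exists_disc_transition_le : ∃ C : ℝ, 5 ≤ C ∧ ∀ (u : E 3 → ℝ), ContDiff ℝ 2 u → ∀ γ, 0 < γ →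
    γ ≤ 1 / C → ∀ x,
    ∫ y in ball x 1, {y | u y ^ 2 < 1 - γ ^ 2}.indicator (fun y => max (disc u y) 0) y
      ≤ C * γ ^ 2 * En u x 2 + C / γ ^ 720 * Fn u x (C / γ ^ 120) := by
  obtain ⟨C1, hC1, h1⟩ := exists_apriori
  obtain ⟨C2, hC2, h2⟩ := exists_disc_le
  obtain ⟨c, hc, h3⟩ := exists_energy_lower
  set C := 5 + 2 * C1 + C2 + C2 * 2 ^ 14 / c with hC
  have hq : 0 ≤ C2 * 2 ^ 14 / c := by positivity
  refine ⟨C, by linarith, fun u hu γ hγ hγC x => ?_⟩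
  have hγ5 : γ ≤ 1 / 5 := hγC.trans (by gcongr; linarith)
  have hγ1 : γ ≤ 1 := by linarith
  have hγ720 : γ ^ 720 ≤ 1 := pow_le_one₀ hγ.le hγ1
  have hγ120 : γ ^ 120 ≤ 1 := pow_le_one₀ hγ.le hγ1
  have hu1 : ContDiff ℝ 1 u := hu.of_le (by norm_num)
  have hgc := continuous_gsq hu1
  have hdc := (continuous_disc hu).max (continuous_const (y := (0 : ℝ)))
  have huc := hu.continuous
  have hS : MeasurableSet {y | u y ^ 2 < 1 - γ ^ 2} :=
    (isOpen_lt (by fun_prop) continuous_const).measurableSet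
  have hle : ∫ y in ball x 1, {y | u y ^ 2 < 1 - γ ^ 2}.indicator (fun y => max (disc u y) 0) y
      ≤ ∫ y in ball x 1, max (disc u y) 0 :=
    setIntegral_mono_on ((integrableOn_ball hdc x 1).indicator hS) (integrableOn_ball hdc x 1)
      measurableSet_ball fun y _ => indicator_le_self' (fun _ _ => le_max_right _ _) y
  have hEn := En_nonneg u x 2
  have hFn := Fn_nonneg u x (C / γ ^ 120)
  have hr : C ≤ C / γ ^ 120 := by
    rw [le_div_iff₀ (by positivity)]
    exact mul_le_of_le_one_right (by linarith) hγ120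
  have t1 : 0 ≤ C * γ ^ 2 * En u x 2 := by positivity
  have t2 : 0 ≤ C / γ ^ 720 * Fn u x (C / γ ^ 120) := by positivity
  rcases lt_or_ge (γ ^ 720) (Fn u x (C / γ ^ 120)) with hF | hF
  · have k1 : ∫ y in ball x 1, max (disc u y) 0 ≤ ∫ y in ball x 1, (gsq u y + u y ^ 6) :=
      setIntegral_ball_le hdc (by fun_prop) fun y _ => by
        have := max_disc_le u y
        have := gsq_nonneg u y
        have : 0 ≤ u y ^ 6 := by positivity
        linarith
    have k2 := h1 u hu x
    have k3 : Fn u x 2 ≤ Fn u x (C / γ ^ 120) := Fn_mono hu (ball_subset_ball (by linarith))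
    have k4 : 1 ≤ 1 / γ ^ 720 * Fn u x (C / γ ^ 120) := by
      rw [one_div_mul_eq_div, le_div_iff₀ (by positivity)]; linarith
    have k5 : 1 * Fn u x (C / γ ^ 120) ≤ 1 / γ ^ 720 * Fn u x (C / γ ^ 120) := by
      gcongr; rw [le_div_iff₀ (by positivity)]; linarith
    have k6 : C1 * (1 + Fn u x 2) ≤ C1 * (2 * (1 / γ ^ 720 * Fn u x (C / γ ^ 120))) := by
      gcongr; linarith
    have k7 : 2 * C1 * (1 / γ ^ 720 * Fn u x (C / γ ^ 120))
        ≤ C * (1 / γ ^ 720 * Fn u x (C / γ ^ 120)) := by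
      gcongr; linarith
    have k8 : C / γ ^ 720 * Fn u x (C / γ ^ 120) = C * (1 / γ ^ 720 * Fn u x (C / γ ^ 120)) := by
      ring
    linarith
  · by_cases hy : ∃ y ∈ ball x 1, u y ^ 2 < 1 - γ ^ 2
    · obtain ⟨y, hyx, hyu⟩ := hy
      have k1 : ∫ y in ball x 1, max (disc u y) 0 ≤ C2 * (γ ^ 15) ^ 2 := by
        refine h2 u hu x (γ ^ 15) (by positivity) ?_ ?_
        · refine (pow_le_of_le_one hγ.le hγ1 (by norm_num)).trans (hγC.trans ?_)
          gcongr; linarith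
        · rw [← pow_mul, ← pow_mul]
          refine (Fn_mono hu (ball_subset_ball ?_)).trans hF
          norm_num
          gcongr
          linarith
      have k2 : Fn u y 4 ≤ 1 := by
        refine (Fn_mono hu (ball_subset_ball' ?_)).trans (hF.trans hγ720)
        rw [mem_ball] at hyx; linarith
      have hγ2 : γ ^ 2 ≤ 1 := pow_le_one₀ hγ.le hγ1
      have k3 := h3 u hu y k2 (γ ^ 2 / 2) (by positivity) (by linarith) (by
        refine abs_le_of_sq_le_sq ?_ (by linarith)
        nlinarith [sq_nonneg (γ ^ 2)])
      have k4 : En u y 1 ≤ En u x 2 :=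
        En_mono hu (ball_subset_ball' (by rw [mem_ball] at hyx; linarith))
      have k5 : γ ^ 28 ≤ 2 ^ 14 / c * En u x 2 := by
        rw [div_mul_eq_mul_div, le_div_iff₀ hc]
        have : (γ ^ 2 / 2) ^ 14 = γ ^ 28 / 2 ^ 14 := by rw [div_pow, ← pow_mul]
        rw [this] at k3
        linarith
      have k6 : C2 * (γ ^ 15) ^ 2 ≤ C2 * γ ^ 2 * (2 ^ 14 / c * En u x 2) := by
        calc C2 * (γ ^ 15) ^ 2 = C2 * γ ^ 2 * γ ^ 28 := by ring
          _ ≤ _ := by gcongr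
      have k7 : C2 * γ ^ 2 * (2 ^ 14 / c * En u x 2) ≤ C * γ ^ 2 * En u x 2 := by
        calc _ = C2 * 2 ^ 14 / c * γ ^ 2 * En u x 2 := by ring
          _ ≤ _ := by gcongr; linarith
      linarith
    · push Not at hy
      rw [setIntegral_congr_fun (g := fun _ => (0 : ℝ)) measurableSet_ball fun y hyx =>
        indicator_of_notMem (by simpa using hy y hyx) _]
      simp
      linarith

/-- The positive part of the discrepancy is controlled up to a small factor on large balls. -/
lemma exists_Pp_le : ∃ C : ℝ, 1 ≤ C ∧ ∀ (u : E 3 → ℝ), ContDiff ℝ 2 u → ∀ γ, 0 < γ →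
    γ ≤ 1 / C → ∀ p r, 1 / γ ^ 122 ≤ r →
    Pp u p r ≤ C * γ ^ 2 * En u p (2 * r) + C / γ ^ 1080 * Fn u p (2 * r) := by
  obtain ⟨C1, hC1, h1⟩ := exists_disc_transition_le
  obtain ⟨C2, hC2, h2⟩ := exists_gsq_near_wells
  refine ⟨8 * C1 + C1 ^ 4 + C2, by linarith [pow_pos (by linarith : 0 < C1) 4],
    fun u hu γ hγ hγC p r hr => ?_⟩
  have hC14 : 0 < C1 ^ 4 := by positivity
  set C := 8 * C1 + C1 ^ 4 + C2 with hC
  have hγC1 : γ ≤ 1 / C1 := hγC.trans (by gcongr; linarith)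
  have hγ8 : γ ≤ 1 / 8 := hγC.trans (by gcongr; linarith)
  have hγ1 : γ ≤ 1 := by linarith
  have hu1 : ContDiff ℝ 1 u := hu.of_le (by norm_num)
  have hgc := continuous_gsq hu1
  have hdc := (continuous_disc hu).max (continuous_const (y := (0 : ℝ)))
  have huc := hu.continuous
  have hS : MeasurableSet {y | u y ^ 2 < 1 - γ ^ 2} :=
    (isOpen_lt (by fun_prop) continuous_const).measurableSet
  have hT : MeasurableSet {x | 1 - γ ^ 2 ≤ u x ^ 2} :=
    (isClosed_le continuous_const (by fun_prop)).measurableSet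
  have hγp : 0 < γ ^ 122 := by positivity
  have hγC1' : γ * C1 ≤ 1 := by rwa [le_div_iff₀ (by linarith)] at hγC1
  have hrad : C1 / γ ^ 120 + 3 ≤ r := by
    refine le_trans ?_ hr
    have e1 : C1 / γ ^ 120 ≤ 1 / γ ^ 122 * (γ * 1) := by
      rw [div_le_iff₀ (by positivity)]
      have : 1 / γ ^ 122 * (γ * 1) * γ ^ 120 = 1 / γ := by field_simp
      rw [this, le_div_iff₀ hγ]; linarith
    have e2 : 1 ≤ 1 / γ ^ 122 * γ := by
      rw [one_div_mul_eq_div, le_div_iff₀ hγp, one_mul]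
      exact pow_le_of_le_one hγ.le hγ1 (by norm_num)
    have e3 : 1 / γ ^ 122 * γ ≤ 1 / γ ^ 122 * (1 / 8) := by gcongr
    linarith
  have hrr : 0 ≤ C1 / γ ^ 120 := by positivity
  have hEn := En_nonneg u p (2 * r)
  have hFn := Fn_nonneg u p (2 * r)
  have k1 : ∫ y in ball p r, {y | u y ^ 2 < 1 - γ ^ 2}.indicator (fun y => max (disc u y) 0) y
      ≤ 8 * C1 * γ ^ 2 * En u p (2 * r) + C1 ^ 4 / γ ^ 1080 * Fn u p (2 * r) := by
    refine (setIntegral_ball_le_of_forall (hdc.measurable.indicator hS)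
      (fun x => indicator_nonneg (fun _ _ => le_max_right _ _) x)
      (fun q t => (integrableOn_ball hdc q t).indicator hS) (continuous_eden hu) (eden_nonneg u)
      ((continuous_resid hu).pow 2) (fun _ => sq_nonneg _) (A := C1 * γ ^ 2)
      (B := C1 / γ ^ 720) (ρ := C1 / γ ^ 120) (by positivity) (by positivity) hrr
      (h1 u hu γ hγ hγC1) p r).trans ?_
    have e1 := En_mono hu (ball_subset_ball (x := p) (by linarith : r + 3 ≤ 2 * r))
    have e2 := Fn_mono hu (ball_subset_ball (x := p) (by linarith : r + 1 + C1 / γ ^ 120 ≤ 2 * r))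
    calc _ ≤ 8 * (C1 * γ ^ 2) * En u p (2 * r)
          + (C1 / γ ^ 120) ^ 3 * (C1 / γ ^ 720) * Fn u p (2 * r) := by gcongr <;> assumption
      _ = _ := by
        have : (C1 / γ ^ 120) ^ 3 * (C1 / γ ^ 720) = C1 ^ 4 / γ ^ 1080 := by
          rw [div_pow, ← pow_mul, div_mul_div_comm, ← pow_add]; ring
        rw [this]; ring
  have k2 := h2 u hu p (γ ^ 2) r (by positivity) (by nlinarith) (by
    refine le_trans ?_ hr
    refine one_div_le_one_div_of_le hγp (pow_le_pow_of_le_one hγ.le hγ1 (by norm_num)))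
  have k3 : Pp u p r ≤ ∫ y in ball p r,
      ({y | u y ^ 2 < 1 - γ ^ 2}.indicator (fun y => max (disc u y) 0) y
        + {x | 1 - γ ^ 2 ≤ u x ^ 2}.indicator (gsq u) y) := by
    refine setIntegral_mono_on (integrableOn_ball hdc p r)
      (((integrableOn_ball hdc p r).indicator hS).add ((integrableOn_ball hgc p r).indicator hT))
      measurableSet_ball fun y _ => ?_
    have hG := gsq_nonneg u y
    have hm := max_disc_le u y
    by_cases hy : u y ^ 2 < 1 - γ ^ 2
    · rw [indicator_of_mem (by exact hy), indicator_of_notMem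
        (show y ∉ {x | 1 - γ ^ 2 ≤ u x ^ 2} from fun h => absurd hy (not_lt.2 h))]; simp
    · rw [indicator_of_notMem (by exact hy), indicator_of_mem
        (show y ∈ {x | 1 - γ ^ 2 ≤ u x ^ 2} from not_lt.1 hy)]; linarith
  rw [integral_add ((integrableOn_ball hdc p r).indicator hS)
    ((integrableOn_ball hgc p r).indicator hT)] at k3
  have hg1080 : γ ^ 1080 ≤ 1 := pow_le_one₀ hγ.le hγ1
  have k4 : C2 * Fn u p (2 * r) ≤ C2 / γ ^ 1080 * Fn u p (2 * r) := by
    gcongr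
    rw [le_div_iff₀ (by positivity)]
    exact mul_le_of_le_one_right hC2.le hg1080
  have k5 : (8 * C1 * γ ^ 2 + C2 * γ ^ 2) * En u p (2 * r) ≤ C * γ ^ 2 * En u p (2 * r) := by
    gcongr
    rw [← add_mul]; gcongr; linarith
  have k6 : (C1 ^ 4 / γ ^ 1080 + C2 / γ ^ 1080) * Fn u p (2 * r)
      ≤ C / γ ^ 1080 * Fn u p (2 * r) := by
    rw [← add_div]
    gcongr
    linarith
  linarith

/-! ### The monotonicity identity -/

/-- The weight in the monotonicity identity. -/
def wt (p : E 3) (ρ : ℝ) (x : E 3) : ℝ := (sqd p x + ρ ^ 2)⁻¹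

lemma wt_pos (p : E 3) {ρ : ℝ} (hρ : 0 < ρ) (x : E 3) : 0 < wt p ρ x := by
  have := sqd_nonneg p x
  unfold wt; positivity

lemma contDiff_wt (p : E 3) {ρ : ℝ} (hρ : 0 < ρ) : ContDiff ℝ 1 (wt p ρ) :=
  ((contDiff_sqd p).add contDiff_const).inv fun x => by
    have := sqd_nonneg p x; positivity

lemma pd_wt (p : E 3) {ρ : ℝ} (hρ : 0 < ρ) (x : E 3) (i : Fin 3) :
    pd i (wt p ρ) x = -wt p ρ x ^ 2 * (2 * (x i - p i)) := by
  have hd : DifferentiableAt ℝ (sqd p) x := (contDiff_sqd (n := 1) p).differentiable (by norm_num) x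
  have h0 : sqd p x + ρ ^ 2 ≠ 0 := by have := sqd_nonneg p x; positivity
  have hk : HasDerivAt (fun t : ℝ => (t + ρ ^ 2)⁻¹) (-(sqd p x + ρ ^ 2)⁻¹ ^ 2) (sqd p x) := by
    refine (((hasDerivAt_id (sqd p x)).add_const (ρ ^ 2)).fun_inv h0).congr_deriv ?_
    simp only [id]; field_simp
  have := pd_comp (i := i) hk hd
  rw [pd_sqd] at this
  exact this

lemma rad_wt_mul (p : E 3) {ρ : ℝ} (hρ : 0 < ρ) {χ : E 3 → ℝ} {x : E 3}
    (hχ : DifferentiableAt ℝ χ x) :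
    rad p (fun y => wt p ρ y * χ y) x
      = -2 * wt p ρ x ^ 2 * sqd p x * χ x + wt p ρ x * rad p χ x := by
  simp only [rad, pd_mul ((contDiff_wt p hρ).differentiable (by norm_num) x) hχ, pd_wt p hρ, sqd,
    sum_three]
  ring

lemma gdot_wt_mul (p : E 3) {ρ : ℝ} (hρ : 0 < ρ) {χ : E 3 → ℝ} {x : E 3}
    (hχ : DifferentiableAt ℝ χ x) (u : E 3 → ℝ) :
    gdot u (fun y => wt p ρ y * χ y) x
      = -2 * wt p ρ x ^ 2 * rad p u x * χ x + wt p ρ x * gdot u χ x := by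
  simp only [gdot, pd_mul ((contDiff_wt p hρ).differentiable (by norm_num) x) hχ, pd_wt p hρ, rad,
    sum_three]
  ring

lemma cut_error_le {p : E 3} {R : ℝ} (hR : 0 < R) {y : E 3} (hy : y ∈ ball p (2 * R))
    (u : E 3 → ℝ) :
    |eden u y * rad p (cut p R) y - rad p u y * gdot u (cut p R) y| ≤ 6 * cutConst * eden u y := by
  have hL := one_le_cutConst
  have hG := gsq_nonneg u y
  have hd : ‖y - p‖ ^ 2 ≤ 4 * R ^ 2 := by
    rw [← dist_eq_norm]; rw [mem_ball] at hy
    calc dist y p ^ 2 ≤ (2 * R) ^ 2 := by gcongr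
      _ = _ := by ring
  have h1 : |rad p (cut p R) y| ≤ 2 * cutConst := by
    refine abs_le_of_sq_le_sq ?_ (by linarith)
    calc rad p (cut p R) y ^ 2 ≤ ‖y - p‖ ^ 2 * gsq (cut p R) y := rad_sq_le _ _ _
      _ ≤ 4 * R ^ 2 * (cutConst / R ^ 2) := by
        gcongr
        · exact gsq_nonneg _ _
        · exact gsq_cut_le y
      _ = 4 * cutConst * 1 := by field_simp
      _ ≤ 4 * cutConst * cutConst := by gcongr
      _ = _ := by ring
  have h2 : |rad p u y * gdot u (cut p R) y| ≤ 2 * cutConst * gsq u y := by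
    refine abs_le_of_sq_le_sq ?_ (by positivity)
    calc (rad p u y * gdot u (cut p R) y) ^ 2 = rad p u y ^ 2 * gdot u (cut p R) y ^ 2 := by ring
      _ ≤ (4 * R ^ 2 * gsq u y) * (cutConst / R ^ 2 * gsq u y) := by
        refine mul_le_mul ((rad_sq_le _ _ _).trans ?_) (gdot_cut_sq_le y u) (sq_nonneg _)
          (by positivity)
        gcongr
      _ = 4 * gsq u y ^ 2 * cutConst * 1 := by field_simp
      _ ≤ 4 * gsq u y ^ 2 * cutConst * cutConst := by gcongr
      _ = _ := by ring
  have he := eden_nonneg u y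
  have h3 : |eden u y * rad p (cut p R) y| ≤ eden u y * (2 * cutConst) := by
    rw [abs_mul, abs_of_nonneg he]; gcongr
  have h4 : gsq u y ≤ 2 * eden u y := by
    have := W_nonneg (u y); unfold eden; linarith
  have h5 : 2 * cutConst * gsq u y ≤ 2 * cutConst * (2 * eden u y) := by gcongr
  refine (abs_sub _ _).trans ?_
  linarith

/-- The weighted monotonicity inequality. -/
lemma monotonicity {u : E 3 → ℝ} (hu : ContDiff ℝ 2 u) (p : E 3) {ρ R : ℝ} (hρ : 0 < ρ)
    (hR : 0 < R) :
    ∫ x in ball p R, (2 * ρ ^ 2 * wt p ρ x ^ 2 * eden u x + wt p ρ x * max (-disc u x) 0)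
      ≤ ∫ x in ball p (2 * R), (wt p ρ x * max (disc u x) 0 + (resid u x ^ 2 / 8
        + 6 * cutConst / R ^ 2 * eden u x)) := by
  have hL := one_le_cutConst
  have hχ := contDiff_cut_one p R
  have hu1 : ContDiff ℝ 1 u := hu.of_le (by norm_num)
  have hwC := contDiff_wt p hρ
  have hh : ContDiff ℝ 1 fun y => wt p ρ y * cut p R y := hwC.mul hχ
  have c1 := hwC.continuous
  have c2 := continuous_eden hu
  have c3 := continuous_disc hu
  have c4 := continuous_resid hu
  have c5 := continuous_rad hh p
  have c6 := continuous_rad hu1 p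
  have c7 := continuous_gdot hu1 hh
  have c8 := hh.continuous
  have e : ∀ x, (wt p ρ x * cut p R x) * (2 * eden u x - disc u x)
      + eden u x * rad p (fun y => wt p ρ y * cut p R y) x
      - rad p u x * gdot u (fun y => wt p ρ y * cut p R y) x
      + (wt p ρ x * cut p R x) * (resid u x * rad p u x)
      = cut p R x * (2 * ρ ^ 2 * wt p ρ x ^ 2 * eden u x - wt p ρ x * disc u x
          + (2 * (wt p ρ x * rad p u x) ^ 2 + resid u x * (wt p ρ x * rad p u x)))
        + wt p ρ x * (eden u x * rad p (cut p R) x - rad p u x * gdot u (cut p R) x) :=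
    fun x => by
      have hd := hχ.differentiable (by norm_num) x
      rw [rad_wt_mul p hρ hd, gdot_wt_mul p hρ hd]
      have : wt p ρ x = wt p ρ x ^ 2 * (sqd p x + ρ ^ 2) := by
        have := sqd_nonneg p x
        unfold wt; field_simp
      linear_combination (2 * cut p R x * eden u x) * this
  have hq : ∀ x, -(resid u x ^ 2 / 8) ≤ 2 * (wt p ρ x * rad p u x) ^ 2
      + resid u x * (wt p ρ x * rad p u x) := fun x => by
    nlinarith [sq_nonneg (4 * (wt p ρ x * rad p u x) + resid u x)]
  have hdisc : ∀ x, disc u x = max (disc u x) 0 - max (-disc u x) 0 := fun x => by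
    rcases le_total 0 (disc u x) with h | h
    · rw [max_eq_left h, max_eq_right (by linarith)]; ring
    · rw [max_eq_right h, max_eq_left (by linarith)]; ring
  refine setIntegral_ball_le_of_integral_eq_zero
    (X := fun x => (wt p ρ x * cut p R x) * (2 * eden u x - disc u x)
      + eden u x * rad p (fun y => wt p ρ y * cut p R y) x
      - rad p u x * gdot u (fun y => wt p ρ y * cut p R y) x
      + (wt p ρ x * cut p R x) * (resid u x * rad p u x))
    (integrableOn_ball (by fun_prop) _ _)
    (integral_stationarity hu p hh ((hasCompactSupport_cut hR).mul_left))
    (integrableOn_ball (by fun_prop) _ _) (integrableOn_ball (by fun_prop) _ _) (by linarith)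
    ?_ ?_ ?_
  · intro y hy
    rw [e y, cut_eq_zero hR hy, gdot_cut_eq_zero hR u hy]
    simp [rad, pd_cut_eq_zero_of_notMem hR hy]
  · intro y hy
    rw [e y, cut_eq_one hR hy]
    have z1 : rad p (cut p R) y = 0 := by simp [rad, pd_cut_eq_zero_of_mem hR hy]
    have z2 : gdot u (cut p R) y = 0 := by simp [gdot, pd_cut_eq_zero_of_mem hR hy]
    rw [z1, z2]
    have k1 := hq y
    have k2 : 0 ≤ 6 * cutConst / R ^ 2 * eden u y := by
      have := eden_nonneg u y; positivity
    have k3 : wt p ρ y * disc u y = wt p ρ y * max (disc u y) 0 - wt p ρ y * max (-disc u y) 0 := by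
      rw [← mul_sub, ← hdisc]
    linarith
  · intro y hy
    rw [e y]
    have hw := wt_pos p hρ y
    have he := eden_nonneg u y
    have hz0 := cut_nonneg p R y
    have hz1 := cut_le_one p R y
    have k1 : -(resid u y ^ 2 / 8 + wt p ρ y * max (disc u y) 0)
        ≤ 2 * ρ ^ 2 * wt p ρ y ^ 2 * eden u y - wt p ρ y * disc u y
          + (2 * (wt p ρ y * rad p u y) ^ 2 + resid u y * (wt p ρ y * rad p u y)) := by
      have := hq y
      have : wt p ρ y * disc u y ≤ wt p ρ y * max (disc u y) 0 := by
        gcongr; exact le_max_left _ _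
      have : 0 ≤ 2 * ρ ^ 2 * wt p ρ y ^ 2 * eden u y := by positivity
      linarith
    have k2 : 0 ≤ resid u y ^ 2 / 8 + wt p ρ y * max (disc u y) 0 := by
      have : 0 ≤ max (disc u y) 0 := le_max_right _ _
      positivity
    have k3 := mul_le_mul_of_nonneg_left k1 hz0
    have k4 := mul_le_mul_of_nonneg_right hz1 k2
    have k5 : -(6 * cutConst / R ^ 2 * eden u y)
        ≤ wt p ρ y * (eden u y * rad p (cut p R) y - rad p u y * gdot u (cut p R) y) := by
      by_cases hyR : y ∈ ball p R
      · have z1 : rad p (cut p R) y = 0 := by simp [rad, pd_cut_eq_zero_of_mem hR hyR]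
        have z2 : gdot u (cut p R) y = 0 := by simp [gdot, pd_cut_eq_zero_of_mem hR hyR]
        rw [z1, z2, mul_zero, mul_zero, sub_zero, mul_zero]
        exact neg_nonpos.2 (by positivity)
      · have hwR : wt p ρ y ≤ 1 / R ^ 2 := by
          unfold wt
          rw [inv_eq_one_div, sqd_eq]
          rw [mem_ball, not_lt] at hyR
          gcongr
          have : R ^ 2 ≤ dist y p ^ 2 := by gcongr
          nlinarith [sq_nonneg ρ]
        have m1 := cut_error_le hR hy u
        have m2 : |wt p ρ y * (eden u y * rad p (cut p R) y - rad p u y * gdot u (cut p R) y)|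
            ≤ 1 / R ^ 2 * (6 * cutConst * eden u y) := by
          rw [abs_mul, abs_of_pos hw]
          gcongr
        have m3 : 1 / R ^ 2 * (6 * cutConst * eden u y) = 6 * cutConst / R ^ 2 * eden u y := by ring
        rw [m3] at m2
        exact (abs_le.1 m2).1
    linarith

/-! ### Almost monotonicity of the density along a geometric sequence of scales -/

/-- The ratio of consecutive scales. -/
def lam : ℝ := 2 ^ 1000

/-- The sequence of scales. -/
def rs (j : ℕ) : ℝ := lam ^ j

/-- The density ratio at a scale. -/
def Dens (u : E 3 → ℝ) (p : E 3) (j : ℕ) : ℝ := En u p (rs j) / rs j ^ 2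

lemma two_le_lam : 2 ≤ lam := by
  unfold lam
  exact le_self_pow₀ (by norm_num) (by norm_num)

lemma rs_pos (j : ℕ) : 0 < rs j := pow_pos (by linarith [two_le_lam]) j

lemma rs_succ (j : ℕ) : rs (j + 1) = lam * rs j := by unfold rs; ring

lemma two_mul_rs_le (j : ℕ) : 2 * rs j ≤ rs (j + 1) := by
  rw [rs_succ]; exact mul_le_mul_of_nonneg_right two_le_lam (rs_pos j).le

lemma rs_mono {i j : ℕ} (h : i ≤ j) : rs i ≤ rs j :=
  pow_le_pow_right₀ (by linarith [two_le_lam]) h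

lemma rs_eq (j : ℕ) : rs j = 2 ^ (1000 * j) := by unfold rs lam; rw [pow_mul]

lemma Dens_nonneg (u : E 3 → ℝ) (p : E 3) (j : ℕ) : 0 ≤ Dens u p j :=
  div_nonneg (En_nonneg _ _ _) (sq_nonneg _)

lemma En_two_mul_le {u : E 3 → ℝ} (hu : ContDiff ℝ 2 u) (p : E 3) (j : ℕ) :
    En u p (2 * rs j) / rs j ^ 2 ≤ lam ^ 2 * Dens u p (j + 1) := by
  have h := En_mono hu (ball_subset_ball (x := p) (two_mul_rs_le j))
  have hl := two_le_lam
  have hr := rs_pos j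
  unfold Dens
  rw [rs_succ] at *
  calc En u p (2 * rs j) / rs j ^ 2 ≤ En u p (lam * rs j) / rs j ^ 2 := by gcongr
    _ = _ := by
      have : lam ≠ 0 := by positivity
      field_simp

lemma Dens_le_succ {u : E 3 → ℝ} (hu : ContDiff ℝ 2 u) (p : E 3) (j : ℕ) :
    Dens u p j ≤ lam ^ 2 * Dens u p (j + 1) := by
  refine le_trans ?_ (En_two_mul_le hu p j)
  unfold Dens
  have hr := rs_pos j
  exact div_le_div_of_nonneg_right (En_mono hu (ball_subset_ball (by linarith))) (sq_nonneg _)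

lemma exists_Pp_scale_le : ∃ C : ℝ, 1 ≤ C ∧ ∃ j₀ : ℕ, ∀ (u : E 3 → ℝ), ContDiff ℝ 2 u → ∀ p j,
    j₀ ≤ j → Pp u p (rs j) / rs j ^ 2
      ≤ C * ((1 / 4) ^ j * Dens u p (j + 1) + (1 / 2) ^ j * Fn u p (rs (j + 1))) := by
  obtain ⟨C, hC, h⟩ := exists_Pp_le
  obtain ⟨j₀, hj₀⟩ := exists_pow_lt_of_lt_one (show (0 : ℝ) < 1 / C by positivity)
    (by norm_num : (1 / 2 : ℝ) < 1)
  have hl := two_le_lam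
  refine ⟨C * lam ^ 2, by nlinarith, j₀, fun u hu p j hj => ?_⟩
  have hr := rs_pos j
  have hE := En_nonneg u p (2 * rs j)
  have hF := Fn_nonneg u p (2 * rs j)
  have hl2 : (1 : ℝ) ≤ lam ^ 2 := one_le_pow₀ (by linarith)
  have g : ((1 / 2 : ℝ) ^ j) ≤ 1 / C :=
    (pow_le_pow_of_le_one (by norm_num) (by norm_num) hj).trans hj₀.le
  have k := h u hu ((1 / 2) ^ j) (by positivity) g p (rs j) (by
    rw [rs_eq, one_div_pow, one_div_pow, one_div_one_div, ← pow_mul]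
    exact pow_le_pow_right₀ (by norm_num) (by omega))
  have e1 : ((1 / 2 : ℝ) ^ j) ^ 2 = (1 / 4) ^ j := by rw [← pow_mul, mul_comm, pow_mul]; norm_num
  have e2 : C / ((1 / 2 : ℝ) ^ j) ^ 1080 / rs j ^ 2 ≤ C * (1 / 2) ^ j := by
    rw [rs_eq, one_div_pow, one_div_pow, div_div, ← pow_mul, ← pow_mul,
      div_le_iff₀ (by positivity)]
    have : C * (1 / 2 ^ j) * (1 / 2 ^ (j * 1080) * 2 ^ (1000 * j * 2))
        = C * ((2 : ℝ) ^ (1000 * j * 2) / (2 ^ j * 2 ^ (j * 1080))) := by ring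
    rw [this]
    refine le_mul_of_one_le_right (by linarith) ?_
    rw [← pow_add, one_le_div (by positivity)]
    exact pow_le_pow_right₀ (by norm_num) (by omega)
  calc Pp u p (rs j) / rs j ^ 2
      ≤ (C * ((1 / 2) ^ j) ^ 2 * En u p (2 * rs j)
        + C / ((1 / 2) ^ j) ^ 1080 * Fn u p (2 * rs j)) / rs j ^ 2 := by gcongr
    _ = C * (1 / 4) ^ j * (En u p (2 * rs j) / rs j ^ 2)
        + C / ((1 / 2) ^ j) ^ 1080 / rs j ^ 2 * Fn u p (2 * rs j) := by rw [e1]; ring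
    _ ≤ C * (1 / 4) ^ j * (lam ^ 2 * Dens u p (j + 1))
        + C * (1 / 2) ^ j * (lam ^ 2 * Fn u p (rs (j + 1))) := by
      gcongr
      · exact En_two_mul_le hu p j
      · refine (Fn_mono hu (ball_subset_ball (two_mul_rs_le j))).trans ?_
        exact le_mul_of_one_le_left (Fn_nonneg _ _ _) hl2
    _ = _ := by ring

lemma wt_le_of_notMem (p : E 3) {ρ R : ℝ} (hR : 0 < R) {x : E 3} (hx : x ∉ ball p R) :
    wt p ρ x ≤ 1 / R ^ 2 := by
  unfold wt
  rw [inv_eq_one_div, sqd_eq]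
  rw [mem_ball, not_lt] at hx
  gcongr
  have : R ^ 2 ≤ dist x p ^ 2 := by gcongr
  nlinarith [sq_nonneg ρ]

lemma wt_le (p : E 3) {ρ : ℝ} (hρ : 0 < ρ) (x : E 3) : wt p ρ x ≤ 1 / ρ ^ 2 := by
  unfold wt
  rw [inv_eq_one_div]
  have := sqd_nonneg p x
  gcongr
  linarith

lemma setIntegral_wt_le {f : E 3 → ℝ} (hf : Continuous f) (hf0 : ∀ x, 0 ≤ f x) (p : E 3) (i n : ℕ) :
    ∫ x in ball p (rs (i + n)), wt p (rs i) x * f x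
      ≤ lam ^ 2 * ∑ j ∈ Finset.range (n + 1), (∫ x in ball p (rs (i + j)), f x) / rs (i + j) ^ 2 := by
  have hl := two_le_lam
  have hl2 : (1 : ℝ) ≤ lam ^ 2 := one_le_pow₀ (by linarith)
  have hwc := (contDiff_wt p (rs_pos i)).continuous
  have I0 : ∀ r, 0 ≤ ∫ x in ball p r, f x := fun r => integral_nonneg hf0
  induction n with
  | zero =>
    simp only [zero_add, Finset.range_one, Finset.sum_singleton, add_zero]
    have : ∫ x in ball p (rs i), wt p (rs i) x * f x ≤ ∫ x in ball p (rs i), 1 / rs i ^ 2 * f x :=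
      setIntegral_ball_le (by fun_prop) (by fun_prop) fun x _ =>
        mul_le_mul_of_nonneg_right (wt_le p (rs_pos i) x) (hf0 x)
    rw [integral_const_mul, one_div_mul_eq_div] at this
    exact this.trans (le_mul_of_one_le_left (div_nonneg (I0 _) (sq_nonneg _)) hl2)
  | succ n ih =>
    rw [Finset.sum_range_succ, mul_add]
    have hsub : ball p (rs (i + n)) ⊆ ball p (rs (i + (n + 1))) :=
      ball_subset_ball (rs_mono (by omega))
    have hpt : ∫ x in ball p (rs (i + (n + 1))), wt p (rs i) x * f x
        ≤ ∫ x in ball p (rs (i + (n + 1))),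
          ((ball p (rs (i + n))).indicator (fun x => wt p (rs i) x * f x) x
            + 1 / rs (i + n) ^ 2 * f x) := by
      refine setIntegral_mono_on (integrableOn_ball (by fun_prop) _ _)
        (((integrableOn_ball (by fun_prop) _ _).indicator measurableSet_ball).add
          (integrableOn_ball (by fun_prop) _ _)) measurableSet_ball fun x _ => ?_
      by_cases hx : x ∈ ball p (rs (i + n))
      · rw [indicator_of_mem hx]
        have := hf0 x
        have : 0 ≤ 1 / rs (i + n) ^ 2 * f x := by positivity
        linarith
      · rw [indicator_of_notMem hx, zero_add]
        exact mul_le_mul_of_nonneg_right (wt_le_of_notMem p (rs_pos _) hx) (hf0 x)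
    rw [integral_add ((integrableOn_ball (by fun_prop) _ _).indicator measurableSet_ball)
      (integrableOn_ball (by fun_prop) _ _), setIntegral_indicator measurableSet_ball,
      inter_eq_self_of_subset_right hsub, integral_const_mul] at hpt
    have e : 1 / rs (i + n) ^ 2 * ∫ x in ball p (rs (i + (n + 1))), f x
        = lam ^ 2 * ((∫ x in ball p (rs (i + (n + 1))), f x) / rs (i + (n + 1)) ^ 2) := by
      rw [← add_assoc, rs_succ]
      have := (rs_pos (i + n)).ne'
      have : lam ≠ 0 := by positivity
      field_simp
    linarith

lemma sum_pow_le {q : ℝ} (h0 : 0 ≤ q) (h1 : q ≤ 1 / 2) (i n : ℕ) :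
    ∑ j ∈ Finset.range n, q ^ (i + j) ≤ 2 * q ^ i := by
  have : ∀ n, ∑ j ∈ Finset.range n, q ^ (i + j) + 2 * q ^ (i + n) ≤ 2 * q ^ i := fun n => by
    induction n with
    | zero => simp
    | succ n ih =>
      rw [Finset.sum_range_succ]
      have : q ^ (i + (n + 1)) ≤ q ^ (i + n) * (1 / 2) := by
        rw [← add_assoc, pow_succ]; gcongr
      linarith
  have h := this n
  have : 0 ≤ q ^ (i + n) := by positivity
  linarith

set_option maxHeartbeats 1000000 in
lemma exists_Dens_le_sum : ∃ C : ℝ, 1 ≤ C ∧ ∃ j₀ : ℕ, ∀ (u : E 3 → ℝ), ContDiff ℝ 2 u → ∀ p i n,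
    j₀ ≤ i → Dens u p i / 2 + ∫ x in ball p (rs (i + n)), wt p (rs i) x * max (-disc u x) 0
      ≤ C * (∑ j ∈ Finset.range (n + 2), (1 / 4) ^ (i + j) * Dens u p (i + j + 1)
        + (Dens u p (i + n + 2) + Fn u p (rs (i + n + 2)))) := by
  obtain ⟨C, hC, j₀, h⟩ := exists_Pp_scale_le
  have hl := two_le_lam
  have hL := one_le_cutConst
  set L := cutConst with hLdef
  have hl2 : (1 : ℝ) ≤ lam ^ 2 := one_le_pow₀ (by linarith)
  have hl4 : (1 : ℝ) ≤ lam ^ 4 := one_le_pow₀ (by linarith)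
  refine ⟨2 * C * lam ^ 2 + 1 + 6 * L * lam ^ 4, ?_, j₀, fun u hu p i n hi => ?_⟩
  · have : 0 ≤ 2 * C * lam ^ 2 + 6 * L * lam ^ 4 := by positivity
    linarith
  have hri := rs_pos i
  have hwc := (contDiff_wt p hri).continuous
  have c2 := continuous_eden hu
  have c3 := continuous_disc hu
  have c4 := continuous_resid hu
  set m := i + n with hm
  have hrm := rs_pos m
  have mon := monotonicity hu p hri hrm
  rw [← hLdef] at mon
  -- lower bound for the left-hand side
  have low : Dens u p i / 2 ≤ ∫ x in ball p (rs m), 2 * rs i ^ 2 * wt p (rs i) x ^ 2 * eden u x := by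
    calc Dens u p i / 2 = ∫ x in ball p (rs i), 1 / (2 * rs i ^ 2) * eden u x := by
          rw [integral_const_mul]; unfold Dens En; field_simp
      _ ≤ ∫ x in ball p (rs i), 2 * rs i ^ 2 * wt p (rs i) x ^ 2 * eden u x := by
          refine setIntegral_ball_le (by fun_prop) (by fun_prop) fun x hx => ?_
          refine mul_le_mul_of_nonneg_right ?_ (eden_nonneg u x)
          have : 1 / (2 * rs i ^ 2) ≤ wt p (rs i) x := by
            unfold wt
            rw [inv_eq_one_div, sqd_eq]
            rw [mem_ball] at hx
            have := dist_nonneg (x := x) (y := p)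
            have : dist x p ^ 2 ≤ rs i ^ 2 := by gcongr
            gcongr
            linarith
          calc 1 / (2 * rs i ^ 2) = 2 * rs i ^ 2 * (1 / (2 * rs i ^ 2)) ^ 2 := by field_simp
            _ ≤ _ := by gcongr
      _ ≤ _ := setIntegral_ball_mono (by fun_prop)
          (fun x => by have := eden_nonneg u x; positivity)
          (ball_subset_ball (rs_mono (by omega)))
  rw [integral_add (integrableOn_ball (by fun_prop) _ _)
    (integrableOn_ball (by fun_prop) _ _)] at mon
  -- upper bound for the right-hand side
  have up : ∫ x in ball p (2 * rs m), (wt p (rs i) x * max (disc u x) 0 + (resid u x ^ 2 / 8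
        + 6 * L / rs m ^ 2 * eden u x))
      ≤ ∫ x in ball p (rs (m + 1)), (wt p (rs i) x * max (disc u x) 0 + (resid u x ^ 2 / 8
        + 6 * L / rs m ^ 2 * eden u x)) := by
    refine setIntegral_ball_mono (by fun_prop) (fun x => ?_) (ball_subset_ball (two_mul_rs_le m))
    have := eden_nonneg u x
    have := (wt_pos p hri x).le
    have : 0 ≤ max (disc u x) 0 := le_max_right _ _
    positivity
  have up := mon.trans up
  rw [integral_add (μ := volume.restrict (ball p (rs (m + 1))))
      (integrableOn_ball (by fun_prop) _ _) (integrableOn_ball (by fun_prop) _ _),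
    integral_add (f := fun x => resid u x ^ 2 / 8) (integrableOn_ball (by fun_prop) _ _)
      (integrableOn_ball (by fun_prop) _ _), integral_div, integral_const_mul] at up
  have hP := setIntegral_wt_le (c3.max (continuous_const (y := (0 : ℝ))))
    (fun x => le_max_right _ _) p i (n + 1)
  rw [← add_assoc, ← hm] at hP
  set F := Fn u p (rs (m + 2)) with hF
  have hF0 : 0 ≤ F := Fn_nonneg _ _ _
  have hFm : (∫ x in ball p (rs (m + 1)), resid u x ^ 2) ≤ F :=
    Fn_mono hu (ball_subset_ball (rs_mono (by omega)))
  have hEm : 6 * L / rs m ^ 2 * (∫ x in ball p (rs (m + 1)), eden u x)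
      ≤ 6 * L * lam ^ 4 * Dens u p (m + 2) := by
    have e : 6 * L / rs m ^ 2 * (∫ x in ball p (rs (m + 1)), eden u x)
        = 6 * L * lam ^ 2 * Dens u p (m + 1) := by
      unfold Dens En
      rw [rs_succ]
      have : lam ≠ 0 := by positivity
      field_simp
    rw [e]
    calc 6 * L * lam ^ 2 * Dens u p (m + 1)
        ≤ 6 * L * lam ^ 2 * (lam ^ 2 * Dens u p (m + 2)) := by gcongr; exact Dens_le_succ hu p _
      _ = _ := by ring
  set S := ∑ j ∈ Finset.range (n + 2), (1 / 4 : ℝ) ^ (i + j) * Dens u p (i + j + 1) with hS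
  have hS0 : 0 ≤ S := Finset.sum_nonneg fun j _ => by have := Dens_nonneg u p (i + j + 1); positivity
  have hsum : ∑ j ∈ Finset.range (n + 1 + 1),
      (∫ x in ball p (rs (i + j)), max (disc u x) 0) / rs (i + j) ^ 2 ≤ C * (S + 2 * F) := by
    have : ∀ j ∈ Finset.range (n + 1 + 1),
        (∫ x in ball p (rs (i + j)), max (disc u x) 0) / rs (i + j) ^ 2
        ≤ C * ((1 / 4) ^ (i + j) * Dens u p (i + j + 1) + (1 / 2) ^ (i + j) * F) := fun j hj => by
      refine (h u hu p (i + j) (by omega)).trans ?_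
      have : Fn u p (rs (i + j + 1)) ≤ F :=
        Fn_mono hu (ball_subset_ball (rs_mono (by rw [Finset.mem_range] at hj; omega)))
      gcongr
    refine (Finset.sum_le_sum this).trans ?_
    rw [← Finset.mul_sum, Finset.sum_add_distrib, ← Finset.sum_mul]
    have := sum_pow_le (q := 1 / 2) (by norm_num) le_rfl i (n + 1 + 1)
    have h1 : (1 / 2 : ℝ) ^ i ≤ 1 := pow_le_one₀ (by norm_num) (by norm_num)
    have h2 : (∑ j ∈ Finset.range (n + 1 + 1), (1 / 2 : ℝ) ^ (i + j)) * F ≤ 2 * F := by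
      gcongr; linarith
    gcongr
  have hsum' : lam ^ 2 * ∑ j ∈ Finset.range (n + 1 + 1),
      (∫ x in ball p (rs (i + j)), max (disc u x) 0) / rs (i + j) ^ 2
      ≤ lam ^ 2 * (C * (S + 2 * F)) := by gcongr
  have hD := Dens_nonneg u p (m + 2)
  have q1 : 0 ≤ (C * lam ^ 2 + 1 + 6 * L * lam ^ 4) * S := by positivity
  have q2 : 0 ≤ (7 / 8 + 6 * L * lam ^ 4) * F := by positivity
  have q3 : 0 ≤ (2 * C * lam ^ 2 + 1) * Dens u p (m + 2) := by positivity
  linarith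

/-- Almost monotonicity of the density ratio. -/
lemma exists_Dens_le : ∃ C : ℝ, 1 ≤ C ∧ ∃ j₀ : ℕ, ∀ (u : E 3 → ℝ), ContDiff ℝ 2 u → ∀ p i n,
    j₀ ≤ i → Dens u p i + ∫ x in ball p (rs (i + n)), wt p (rs i) x * max (-disc u x) 0
      ≤ C * (Dens u p (i + n + 2) + Fn u p (rs (i + n + 2))) := by
  obtain ⟨C, hC, j₁, h⟩ := exists_Dens_le_sum
  obtain ⟨j₂, hj₂⟩ := exists_pow_lt_of_lt_one (show (0 : ℝ) < 1 / (8 * C) by positivity)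
    (by norm_num : (1 / 4 : ℝ) < 1)
  have hl := two_le_lam
  have hl2 : (1 : ℝ) ≤ lam ^ 2 := one_le_pow₀ (by linarith)
  refine ⟨4 * C * lam ^ 2, by nlinarith, max j₁ j₂, ?_⟩
  intro u hu p i n hi
  have I0 : ∀ i m, 0 ≤ ∫ x in ball p (rs m), wt p (rs i) x * max (-disc u x) 0 := fun i m =>
    integral_nonneg fun x => mul_nonneg (wt_pos p (rs_pos i) x).le (le_max_right _ _)
  set m := i + n with hm
  set D := Dens u p (m + 2) + Fn u p (rs (m + 2)) with hD
  have hD1 := Dens_nonneg u p (m + 2)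
  have hD2 := Fn_nonneg u p (rs (m + 2))
  have hD0 : 0 ≤ D := by positivity
  set B := 4 * C * lam ^ 2 * D with hB
  have hB0 : 0 ≤ B := by positivity
  have hBD : 4 * C * D ≤ B := by
    rw [hB]
    calc 4 * C * D = 4 * C * 1 * D := by ring
      _ ≤ _ := by gcongr
  have step : ∀ i n, max j₁ j₂ ≤ i → i + n = m → (∀ j, i < j → j ≤ m + 2 → Dens u p j ≤ B) →
      Dens u p i / 2 + ∫ x in ball p (rs (i + n)), wt p (rs i) x * max (-disc u x) 0 ≤ B / 2 := by
    intro i n hi hin hj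
    have k := h u hu p i n (le_trans (le_max_left _ _) hi)
    have k1 : ∑ j ∈ Finset.range (n + 2), (1 / 4 : ℝ) ^ (i + j) * Dens u p (i + j + 1)
        ≤ (∑ j ∈ Finset.range (n + 2), (1 / 4 : ℝ) ^ (i + j)) * B := by
      rw [Finset.sum_mul]
      refine Finset.sum_le_sum fun j hj' => ?_
      rw [Finset.mem_range] at hj'
      exact mul_le_mul_of_nonneg_left (hj _ (by omega) (by omega)) (by positivity)
    have k2 := sum_pow_le (q := 1 / 4) (by norm_num) (by norm_num) i (n + 2)
    have k3 : (1 / 4 : ℝ) ^ i ≤ 1 / (8 * C) :=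
      (pow_le_pow_of_le_one (by norm_num) (by norm_num) (le_trans (le_max_right _ _) hi)).trans
        hj₂.le
    have k4 : (∑ j ∈ Finset.range (n + 2), (1 / 4 : ℝ) ^ (i + j)) * B ≤ 2 * (1 / (8 * C)) * B := by
      gcongr; linarith
    have k5 : C * (2 * (1 / (8 * C)) * B) = B / 4 := by field_simp; ring
    rw [hin, ← hD] at k
    have k6 := mul_le_mul_of_nonneg_left (k1.trans k4) (by linarith : 0 ≤ C)
    rw [k5] at k6
    rw [hin]
    linarith
  have all : ∀ k i, i + k = m + 2 → max j₁ j₂ ≤ i → Dens u p i ≤ B := by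
    intro k
    induction k using Nat.strong_induction_on with
    | _ k ih =>
      intro i hik hi
      have hj : ∀ j, i < j → j ≤ m + 2 → Dens u p j ≤ B := fun j h1 h2 =>
        ih (m + 2 - j) (by omega) j (by omega) (by omega)
      match k, hik with
      | 0, hik =>
        have : i = m + 2 := by omega
        subst this
        have : Dens u p (m + 2) ≤ 4 * C * D := by
          have : D ≤ 4 * C * D := le_mul_of_one_le_left hD0 (by linarith)
          linarith
        linarith
      | 1, hik =>
        have : i = m + 1 := by omega
        subst this
        refine (Dens_le_succ hu p _).trans ?_
        rw [hB]
        calc lam ^ 2 * Dens u p (m + 1 + 1) ≤ lam ^ 2 * D := by gcongr; linarith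
          _ ≤ lam ^ 2 * D * (4 * C) := le_mul_of_one_le_right (by positivity) (by linarith)
          _ = _ := by ring
      | k + 2, hik =>
        have := step i k hi (by omega) hj
        have := I0 i (i + k)
        linarith
  have k1 := step i n hi hm.symm fun j h1 h2 => all (m + 2 - j) j (by omega) (by omega)
  have k2 := I0 i m
  rw [← hm] at k1
  linarith

/-- Testing the equation with a function of `u` which controls a nonnegative quantity. -/
lemma setIntegral_le_of_test {u : E 3 → ℝ} (hu : ContDiff ℝ 2 u) {g g' : ℝ → ℝ}
    (hg : ∀ t, HasDerivAt g (g' t) t) (hg' : Continuous g') (p : E 3) {R : ℝ} (hR : 0 < R)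
    {a b : E 3 → ℝ} (ha : Continuous a) (ha0 : ∀ y, 0 ≤ a y) (hb : Continuous b)
    (hb0 : ∀ y, 0 ≤ b y)
    (h : ∀ y ∈ ball p (2 * R), a y + 2 * g (u y) ^ 2
      ≤ (g' (u y) * gsq u y + g (u y) * W' (u y)) + b y) :
    ∫ x in ball p R, a x
      ≤ (∫ x in ball p (2 * R), b x) + (Fn u p (2 * R) + 2 * cutConst / R ^ 2 * En u p (2 * R)) := by
  have c1 := continuous_resid hu
  have c2 := continuous_eden hu
  have hL := one_le_cutConst
  have key : ∫ x in ball p R, a x ≤ ∫ x in ball p (2 * R),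
      (b x + (resid u x ^ 2 + 2 * cutConst / R ^ 2 * eden u x)) := by
    refine test_cut hu hg hg' p hR 0 (integrableOn_ball ha _ _)
      (integrableOn_ball (by fun_prop) _ _) ?_ ?_
    · intro y hy
      have h1 := h y (ball_subset_ball (by linarith) hy)
      have h2 := eden_nonneg u y
      have h3 : 0 ≤ 2 * cutConst / R ^ 2 * eden u y := by positivity
      nlinarith [sq_nonneg (resid u y - 2 * g (u y)), sq_nonneg (resid u y), sq_nonneg (g (u y))]
    · intro y hy
      have h1 := h y hy
      have hz0 := cut_nonneg p R y
      have hz1 := cut_le_one p R y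
      have hD := gdot_cut_sq_le (p := p) (R := R) y u
      have hG : cutConst / R ^ 2 * gsq u y ≤ 2 * cutConst / R ^ 2 * eden u y := by
        have : gsq u y ≤ 2 * eden u y := by unfold eden; linarith [W_nonneg (u y)]
        calc _ ≤ cutConst / R ^ 2 * (2 * eden u y) := by gcongr
          _ = _ := by ring
      have ha0 := ha0 y
      have hb0 := hb0 y
      set X := g' (u y) * gsq u y + g (u y) * W' (u y)
      set D := gdot u (cut p R) y
      set z := cut p R y
      set G := g (u y)
      set r := resid u y
      have hz2 : z ^ 2 ≤ 1 := pow_le_one₀ hz0 hz1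
      have e1 : 0 ≤ z ^ 2 * (X - r * G - G ^ 2 + b y + r ^ 2) := by
        apply mul_nonneg (sq_nonneg _)
        nlinarith [sq_nonneg (r - 2 * G), sq_nonneg r]
      have e2 : 0 ≤ (1 - z ^ 2) * (b y + r ^ 2) :=
        mul_nonneg (by linarith) (by positivity)
      have e3 : 0 ≤ (z * G + D) ^ 2 := sq_nonneg _
      norm_num
      nlinarith
  refine key.trans (le_of_eq ?_)
  rw [integral_add (integrableOn_ball (by fun_prop) _ _) (integrableOn_ball (by fun_prop) _ _),
    integral_add (f := fun x => resid u x ^ 2) (integrableOn_ball (by fun_prop) _ _)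
      (integrableOn_ball (by fun_prop) _ _), integral_const_mul]
  rfl

/-- Decay of the energy where `u` is close to a well. -/
lemma En_le_of_well {u : E 3 → ℝ} (hu : ContDiff ℝ 2 u) (p : E 3) {R : ℝ} (hR : 0 < R)
    (h : ∀ y ∈ ball p (2 * R), 1 / 2 ≤ u y) :
    En u p R ≤ 16 * (Fn u p (2 * R) + 2 * cutConst / R ^ 2 * En u p (2 * R)) := by
  have c2 := continuous_eden hu
  have := setIntegral_le_of_test hu (g := fun t => (t - 1) / 4) (g' := fun _ => 1 / 4)
    (fun t => ((hasDerivAt_id t).sub_const 1).div_const 4) continuous_const p hR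
    (a := fun y => 1 / 16 * eden u y) (b := fun _ => 0) (by fun_prop)
    (fun y => by have := eden_nonneg u y; positivity) continuous_const (fun _ => le_rfl) ?_
  · rw [integral_const_mul, integral_zero] at this
    unfold En at *
    linarith
  · intro y hy
    have h1 := h y hy
    have h2 := gsq_nonneg u y
    simp only [eden, W, W']
    set t := u y
    have : 0 ≤ (t - 1) ^ 2 * (t * (t + 1) / 4 - 1 / 8 - (t + 1) ^ 2 / 64) := by
      apply mul_nonneg (sq_nonneg _)
      nlinarith
    nlinarith

/-- A test function adapted to the half-line above `s`. -/
lemma exists_halfline_test {s : ℝ} (hs : -1 < s) : ∃ g g' : ℝ → ℝ, (∀ t, HasDerivAt g (g' t) t) ∧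
    Continuous g' ∧ (∀ t, s < t → g' t = 1 + 2 / (1 + t) ^ 2) ∧
    ∀ t, s < t → g t = t - 2 / (1 + t) := by
  have hpos : ∀ t, 0 < 1 + max t s := fun t => by have := le_max_right t s; linarith
  have hc : Continuous fun t : ℝ => 1 + 2 / (1 + max t s) ^ 2 := by
    refine continuous_const.add (continuous_const.div (by fun_prop) fun t => ?_)
    have := hpos t
    positivity
  refine ⟨fun t => (s - 2 / (1 + s)) + ∫ x in s..t, (1 + 2 / (1 + max x s) ^ 2), _, fun t => ?_, hc,
    fun t ht => ?_, fun t ht => ?_⟩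
  · exact (hc.integral_hasStrictDerivAt s t).hasDerivAt.const_add _
  · rw [max_eq_left ht.le]
  · have : ∫ x in s..t, (1 + 2 / (1 + max x s) ^ 2) = (t - 2 / (1 + t)) - (s - 2 / (1 + s)) := by
      refine intervalIntegral.integral_eq_sub_of_hasDerivAt (f := fun t => t - 2 / (1 + t)) ?_
        (hc.intervalIntegrable _ _)
      intro x hx
      rw [uIcc_of_le ht.le] at hx
      rw [max_eq_left hx.1]
      have h0 : 1 + x ≠ 0 := by linarith [hx.1]
      refine ((hasDerivAt_id x).sub (((hasDerivAt_const x (2 : ℝ)).div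
        ((hasDerivAt_id x).const_add 1) h0))).congr_deriv ?_
      simp
      ring
    dsimp only
    rw [this]; ring

/-- Where `u` stays above `s > -1`, the energy is controlled by the discrepancy. -/
lemma exists_En_le_disc {s : ℝ} (hs : -1 < s) : ∃ C : ℝ, 1 ≤ C ∧ ∀ (u : E 3 → ℝ), ContDiff ℝ 2 u →
    ∀ (p : E 3) (R : ℝ), 0 < R → (∀ y ∈ ball p (2 * R), s < u y) →
    En u p R ≤ C * ((∫ x in ball p (2 * R), |disc u x|) + Fn u p (2 * R)
      + En u p (2 * R) / R ^ 2) := by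
  obtain ⟨g, g', hg, hg', e', e⟩ := exists_halfline_test hs
  set σ := 1 + s with hσ
  have hσ0 : 0 < σ := by linarith
  set K := 4 * (1 + 1 / σ) ^ 2 / σ ^ 2 with hK
  have hK0 : 0 < K := by positivity
  set G := 1 + 2 / σ ^ 2 with hG
  have hG0 : 0 < G := by positivity
  have hL := one_le_cutConst
  refine ⟨(G + 1) + K * (1 + 2 * cutConst) + 1, by nlinarith, fun u hu p R hR h => ?_⟩
  have c1 := continuous_resid hu
  have c2 := continuous_eden hu
  have c3 := continuous_disc hu
  have c4 : Continuous fun y => W (u y) := (contDiff_W (n := 0)).continuous.comp hu.continuous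
  have key := setIntegral_le_of_test hu (g := fun t => 1 / K * g t) (g' := fun t => 1 / K * g' t)
    (fun t => (hg t).const_mul _) (by fun_prop) p hR
    (a := fun y => 4 / K * W (u y)) (b := fun y => 2 * G / K * |disc u y|) (by fun_prop)
    (fun y => by have := W_nonneg (u y); positivity) (by fun_prop) (fun y => by positivity) ?_
  · have h1 : En u p R ≤ (∫ x in ball p R, 2 * W (u x)) + ∫ x in ball p R, |disc u x| := by
      rw [← integral_add (integrableOn_ball (by fun_prop) _ _)
        (integrableOn_ball (by fun_prop) _ _)]
      refine setIntegral_ball_le (by fun_prop) (by fun_prop) fun x _ => ?_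
      have : eden u x = 2 * W (u x) + disc u x := by unfold eden disc; ring
      rw [this]
      gcongr
      exact le_abs_self _
    have h2 : (∫ x in ball p R, |disc u x|) ≤ ∫ x in ball p (2 * R), |disc u x| :=
      setIntegral_ball_mono (by fun_prop) (fun _ => abs_nonneg _) (ball_subset_ball (by linarith))
    rw [integral_const_mul] at h1 key
    rw [integral_const_mul] at key
    have hP : 0 ≤ ∫ x in ball p (2 * R), |disc u x| := integral_nonneg fun _ => abs_nonneg _
    have hF := Fn_nonneg u p (2 * R)
    have hE := En_nonneg u p (2 * R)
    set P := ∫ x in ball p (2 * R), |disc u x|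
    set w := ∫ x in ball p R, W (u x)
    have hw : 2 * w ≤ G * P + K / 2 * (Fn u p (2 * R) + 2 * cutConst / R ^ 2 * En u p (2 * R)) := by
      calc 2 * w = K / 2 * (4 / K * w) := by field_simp; ring
        _ ≤ K / 2 * (2 * G / K * P + (Fn u p (2 * R) + 2 * cutConst / R ^ 2 * En u p (2 * R))) := by
            gcongr
        _ = _ := by field_simp
    set q := En u p (2 * R) / R ^ 2 with hq
    have hq0 : 0 ≤ q := by positivity
    have e2 : 2 * cutConst / R ^ 2 * En u p (2 * R) = 2 * cutConst * q := by rw [hq]; ring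
    rw [e2] at hw
    set F := Fn u p (2 * R)
    have q1 : 0 ≤ K * F := by positivity
    have q2 : 0 ≤ K * cutConst * F := by positivity
    have q3 : 0 ≤ K * cutConst * q := by positivity
    have q4 : 0 ≤ K * cutConst * P := by positivity
    have q5 : 0 ≤ K * P := by positivity
    have q6 : 0 ≤ K * q := by positivity
    have q7 : 0 ≤ G * F := by positivity
    have q8 : 0 ≤ G * q := by positivity
    nlinarith
  · intro y hy
    have hy := h y hy
    rw [e _ hy, e' _ hy]
    have hτ : σ < 1 + u y := by linarith
    set t := u y with ht
    have hτ0 : 0 < 1 + t := by linarith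
    have hd : gsq u y = 2 * W t + 2 * disc u y := by unfold disc; ring
    have id : (1 + 2 / (1 + t) ^ 2) * (2 * W t) + (t - 2 / (1 + t)) * W' t = 6 * W t := by
      unfold W W'; field_simp; ring
    have hgb : (t - 2 / (1 + t)) ^ 2 ≤ K * W t := by
      have e3 : (t - 2 / (1 + t)) ^ 2 = 4 * (1 + 1 / (1 + t)) ^ 2 / (1 + t) ^ 2 * W t := by
        unfold W; field_simp; ring
      rw [e3]
      refine mul_le_mul_of_nonneg_right ?_ (W_nonneg t)
      rw [hK]; gcongr
    have hg1 : 1 + 2 / (1 + t) ^ 2 ≤ G := by rw [hG]; gcongr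
    have hdd : -(G * |disc u y|) ≤ (1 + 2 / (1 + t) ^ 2) * disc u y := by
      have h1 : (1 + 2 / (1 + t) ^ 2) * |disc u y| ≤ G * |disc u y| := by gcongr
      have h2 : -((1 + 2 / (1 + t) ^ 2) * |disc u y|) ≤ (1 + 2 / (1 + t) ^ 2) * disc u y := by
        have := neg_abs_le (disc u y)
        have h3 : 0 ≤ 1 + 2 / (1 + t) ^ 2 := by positivity
        nlinarith
      linarith
    rw [hd]
    set Q := 1 + 2 / (1 + t) ^ 2
    set H := t - 2 / (1 + t)
    have f1 : 2 * (1 / K * H) ^ 2 ≤ 2 / K * W t := by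
      calc 2 * (1 / K * H) ^ 2 = 2 / K ^ 2 * H ^ 2 := by rw [mul_pow, div_pow, one_pow]; field_simp
        _ ≤ 2 / K ^ 2 * (K * W t) := by gcongr
        _ = _ := by field_simp
    have f2 : 1 / K * Q * (2 * W t + 2 * disc u y) + 1 / K * H * W' t + 2 * G / K * |disc u y|
        = 6 / K * W t + 2 / K * (Q * disc u y + G * |disc u y|) := by
      have : 1 / K * Q * (2 * W t) + 1 / K * H * W' t = 6 / K * W t := by
        calc _ = 1 / K * (Q * (2 * W t) + H * W' t) := by ring
          _ = _ := by rw [id]; ring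
      linear_combination this
    rw [f2]
    have f3 : 0 ≤ 2 / K * (Q * disc u y + G * |disc u y|) := by
      apply mul_nonneg (by positivity); linarith
    have f4 : 6 / K * W t = 4 / K * W t + 2 / K * W t := by ring
    linarith

/-- The weighted integral dominates the sum over scales. -/
lemma sum_le_setIntegral_wt {f : E 3 → ℝ} (hf : Continuous f) (hf0 : ∀ x, 0 ≤ f x) (p : E 3) {R : ℝ}
    (n : ℕ) : ∀ i, rs (i + n) ≤ R →
    ∑ j ∈ Finset.range n, (∫ x in ball p (rs (i + j)), f x) / rs (i + j) ^ 2
      ≤ 4 * ∫ x in ball p R, wt p (rs i) x * f x := by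
  have hl := two_le_lam
  induction n with
  | zero =>
    intro i _
    simp only [Finset.range_zero, Finset.sum_empty]
    have : 0 ≤ ∫ x in ball p R, wt p (rs i) x * f x :=
      integral_nonneg fun x => mul_nonneg (wt_pos p (rs_pos i) x).le (hf0 x)
    positivity
  | succ n ih =>
    intro i hi
    have h1 := ih (i + 1) (by rwa [add_assoc, add_comm 1])
    rw [Finset.sum_range_succ']
    have h2 : ∀ j, i + 1 + j = i + (j + 1) := fun j => by ring
    simp only [h2, add_zero] at h1 ⊢
    have hri := rs_pos i
    have w1 := (contDiff_wt p hri).continuous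
    have w2 := (contDiff_wt p (rs_pos (i + 1))).continuous
    have hw : ∀ x, wt p (rs (i + 1)) x ≤ wt p (rs i) x := fun x => by
      unfold wt
      have := sqd_nonneg p x
      have := rs_mono (Nat.le_succ i)
      gcongr
    have h3 : (∫ x in ball p (rs i), f x) / rs i ^ 2
        ≤ ∫ x in ball p R, 4 * ((wt p (rs i) x - wt p (rs (i + 1)) x) * f x) := by
      rw [← integral_div]
      calc ∫ x in ball p (rs i), f x / rs i ^ 2
          ≤ ∫ x in ball p (rs i), 4 * ((wt p (rs i) x - wt p (rs (i + 1)) x) * f x) := by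
            refine setIntegral_ball_le (by fun_prop) (by fun_prop) fun x hx => ?_
            have a1 : 1 / (2 * rs i ^ 2) ≤ wt p (rs i) x := by
              unfold wt
              rw [inv_eq_one_div, sqd_eq]
              rw [mem_ball] at hx
              have := dist_nonneg (x := x) (y := p)
              have : dist x p ^ 2 ≤ rs i ^ 2 := by gcongr
              gcongr
              linarith
            have a2 := wt_le p (rs_pos (i + 1)) x
            have a3 : 1 / rs (i + 1) ^ 2 ≤ 1 / (4 * rs i ^ 2) := by
              have := two_mul_rs_le i
              have : (2 * rs i) ^ 2 ≤ rs (i + 1) ^ 2 := by gcongr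
              gcongr
              linarith
            have a4 : 1 / rs i ^ 2 ≤ 4 * (wt p (rs i) x - wt p (rs (i + 1)) x) := by
              have b1 : 1 / (2 * rs i ^ 2) = 1 / 2 * (1 / rs i ^ 2) := by ring
              have b2 : 1 / (4 * rs i ^ 2) = 1 / 4 * (1 / rs i ^ 2) := by ring
              linarith
            calc f x / rs i ^ 2 = 1 / rs i ^ 2 * f x := by ring
              _ ≤ 4 * (wt p (rs i) x - wt p (rs (i + 1)) x) * f x :=
                  mul_le_mul_of_nonneg_right a4 (hf0 x)
              _ = _ := by ring
        _ ≤ _ := setIntegral_ball_mono (by fun_prop)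
            (fun x => mul_nonneg (by norm_num) (mul_nonneg (sub_nonneg.2 (hw x)) (hf0 x)))
            (ball_subset_ball ((rs_mono (by omega)).trans hi))
    have h4 : ∫ x in ball p R, 4 * ((wt p (rs i) x - wt p (rs (i + 1)) x) * f x)
        = 4 * (∫ x in ball p R, wt p (rs i) x * f x)
          - 4 * ∫ x in ball p R, wt p (rs (i + 1)) x * f x := by
      rw [integral_const_mul, ← mul_sub, ← integral_sub (integrableOn_ball (by fun_prop) _ _)
        (integrableOn_ball (by fun_prop) _ _)]
      simp only [sub_mul]
    linarith

lemma one_le_rs (j : ℕ) : 1 ≤ rs j := one_le_pow₀ (by linarith [two_le_lam])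

lemma inv_rs_sq_le (j : ℕ) : 1 / rs j ^ 2 ≤ (1 / 2) ^ j := by
  have h1 : (2 : ℝ) ^ j ≤ rs j := pow_le_pow_left₀ (by norm_num) two_le_lam j
  have h2 : rs j ≤ rs j ^ 2 := le_self_pow₀ (one_le_rs j) (by norm_num)
  rw [div_pow, one_pow]
  gcongr
  linarith

/-- A gap theorem: where `u` stays above `s > -1` on a large ball of bounded density and with
small residual, `u` is close to a well at the centre. -/
lemma exists_gap {s β : ℝ} (hs : -1 < s) (hβ : 0 < β) (hβ1 : β ≤ 1) : ∃ δ : ℝ, 0 < δ ∧ ∀ C₀ : ℝ,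
    0 ≤ C₀ → ∃ N : ℕ, ∀ (u : E 3 → ℝ), ContDiff ℝ 2 u → ∀ (x : E 3) (m : ℕ), N ≤ m →
    (∀ y ∈ ball x (rs m), s < u y) → Dens u x m ≤ C₀ → Fn u x (rs m) ≤ δ → 1 - β < |u x| := by
  obtain ⟨c, hc, hlow⟩ := exists_energy_lower
  obtain ⟨C, hC, j₀, hmon⟩ := exists_Dens_le
  obtain ⟨C', hC', j₁, hPp⟩ := exists_Pp_scale_le
  obtain ⟨Cs, hCs, hdisc⟩ := exists_En_le_disc hs
  have hl := two_le_lam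
  set J := max j₀ j₁ with hJ
  set d := c * β ^ 14 / rs J ^ 2 with hd
  have hrJ := rs_pos J
  have hd0 : 0 < d := by positivity
  refine ⟨min 1 (d / (2 * C)), by positivity, fun C₀ hC₀ => ?_⟩
  set C2 := C * (C₀ + 1) with hC2
  have hC20 : 0 < C2 := by positivity
  set t := d / (2 * C) / (4 * Cs * lam ^ 2) with ht
  have ht0 : 0 < t := by positivity
  obtain ⟨M, hM⟩ := exists_pow_lt_of_lt_one
    (show (0 : ℝ) < t / (C' * (C2 + 1) + 1 + lam ^ 2 * C2) by positivity)
    (by norm_num : (1 / 2 : ℝ) < 1)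
  obtain ⟨n, hn⟩ := exists_nat_gt (4 * C2 / t)
  have hn0 : (0 : ℝ) < n := lt_trans (by positivity) hn
  refine ⟨J + M + n + 10, fun u hu x m hm hus hD hF => ?_⟩
  by_contra hcon
  rw [not_lt] at hcon
  have hF1 : Fn u x (rs m) ≤ 1 := hF.trans (min_le_left _ _)
  have hF2 : Fn u x (rs m) ≤ d / (2 * C) := hF.trans (min_le_right _ _)
  have hr4 : 4 ≤ rs m := by
    calc (4 : ℝ) = 2 ^ 2 := by norm_num
      _ ≤ lam ^ 2 := by gcongr
      _ = rs 2 := rfl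
      _ ≤ rs m := rs_mono (by omega)
  have hFle : ∀ j, j ≤ m → Fn u x (rs j) ≤ Fn u x (rs m) := fun j hj =>
    Fn_mono hu (ball_subset_ball (rs_mono hj))
  -- lower density bound
  have hlb : ∀ j, J + 2 ≤ j → j ≤ m → d / (2 * C) ≤ Dens u x j := by
    intro j hj hjm
    have h1 : d ≤ Dens u x J := by
      unfold Dens
      rw [hd]
      gcongr
      exact (hlow u hu x ((Fn_mono hu (ball_subset_ball hr4)).trans hF1) β hβ hβ1 hcon).trans
        (En_mono hu (ball_subset_ball (one_le_rs J)))
    have h2 := hmon u hu x J (j - J - 2) (le_max_left _ _)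
    rw [show J + (j - J - 2) + 2 = j by omega] at h2
    have h3 : 0 ≤ ∫ y in ball x (rs (J + (j - J - 2))), wt x (rs J) y * max (-disc u y) 0 :=
      integral_nonneg fun y => mul_nonneg (wt_pos x hrJ y).le (le_max_right _ _)
    have h4 := hFle j hjm
    have h5 : d ≤ C * (Dens u x j + d / (2 * C)) := by
      calc d ≤ C * (Dens u x j + Fn u x (rs j)) := by linarith
        _ ≤ _ := by gcongr; linarith
    have h6 : C * (Dens u x j + d / (2 * C)) = C * Dens u x j + d / 2 := by field_simp
    rw [div_le_iff₀ (by positivity)]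
    linarith
  -- upper bounds
  have hub : ∀ j, J ≤ j → j + 2 ≤ m → Dens u x j
      + ∫ y in ball x (rs (m - 2)), wt x (rs j) y * max (-disc u y) 0 ≤ C2 := by
    intro j hj hjm
    have h2 := hmon u hu x j (m - 2 - j) ((le_max_left _ _).trans hj)
    rw [show j + (m - 2 - j) + 2 = m by omega, show j + (m - 2 - j) = m - 2 by omega] at h2
    refine h2.trans ?_
    rw [hC2]
    gcongr
  have hI0 : ∀ j, 0 ≤ ∫ y in ball x (rs (m - 2)), wt x (rs j) y * max (-disc u y) 0 := fun j =>
    integral_nonneg fun y => mul_nonneg (wt_pos x (rs_pos j) y).le (le_max_right _ _)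
  have c3 := continuous_disc hu
  -- a good scale
  set i := J + M + 4 with hi
  obtain ⟨k, hk, hgood⟩ : ∃ k < n, (∫ y in ball x (rs (i + k)), max (-disc u y) 0) / rs (i + k) ^ 2
      < t := by
    by_contra! hall
    have h1 := sum_le_setIntegral_wt (f := fun y => max (-disc u y) 0)
      (c3.neg.max (continuous_const (y := (0 : ℝ)))) (fun _ => le_max_right _ _) x (R := rs (m - 2))
      n i (rs_mono (by omega))
    have h2 : ∑ j ∈ Finset.range n, t ≤ ∑ j ∈ Finset.range n,
        (∫ y in ball x (rs (i + j)), max (-disc u y) 0) / rs (i + j) ^ 2 :=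
      Finset.sum_le_sum fun j hj => hall j (Finset.mem_range.1 hj)
    rw [Finset.sum_const, Finset.card_range, nsmul_eq_mul] at h2
    have h3 := hub i (by omega) (by omega)
    have h4 := Dens_nonneg u x i
    rw [div_lt_iff₀ ht0] at hn
    linarith
  obtain ⟨j, hj⟩ : ∃ j, i + k = j + 1 := ⟨i + k - 1, by omega⟩
  rw [hj] at hgood
  have hrj := rs_pos j
  have hball : ball x (2 * rs j) ⊆ ball x (rs (j + 1)) := ball_subset_ball (two_mul_rs_le j)
  have key := hdisc u hu x (rs j) hrj fun y hy =>
    hus y (ball_subset_ball (rs_mono (by omega)) (hball hy))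
  have k1 : (∫ y in ball x (2 * rs j), |disc u y|)
      ≤ (∫ y in ball x (rs (j + 1)), max (-disc u y) 0) + Pp u x (rs (j + 1)) := by
    refine (setIntegral_ball_mono (by fun_prop) (fun _ => abs_nonneg _) hball).trans ?_
    unfold Pp
    have d1 : Continuous fun y => max (disc u y) 0 := c3.max (continuous_const (y := (0 : ℝ)))
    have d2 : Continuous fun y => max (-disc u y) 0 := c3.neg.max (continuous_const (y := (0 : ℝ)))
    rw [← integral_add (integrableOn_ball d2 _ _) (integrableOn_ball d1 _ _)]
    refine setIntegral_ball_le (by fun_prop) (by fun_prop) fun y _ => ?_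
    rcases abs_cases (disc u y) with ⟨h, _⟩ | ⟨h, _⟩ <;> rw [h]
    · linarith [le_max_left (disc u y) 0, le_max_right (-disc u y) 0]
    · linarith [le_max_left (-disc u y) 0, le_max_right (disc u y) 0]
  set r := rs (j + 1) with hr
  have hr0 : 0 < r := rs_pos _
  have k2 : (∫ y in ball x r, max (-disc u y) 0) ≤ t * r ^ 2 := by
    rw [div_lt_iff₀ (by positivity)] at hgood
    exact hgood.le
  set q := (1 / 2 : ℝ) ^ (j + 1) with hq
  have hq0 : 0 < q := by positivity
  have k3 : Pp u x r ≤ C' * (C2 + 1) * q * r ^ 2 := by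
    have h1 := hPp u hu x (j + 1) (by have := le_max_right j₀ j₁; omega)
    rw [div_le_iff₀ (by positivity)] at h1
    refine h1.trans ?_
    have h2 : Dens u x (j + 1 + 1) ≤ C2 := by
      have := hub (j + 1 + 1) (by omega) (by omega)
      linarith [hI0 (j + 1 + 1)]
    have h3 : Fn u x (rs (j + 1 + 1)) ≤ 1 := (hFle _ (by omega)).trans hF1
    have h4 : (1 / 4 : ℝ) ^ (j + 1) ≤ q := by rw [hq]; gcongr; norm_num
    have h5 := Dens_nonneg u x (j + 1 + 1)
    have h6 : (1 / 4 : ℝ) ^ (j + 1) * Dens u x (j + 1 + 1) + q * Fn u x (rs (j + 1 + 1))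
        ≤ q * C2 + q * 1 := by gcongr
    calc _ ≤ C' * (q * C2 + q * 1) * r ^ 2 := by gcongr
      _ = _ := by ring
  have hr1 : 1 ≤ q * r ^ 2 := by
    have := inv_rs_sq_le (j + 1)
    rwa [div_le_iff₀ (by positivity)] at this
  have k4 : Fn u x (2 * rs j) ≤ q * r ^ 2 :=
    ((Fn_mono hu hball).trans ((hFle _ (by omega)).trans hF1)).trans hr1
  have k5 : En u x (2 * rs j) / rs j ^ 2 ≤ lam ^ 2 * C2 * (q * r ^ 2) := by
    refine (En_two_mul_le hu x j).trans ?_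
    have : Dens u x (j + 1) ≤ C2 := by
      have := hub (j + 1) (by omega) (by omega)
      linarith [hI0 (j + 1)]
    calc lam ^ 2 * Dens u x (j + 1) ≤ lam ^ 2 * C2 * 1 := by rw [mul_one]; gcongr
      _ ≤ _ := by gcongr
  have hqM : (C' * (C2 + 1) + 1 + lam ^ 2 * C2) * q ≤ t := by
    have h1 : q ≤ (1 / 2) ^ M :=
      pow_le_pow_of_le_one (by norm_num) (by norm_num) (by omega)
    have h2 := h1.trans hM.le
    rw [le_div_iff₀ (by positivity)] at h2
    linarith
  have k6 : En u x (rs j) ≤ Cs * (2 * t) * r ^ 2 := by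
    have h1 : (∫ y in ball x (2 * rs j), |disc u y|) + Fn u x (2 * rs j)
        + En u x (2 * rs j) / rs j ^ 2
        ≤ t * r ^ 2 + ((C' * (C2 + 1) + 1 + lam ^ 2 * C2) * q) * r ^ 2 := by linarith
    have h2 : ((C' * (C2 + 1) + 1 + lam ^ 2 * C2) * q) * r ^ 2 ≤ t * r ^ 2 := by gcongr
    calc _ ≤ _ := key
      _ ≤ Cs * (t * r ^ 2 + t * r ^ 2) :=
          mul_le_mul_of_nonneg_left (h1.trans (by linarith)) (by linarith)
      _ = _ := by ring
  have k7 := hlb j (by omega) (by omega)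
  unfold Dens at k7
  rw [le_div_iff₀ (by positivity)] at k7
  have e1 : Cs * (2 * t) * r ^ 2 = d / (2 * C) / 2 * rs j ^ 2 := by
    rw [ht, hr, rs_succ]; field_simp; norm_num
  have : 0 < d / (2 * C) * rs j ^ 2 := by positivity
  linarith

/-- Small energy density and small residual at a large scale force `u` to be near a well. -/
lemma exists_clearing {β : ℝ} (hβ : 0 < β) (hβ1 : β ≤ 1) : ∃ η : ℝ, 0 < η ∧ ∃ N : ℕ,
    ∀ (u : E 3 → ℝ), ContDiff ℝ 2 u → ∀ (x : E 3) (m : ℕ), N ≤ m → Dens u x m ≤ η →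
    Fn u x (rs m) ≤ η → 1 - β < |u x| := by
  obtain ⟨c, hc, hlow⟩ := exists_energy_lower
  obtain ⟨C, hC, J, hmon⟩ := exists_Dens_le
  have hl := two_le_lam
  have hrJ := rs_pos J
  set d := c * β ^ 14 / rs J ^ 2 with hd
  have hd0 : 0 < d := by positivity
  refine ⟨min 1 (d / (4 * C)), by positivity, J + 2, fun u hu x m hm hD hF => ?_⟩
  by_contra hcon
  rw [not_lt] at hcon
  have hr4 : 4 ≤ rs m := by
    calc (4 : ℝ) = 2 ^ 2 := by norm_num
      _ ≤ lam ^ 2 := by gcongr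
      _ = rs 2 := rfl
      _ ≤ rs m := rs_mono (by omega)
  have h1 : d ≤ Dens u x J := by
    unfold Dens
    rw [hd]
    gcongr
    exact (hlow u hu x ((Fn_mono hu (ball_subset_ball hr4)).trans (hF.trans (min_le_left _ _)))
      β hβ hβ1 hcon).trans (En_mono hu (ball_subset_ball (one_le_rs J)))
  have h2 := hmon u hu x J (m - J - 2) le_rfl
  rw [show J + (m - J - 2) + 2 = m by omega] at h2
  have h3 : 0 ≤ ∫ y in ball x (rs (J + (m - J - 2))), wt x (rs J) y * max (-disc u y) 0 :=
    integral_nonneg fun y => mul_nonneg (wt_pos x hrJ y).le (le_max_right _ _)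
  have h5 : C * (Dens u x m + Fn u x (rs m)) ≤ C * (d / (4 * C) + d / (4 * C)) := by
    gcongr
    · exact hD.trans (min_le_right _ _)
    · exact hF.trans (min_le_right _ _)
  have h6 : C * (d / (4 * C) + d / (4 * C)) = d / 2 := by field_simp; norm_num
  linarith

lemma gsq_neg (u : E 3 → ℝ) : gsq (fun y => -u y) = gsq u := by
  funext x; simp [gsq, pd_neg]

lemma En_neg (u : E 3 → ℝ) (p : E 3) (r : ℝ) : En (fun y => -u y) p r = En u p r := by
  unfold En eden
  rw [gsq_neg]
  simp [W]

lemma Fn_neg {u : E 3 → ℝ} (hu : ContDiff ℝ 2 u) (p : E 3) (r : ℝ) :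
    Fn (fun y => -u y) p r = Fn u p r := by
  unfold Fn
  simp [resid_neg hu]

/-- A continuous function omitting a value on a ball stays on one side. -/
lemma lt_or_gt_of_ball_ne {u : E 3 → ℝ} (hu : Continuous u) {p : E 3} {r s : ℝ}
    (h : ∀ y ∈ ball p r, u y ≠ s) : (∀ y ∈ ball p r, s < u y) ∨ ∀ y ∈ ball p r, u y < s := by
  by_contra! hcon
  obtain ⟨⟨y, hy, h1⟩, z, hz, h2⟩ := hcon
  obtain ⟨w, hw, h3⟩ := (convex_ball p r).isPreconnected.intermediate_value hy hz hu.continuousOn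
    ⟨h1, h2⟩
  exact h w hw h3

/-- The gap theorem for functions omitting a value. -/
lemma exists_gap_ne {s β : ℝ} (hs : s ∈ Ioo (-1 : ℝ) 1) (hβ : 0 < β) (hβ1 : β ≤ 1) :
    ∃ δ : ℝ, 0 < δ ∧ ∀ C₀ : ℝ, 0 ≤ C₀ → ∃ N : ℕ, ∀ (u : E 3 → ℝ), ContDiff ℝ 2 u →
    ∀ (x : E 3) (m : ℕ), N ≤ m → (∀ y ∈ ball x (rs m), u y ≠ s) → Dens u x m ≤ C₀ →
    Fn u x (rs m) ≤ δ → 1 - β < |u x| := by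
  obtain ⟨δ₁, hδ₁, h₁⟩ := exists_gap hs.1 hβ hβ1
  obtain ⟨δ₂, hδ₂, h₂⟩ := exists_gap (s := -s) (by linarith [hs.2]) hβ hβ1
  refine ⟨min δ₁ δ₂, by positivity, fun C₀ hC₀ => ?_⟩
  obtain ⟨N₁, h₁⟩ := h₁ C₀ hC₀
  obtain ⟨N₂, h₂⟩ := h₂ C₀ hC₀
  refine ⟨max N₁ N₂, fun u hu x m hm hne hD hF => ?_⟩
  rcases lt_or_gt_of_ball_ne hu.continuous hne with h | h
  · exact h₁ u hu x m (by omega) h hD (hF.trans (min_le_left _ _))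
  · rw [← abs_neg]
    refine h₂ (fun y => -u y) hu.neg x m (by omega) (fun y hy => neg_lt_neg (h y hy)) ?_ ?_
    · unfold Dens at *; rwa [En_neg]
    · rw [Fn_neg hu]; exact hF.trans (min_le_right _ _)

lemma En_le_of_abs {u : E 3 → ℝ} (hu : ContDiff ℝ 2 u) (p : E 3) {R : ℝ} (hR : 0 < R)
    (h : ∀ y ∈ ball p (2 * R), 1 / 2 < |u y|) :
    En u p R ≤ 16 * (Fn u p (2 * R) + 2 * cutConst / R ^ 2 * En u p (2 * R)) := by
  rcases lt_or_gt_of_ball_ne (s := 0) hu.continuous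
    (fun y hy h0 => by have := h y hy; rw [h0] at this; norm_num at this) with hc | hc
  · refine En_le_of_well hu p hR fun y hy => ?_
    have := h y hy
    rw [abs_of_pos (hc y hy)] at this
    exact this.le
  · rw [← En_neg u p R, ← En_neg u p (2 * R), ← Fn_neg hu]
    refine En_le_of_well hu.neg p hR fun y hy => ?_
    have := h y hy
    rw [abs_of_neg (hc y hy)] at this
    exact this.le

/-- The diffuse area in a ball. -/
def aE (ev : ℝ) (u : E 3 → ℝ) (p : E 3) (r : ℝ) : ℝ := ∫ x in ball p r, areaDensity ev u x

/-- The diffuse Willmore energy in a ball. -/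
def wE (ev : ℝ) (u : E 3 → ℝ) (p : E 3) (r : ℝ) : ℝ := (1 / ev) * ∫ x in ball p r, willDensity ev u x

lemma setIntegral_comp_add_smul (f : E 3 → ℝ) (p : E 3) {ev : ℝ} (hev : 0 < ev) (R : ℝ) :
    ∫ y in ball 0 R, f (p + ev • y) = (ev ^ 3)⁻¹ * ∫ x in ball p (ev * R), f x := by
  rw [← integral_indicator measurableSet_ball, ← integral_indicator measurableSet_ball]
  have h1 : ∀ y, (ball (0 : E 3) R).indicator (fun y => f (p + ev • y)) y
      = (fun z => (ball p (ev * R)).indicator f (p + z)) (ev • y) := by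
    intro y
    have hiff : y ∈ ball (0 : E 3) R ↔ p + ev • y ∈ ball p (ev * R) := by
      rw [mem_ball_zero_iff, mem_ball, dist_eq_norm, add_sub_cancel_left, norm_smul,
        Real.norm_of_nonneg hev.le]
      exact (mul_lt_mul_iff_right₀ hev).symm
    by_cases hy : y ∈ ball (0 : E 3) R
    · simp only [indicator_of_mem hy, indicator_of_mem (hiff.1 hy)]
    · simp only [indicator_of_notMem hy, indicator_of_notMem (fun h => hy (hiff.2 h))]
  simp_rw [h1]
  rw [Measure.integral_comp_smul (μ := volume) (fun z => (ball p (ev * R)).indicator f (p + z)) ev,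
    integral_add_left_eq_self]
  simp [abs_of_pos hev]

lemma contDiff_comp_add_smul {v : E 3 → ℝ} (hv : ContDiff ℝ 2 v) (p : E 3) (ev : ℝ) :
    ContDiff ℝ 2 fun y => v (p + ev • y) :=
  hv.comp (contDiff_const.add (contDiff_id.const_smul ev))

lemma lap_comp_add_smul {v : E 3 → ℝ} (hv : ContDiff ℝ 2 v) (p : E 3) (ev : ℝ) (y : E 3) :
    lap (fun y => v (p + ev • y)) y = ev ^ 2 * lap v (p + ev • y) := by
  rw [lap_eq (contDiff_comp_add_smul hv p ev), lap_eq hv, Finset.mul_sum]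
  refine Finset.sum_congr rfl fun i _ => ?_
  have h1 : pd i (fun y => v (p + ev • y)) = fun y => ev * pd i v (p + ev • y) := by
    funext y
    exact pd_comp_add_smul ev p y i (hv.differentiable (by norm_num) _)
  have hd : Differentiable ℝ (pd i v) := (contDiff_pd_one hv i).differentiable (by norm_num)
  have hd' : DifferentiableAt ℝ (fun y => pd i v (p + ev • y)) y :=
    hd.comp (by fun_prop : Differentiable ℝ fun y : E 3 => p + ev • y) y
  rw [h1, pd_const_mul ev hd',
    pd_comp_add_smul ev p y i (hd _)]
  ring

lemma gsq_comp_add_smul {v : E 3 → ℝ} (hv : ContDiff ℝ 2 v) (p : E 3) (ev : ℝ) (y : E 3) :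
    gsq (fun y => v (p + ev • y)) y = ev ^ 2 * gsq v (p + ev • y) := by
  unfold gsq
  rw [Finset.mul_sum]
  refine Finset.sum_congr rfl fun i _ => ?_
  rw [pd_comp_add_smul ev p y i (hv.differentiable (by norm_num) _)]
  ring

lemma En_scale {v : E 3 → ℝ} (hv : ContDiff ℝ 2 v) (p : E 3) {ev : ℝ} (hev : 0 < ev) (R : ℝ) :
    En (fun y => v (p + ev • y)) 0 R = aE ev v p (ev * R) / ev ^ 2 := by
  unfold En aE
  have : ∀ y, eden (fun y => v (p + ev • y)) y
      = (fun x => ev * areaDensity ev v x) (p + ev • y) := fun y => by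
    simp only [eden, areaDensity, gsq_comp_add_smul hv, gsq_eq_norm v]
    field_simp
  simp_rw [this]
  rw [setIntegral_comp_add_smul (fun x => ev * areaDensity ev v x) p hev R, integral_const_mul]
  field_simp

lemma Fn_scale {v : E 3 → ℝ} (hv : ContDiff ℝ 2 v) (p : E 3) {ev : ℝ} (hev : 0 < ev) (R : ℝ) :
    Fn (fun y => v (p + ev • y)) 0 R = wE ev v p (ev * R) := by
  unfold Fn wE
  have : ∀ y, resid (fun y => v (p + ev • y)) y ^ 2
      = (fun x => ev ^ 2 * willDensity ev v x) (p + ev • y) := fun y => by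
    simp only [resid, willDensity, lap_comp_add_smul hv]
    field_simp
    ring
  simp_rw [this]
  rw [setIntegral_comp_add_smul (fun x => ev ^ 2 * willDensity ev v x) p hev R, integral_const_mul]
  field_simp

lemma areaDensity_nonneg {ev : ℝ} (hev : 0 < ev) (u : E 3 → ℝ) (x : E 3) :
    0 ≤ areaDensity ev u x := by
  have := W_nonneg (u x)
  unfold areaDensity; positivity

lemma willDensity_nonneg (ev : ℝ) (u : E 3 → ℝ) (x : E 3) : 0 ≤ willDensity ev u x := sq_nonneg _

/-- A scale just below a given radius. -/
lemma exists_scale {ev r : ℝ} (hev : 0 < ev) {N : ℕ} (h : ev * rs N ≤ r) :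
    ∃ m, N ≤ m ∧ ev * rs m ≤ r ∧ r < ev * rs (m + 1) := by
  have hl := two_le_lam
  have h1 : rs N ≤ r / ev := by rw [le_div_iff₀ hev]; linarith
  obtain ⟨m, hm1, hm2⟩ := exists_nat_pow_near ((one_le_rs N).trans h1) (by linarith : 1 < lam)
  refine ⟨m, ?_, ?_, ?_⟩
  · by_contra hlt
    have : rs (m + 1) ≤ rs N := rs_mono (by omega)
    unfold rs at *
    linarith
  · rw [le_div_iff₀ hev] at hm1; unfold rs; linarith
  · rw [div_lt_iff₀ hev] at hm2; unfold rs; linarith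

lemma exists_contDiff_eqOn {Ω : Set (E 3)} (hΩ : IsOpen Ω) {u : E 3 → ℝ} (hu : ContDiffOn ℝ 2 u Ω)
    {p : E 3} {r : ℝ} (hr : 0 < r) (hb : closedBall p (2 * r) ⊆ Ω) :
    ∃ v : E 3 → ℝ, ContDiff ℝ 2 v ∧ EqOn v u (ball p r) := by
  refine ⟨fun y => cut p r y * u y, ?_, fun y hy => by simp [cut_eq_one hr hy]⟩
  rw [contDiff_iff_contDiffAt]
  intro x
  by_cases hx : x ∈ Ω
  · exact (contDiff_cut (n := 2) p r).contDiffAt.mul (hu.contDiffAt (hΩ.mem_nhds hx))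
  · have : (fun y => cut p r y * u y) =ᶠ[nhds x] fun _ => 0 := by
      filter_upwards [isClosed_closedBall.isOpen_compl.mem_nhds (fun h => hx (hb h))] with y hy
      rw [cut_eq_zero hr (fun h => hy (ball_subset_closedBall h)), zero_mul]
    exact contDiffAt_const.congr_of_eventuallyEq this

lemma areaDensity_congr {u v : E 3 → ℝ} {x : E 3} (h : v =ᶠ[nhds x] u) (ev : ℝ) :
    areaDensity ev v x = areaDensity ev u x := by
  unfold areaDensity
  rw [h.fderiv_eq, h.eq_of_nhds]

lemma willDensity_congr {u v : E 3 → ℝ} {x : E 3} (h : v =ᶠ[nhds x] u) (ev : ℝ) :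
    willDensity ev v x = willDensity ev u x := by
  unfold willDensity lap
  rw [h.fderiv.fderiv_eq, h.eq_of_nhds]

lemma continuousOn_areaDensity {Ω : Set (E 3)} (hΩ : IsOpen Ω) {u : E 3 → ℝ}
    (hu : ContDiffOn ℝ 2 u Ω) (ev : ℝ) : ContinuousOn (areaDensity ev u) Ω := by
  have h1 := hu.continuousOn_fderiv_of_isOpen hΩ (by norm_num)
  have h2 : ContinuousOn (fun x => W (u x)) Ω :=
    (contDiff_W (n := 0)).continuous.comp_continuousOn hu.continuousOn
  unfold areaDensity
  exact ((h1.norm.pow 2).const_mul _).add (h2.const_mul _)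

lemma continuousOn_willDensity {Ω : Set (E 3)} (hΩ : IsOpen Ω) {u : E 3 → ℝ}
    (hu : ContDiffOn ℝ 2 u Ω) (ev : ℝ) : ContinuousOn (willDensity ev u) Ω := by
  have h1 : ContDiffOn ℝ 1 (fderiv ℝ u) Ω := hu.fderiv_of_isOpen hΩ (by norm_num)
  have h2 := h1.continuousOn_fderiv_of_isOpen hΩ (by norm_num)
  have h3 : ContinuousOn (fun x => W' (u x)) Ω :=
    (contDiff_W' (n := 0)).continuous.comp_continuousOn hu.continuousOn
  have h4 : ContinuousOn (lap u) Ω := by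
    unfold lap
    exact continuousOn_finsetSum _ fun i _ =>
      (h2.clm_apply continuousOn_const).clm_apply continuousOn_const
  unfold willDensity
  exact ((h4.const_mul _).sub (h3.const_mul _)).pow 2

lemma setIntegral_ball_mono_of_continuousOn {Ω : Set (E 3)} {f : E 3 → ℝ} (hf : ContinuousOn f Ω)
    (h0 : ∀ x, 0 ≤ f x) {p q : E 3} {r s : ℝ} (hq : closedBall q s ⊆ Ω) (h : ball p r ⊆ ball q s) :
    ∫ x in ball p r, f x ≤ ∫ x in ball q s, f x :=
  setIntegral_mono_set ((((hf.mono hq).integrableOn_compact (isCompact_closedBall q s))).mono_set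
    ball_subset_closedBall) (ae_of_all _ h0) h.eventuallyLE

lemma aE_mono {Ω : Set (E 3)} (hΩ : IsOpen Ω) {u : E 3 → ℝ} (hu : ContDiffOn ℝ 2 u Ω) {ev : ℝ}
    (hev : 0 < ev) {p q : E 3} {r s : ℝ} (hq : closedBall q s ⊆ Ω) (h : ball p r ⊆ ball q s) :
    aE ev u p r ≤ aE ev u q s :=
  setIntegral_ball_mono_of_continuousOn (continuousOn_areaDensity hΩ hu ev)
    (areaDensity_nonneg hev u) hq h

lemma wE_mono {Ω : Set (E 3)} (hΩ : IsOpen Ω) {u : E 3 → ℝ} (hu : ContDiffOn ℝ 2 u Ω) {ev : ℝ}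
    (hev : 0 < ev) {p q : E 3} {r s : ℝ} (hq : closedBall q s ⊆ Ω) (h : ball p r ⊆ ball q s) :
    wE ev u p r ≤ wE ev u q s :=
  mul_le_mul_of_nonneg_left (setIntegral_ball_mono_of_continuousOn
    (continuousOn_willDensity hΩ hu ev) (willDensity_nonneg ev u) hq h) (by positivity)

/-- Blow-up of `u` at `p`, extended to the whole space. -/
lemma exists_blowup {Ω : Set (E 3)} (hΩ : IsOpen Ω) {u : E 3 → ℝ} (hu : ContDiffOn ℝ 2 u Ω)
    {p : E 3} {r : ℝ} (hr : 0 < r) (hb : closedBall p (2 * r) ⊆ Ω) {ev : ℝ} (hev : 0 < ev) :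
    ∃ w : E 3 → ℝ, ContDiff ℝ 2 w ∧ (∀ y ∈ ball (0 : E 3) (r / ev), w y = u (p + ev • y)
      ∧ p + ev • y ∈ ball p r) ∧
      ∀ R, ev * R ≤ r → En w 0 R = aE ev u p (ev * R) / ev ^ 2 ∧ Fn w 0 R = wE ev u p (ev * R) := by
  obtain ⟨v, hv, he⟩ := exists_contDiff_eqOn hΩ hu hr hb
  have hloc : ∀ x ∈ ball p r, v =ᶠ[nhds x] u := fun x hx =>
    he.eventuallyEq_of_mem (isOpen_ball.mem_nhds hx)
  refine ⟨fun y => v (p + ev • y), contDiff_comp_add_smul hv p ev, fun y hy => ?_, fun R hR => ?_⟩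
  · have : p + ev • y ∈ ball p r := by
      rw [mem_ball_zero_iff, lt_div_iff₀ hev] at hy
      rw [mem_ball, dist_eq_norm, add_sub_cancel_left, norm_smul, Real.norm_of_nonneg hev.le]
      linarith
    exact ⟨he this, this⟩
  · rw [En_scale hv p hev, Fn_scale hv p hev]
    constructor
    · unfold aE
      rw [setIntegral_congr_fun measurableSet_ball fun x hx =>
        areaDensity_congr (hloc x (ball_subset_ball hR hx)) ev]
    · unfold wE
      rw [setIntegral_congr_fun measurableSet_ball fun x hx =>
        willDensity_congr (hloc x (ball_subset_ball hR hx)) ev]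

lemma exists_blowup_scale {Ω : Set (E 3)} (hΩ : IsOpen Ω) {u : E 3 → ℝ} (hu : ContDiffOn ℝ 2 u Ω)
    {p : E 3} {r : ℝ} (hr : 0 < r) (hb : closedBall p (2 * r) ⊆ Ω) {ev : ℝ} (hev : 0 < ev) {N : ℕ}
    (hN : ev * rs N ≤ r) :
    ∃ w : E 3 → ℝ, ContDiff ℝ 2 w ∧ ∃ m, N ≤ m ∧ ev * rs m ≤ r ∧ r < ev * rs (m + 1) ∧ w 0 = u p ∧
      (∀ y ∈ ball (0 : E 3) (rs m), ∃ z ∈ ball p r, w y = u z) ∧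
      Dens w 0 m ≤ lam ^ 2 * (aE ev u p r / r ^ 2) ∧ Fn w 0 (rs m) ≤ wE ev u p r ∧
      ∀ j, ev * rs j ≤ r → Dens w 0 j = aE ev u p (ev * rs j) / (ev * rs j) ^ 2 := by
  obtain ⟨w, hw, hwu, hEF⟩ := exists_blowup hΩ hu hr hb hev
  obtain ⟨m, hm, h1, h2⟩ := exists_scale hev hN
  have hl := two_le_lam
  have hrm := rs_pos m
  have hDens : ∀ j, ev * rs j ≤ r → Dens w 0 j = aE ev u p (ev * rs j) / (ev * rs j) ^ 2 := by
    intro j hj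
    unfold Dens
    rw [(hEF _ hj).1, div_div, mul_pow]
  have hball : closedBall p r ⊆ Ω := (closedBall_subset_closedBall (by linarith)).trans hb
  refine ⟨w, hw, m, hm, h1, h2, ?_, ?_, ?_, ?_, hDens⟩
  · simpa using (hwu 0 (mem_ball_self (by positivity))).1
  · intro y hy
    have := hwu y (ball_subset_ball (by rw [le_div_iff₀ hev]; linarith) hy)
    exact ⟨_, this.2, this.1⟩
  · rw [hDens m h1]
    have h3 := aE_mono hΩ hu hev hball (ball_subset_ball h1)
    have h4 : 0 ≤ aE ev u p r := integral_nonneg fun x => areaDensity_nonneg hev u x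
    rw [rs_succ] at h2
    have h5 : (r / lam) ^ 2 ≤ (ev * rs m) ^ 2 := by
      gcongr
      rw [div_le_iff₀ (by linarith)]
      linarith
    calc aE ev u p (ev * rs m) / (ev * rs m) ^ 2 ≤ aE ev u p r / (r / lam) ^ 2 := by gcongr
      _ = _ := by field_simp
  · rw [(hEF _ h1).2]
    exact wE_mono hΩ hu hev hball (ball_subset_ball h1)

lemma exists_clearing_scaled {β : ℝ} (hβ : 0 < β) (hβ1 : β ≤ 1) : ∃ η : ℝ, 0 < η ∧ ∀ r, 0 < r →
    ∃ ε₁ : ℝ, 0 < ε₁ ∧ ∀ (Ω : Set (E 3)), IsOpen Ω → ∀ u, ContDiffOn ℝ 2 u Ω → ∀ p,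
    closedBall p (2 * r) ⊆ Ω → ∀ ev, 0 < ev → ev < ε₁ → aE ev u p r ≤ η * r ^ 2 →
    wE ev u p r ≤ η → 1 - β < |u p| := by
  obtain ⟨η, hη, N, h⟩ := exists_clearing hβ hβ1
  have hl := two_le_lam
  have hl2 : 1 ≤ lam ^ 2 := one_le_pow₀ (by linarith)
  refine ⟨η / lam ^ 2, by positivity, fun r hr => ⟨r / rs N, div_pos hr (rs_pos N), ?_⟩⟩
  intro Ω hΩ u hu p hb ev hev hev1 ha hw
  rw [lt_div_iff₀ (rs_pos N)] at hev1
  obtain ⟨w, hwc, m, hm, -, -, h0, -, hD, hF, -⟩ := exists_blowup_scale hΩ hu hr hb hev hev1.le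
  rw [← h0]
  refine h w hwc 0 m hm (hD.trans ?_) (hF.trans (hw.trans (div_le_self hη.le hl2)))
  rw [← div_le_iff₀ (by positivity)] at ha
  calc _ ≤ lam ^ 2 * (η / lam ^ 2) := by gcongr
    _ = η := by field_simp

lemma exists_gap_scaled {s β : ℝ} (hs : s ∈ Ioo (-1 : ℝ) 1) (hβ : 0 < β) (hβ1 : β ≤ 1) :
    ∃ δ : ℝ, 0 < δ ∧ ∀ r, 0 < r → ∀ C₀ : ℝ, 0 ≤ C₀ →
    ∃ ε₁ : ℝ, 0 < ε₁ ∧ ∀ (Ω : Set (E 3)), IsOpen Ω → ∀ u, ContDiffOn ℝ 2 u Ω → ∀ p,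
    closedBall p (2 * r) ⊆ Ω → ∀ ev, 0 < ev → ev < ε₁ → (∀ y ∈ ball p r, u y ≠ s) →
    aE ev u p r ≤ C₀ → wE ev u p r ≤ δ → 1 - β < |u p| := by
  obtain ⟨δ, hδ, h⟩ := exists_gap_ne hs hβ hβ1
  refine ⟨δ, hδ, fun r hr C₀ hC₀ => ?_⟩
  obtain ⟨N, h⟩ := h (lam ^ 2 * (C₀ / r ^ 2)) (by positivity)
  refine ⟨r / rs N, div_pos hr (rs_pos N), ?_⟩
  intro Ω hΩ u hu p hb ev hev hev1 hne ha hw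
  rw [lt_div_iff₀ (rs_pos N)] at hev1
  obtain ⟨w, hwc, m, hm, -, -, h0, hy, hD, hF, -⟩ := exists_blowup_scale hΩ hu hr hb hev hev1.le
  rw [← h0]
  refine h w hwc 0 m hm (fun y hym => ?_) (hD.trans (by gcongr)) (hF.trans hw)
  obtain ⟨z, hz, e⟩ := hy y hym
  rw [e]
  exact hne z hz

lemma aE_decay {Ω : Set (E 3)} (hΩ : IsOpen Ω) {u : E 3 → ℝ} (hu : ContDiffOn ℝ 2 u Ω)
    {p : E 3} {r : ℝ} (hr : 0 < r) (hb : closedBall p (4 * r) ⊆ Ω) {ev : ℝ} (hev : 0 < ev)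
    (h : ∀ y ∈ ball p (2 * r), 1 / 2 < |u y|) :
    aE ev u p r ≤ 16 * ev ^ 2 * (wE ev u p (2 * r) + 2 * cutConst / r ^ 2 * aE ev u p (2 * r)) := by
  obtain ⟨w, hw, hwu, hEF⟩ := exists_blowup hΩ hu (r := 2 * r) (by linarith)
    (by rwa [← mul_assoc, show (2 : ℝ) * 2 = 4 by norm_num]) hev
  have key := En_le_of_abs hw 0 (R := r / ev) (by positivity) fun y hy => by
    have := hwu y (by rwa [mul_div_assoc])
    rw [this.1]
    exact h _ this.2
  have e1 : ev * (r / ev) = r := by field_simp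
  have e2 : ev * (2 * (r / ev)) = 2 * r := by field_simp
  rw [(hEF (r / ev) (by rw [e1]; linarith)).1, (hEF (2 * (r / ev)) (by rw [e2])).1,
    (hEF (2 * (r / ev)) (by rw [e2])).2, e1, e2, div_le_iff₀ (by positivity)] at key
  refine key.trans (le_of_eq ?_)
  field_simp

lemma exists_density_scaled : ∃ C : ℝ, 1 ≤ C ∧ ∀ r, 0 < r → ∃ ε₁ : ℝ, 0 < ε₁ ∧
    ∀ (Ω : Set (E 3)), IsOpen Ω → ∀ u, ContDiffOn ℝ 2 u Ω → ∀ p R, lam ^ 4 * r ≤ R →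
    closedBall p (2 * R) ⊆ Ω → ∀ ev, 0 < ev → ev < ε₁ →
    aE ev u p r ≤ C * r ^ 2 * (aE ev u p R / R ^ 2 + wE ev u p R) := by
  obtain ⟨C, hC, J, hmon⟩ := exists_Dens_le
  have hl := two_le_lam
  have hl4 : 1 ≤ lam ^ 4 := one_le_pow₀ (by linarith)
  refine ⟨C * lam ^ 4, by nlinarith, fun r hr => ⟨r / rs J, div_pos hr (rs_pos J), ?_⟩⟩
  intro Ω hΩ u hu p R hrR hb ev hev hev1
  rw [lt_div_iff₀ (rs_pos J)] at hev1
  have hrR' : r ≤ R := by nlinarith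
  have hR : 0 < R := by linarith
  obtain ⟨i, hi, hi1, hi2⟩ := exists_scale hev hev1.le
  obtain ⟨w, hw, m, hm, hm1, hm2, -, -, hD, hF, hDj⟩ :=
    exists_blowup_scale hΩ hu hR hb hev (hev1.le.trans hrR')
  have him : i + 4 < m + 1 := by
    by_contra hcon
    have h1 : rs (m + 1) ≤ rs (i + 4) := rs_mono (by omega)
    have h2 : rs (i + 4) = lam ^ 4 * rs i := by unfold rs; ring
    have h3 : ev * rs (m + 1) ≤ lam ^ 4 * (ev * rs i) := by
      calc _ ≤ ev * (lam ^ 4 * rs i) := by rw [← h2]; gcongr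
        _ = _ := by ring
    have h4 : lam ^ 4 * (ev * rs i) ≤ lam ^ 4 * r := by gcongr
    linarith
  have h1 := hmon w hw 0 (i + 1) (m - i - 3) (by omega)
  rw [show i + 1 + (m - i - 3) + 2 = m by omega] at h1
  have h3 : 0 ≤ ∫ y in ball 0 (rs (i + 1 + (m - i - 3))),
      wt 0 (rs (i + 1)) y * max (-disc w y) 0 :=
    integral_nonneg fun y => mul_nonneg (wt_pos 0 (rs_pos _) y).le (le_max_right _ _)
  have hiR : ev * rs (i + 1) ≤ R :=
    le_trans (mul_le_mul_of_nonneg_left (rs_mono (by omega)) hev.le) hm1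
  have hball : ∀ t, t ≤ R → closedBall p t ⊆ Ω := fun t ht =>
    (closedBall_subset_closedBall (by linarith)).trans hb
  have h4 : aE ev u p r ≤ Dens w 0 (i + 1) * (ev * rs (i + 1)) ^ 2 := by
    have := rs_pos (i + 1)
    rw [hDj _ hiR, div_mul_cancel₀ _ (by positivity)]
    exact aE_mono hΩ hu hev (hball _ hiR) (ball_subset_ball hi2.le)
  have h5 : (ev * rs (i + 1)) ^ 2 ≤ lam ^ 2 * r ^ 2 := by
    rw [rs_succ, ← mul_pow]
    have := rs_pos i
    have h7 : ev * (lam * rs i) ≤ lam * r := by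
      have : lam * (ev * rs i) ≤ lam * r := mul_le_mul_of_nonneg_left hi1 (by linarith)
      linarith
    exact pow_le_pow_left₀ (by positivity) h7 2
  have ha0 : 0 ≤ aE ev u p R := integral_nonneg fun x => areaDensity_nonneg hev u x
  have hw0 : 0 ≤ wE ev u p R :=
    mul_nonneg (by positivity) (integral_nonneg fun x => willDensity_nonneg ev u x)
  have hl2 : 1 ≤ lam ^ 2 := one_le_pow₀ (by linarith)
  have h6 : Dens w 0 (i + 1) ≤ C * (lam ^ 2 * (aE ev u p R / R ^ 2 + wE ev u p R)) := by
    calc _ ≤ C * (Dens w 0 m + Fn w 0 (rs m)) := by linarith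
      _ ≤ C * (lam ^ 2 * (aE ev u p R / R ^ 2) + lam ^ 2 * wE ev u p R) := by
          gcongr
          exact hF.trans (le_mul_of_one_le_left hw0 hl2)
      _ = _ := by ring
  calc _ ≤ _ := h4
    _ ≤ C * (lam ^ 2 * (aE ev u p R / R ^ 2 + wE ev u p R)) * (lam ^ 2 * r ^ 2) := by gcongr
    _ = _ := by ring

lemma c0_pos : 0 < c0 := by unfold c0; positivity

/-- The cut-off function as a bounded continuous function. -/
def cutB (p : E 3) (r : ℝ) : BoundedContinuousFunction (E 3) ℝ :=
  BoundedContinuousFunction.ofNormedAddCommGroup (cut p r) (contDiff_cut_one p r).continuous 1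
    fun x => by rw [Real.norm_of_nonneg (cut_nonneg p r x)]; exact cut_le_one p r x

lemma cutB_apply (p : E 3) (r : ℝ) (x : E 3) : cutB p r x = cut p r x := rfl

lemma setIntegral_cut_mul_eq {Ω : Set (E 3)} (hΩ : IsOpen Ω) (f : E 3 → ℝ)
    {p : E 3} {r : ℝ} (hr : 0 < r) (hb : closedBall p (2 * r) ⊆ Ω) :
    ∫ x in Ω, cut p r x * f x = ∫ x in ball p (2 * r), cut p r x * f x :=
  setIntegral_eq_of_subset_of_forall_sdiff_eq_zero hΩ.measurableSet
    (ball_subset_closedBall.trans hb) fun x hx => by rw [cut_eq_zero hr hx.2, zero_mul]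

lemma setIntegral_ball_le_cut {Ω : Set (E 3)} (hΩ : IsOpen Ω) {f : E 3 → ℝ} (hf : ContinuousOn f Ω)
    (h0 : ∀ x, 0 ≤ f x) {p : E 3} {r : ℝ} (hr : 0 < r) (hb : closedBall p (2 * r) ⊆ Ω) :
    ∫ x in ball p r, f x ≤ ∫ x in Ω, cut p r x * f x := by
  rw [setIntegral_cut_mul_eq hΩ f hr hb]
  calc ∫ x in ball p r, f x = ∫ x in ball p r, cut p r x * f x :=
        setIntegral_congr_fun measurableSet_ball fun x hx => by simp [cut_eq_one hr hx]
    _ ≤ _ := setIntegral_ball_mono_of_continuousOn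
        ((contDiff_cut_one p r).continuous.continuousOn.mul hf)
        (fun x => mul_nonneg (cut_nonneg p r x) (h0 x)) hb (ball_subset_ball (by linarith))

lemma setIntegral_cut_le_ball {Ω : Set (E 3)} (hΩ : IsOpen Ω) {f : E 3 → ℝ} (hf : ContinuousOn f Ω)
    (h0 : ∀ x, 0 ≤ f x) {p : E 3} {r : ℝ} (hr : 0 < r) (hb : closedBall p (2 * r) ⊆ Ω) :
    ∫ x in Ω, cut p r x * f x ≤ ∫ x in ball p (2 * r), f x := by
  rw [setIntegral_cut_mul_eq hΩ f hr hb]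
  have hi : ∀ g : E 3 → ℝ, ContinuousOn g Ω → IntegrableOn g (ball p (2 * r)) := fun g hg =>
    ((hg.mono hb).integrableOn_compact (isCompact_closedBall p (2 * r))).mono_set
      ball_subset_closedBall
  refine setIntegral_mono_on (hi _ ((contDiff_cut_one p r).continuous.continuousOn.mul hf))
    (hi _ hf) measurableSet_ball fun x _ => ?_
  exact mul_le_of_le_one_left (h0 x) (cut_le_one p r x)

lemma integrable_cut (ν : Measure (E 3)) [IsFiniteMeasure ν] (p : E 3) (r : ℝ) :
    Integrable (cut p r) ν := (cutB p r).integrable ν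

lemma integral_cut_le (ν : Measure (E 3)) [IsFiniteMeasure ν] (p : E 3) {r : ℝ} (hr : 0 < r) :
    ∫ x, cut p r x ∂ν ≤ ν.real (ball p (2 * r)) := by
  rw [← integral_indicator_one measurableSet_ball]
  refine integral_mono (integrable_cut ν p r)
    ((integrable_const (1 : ℝ)).indicator measurableSet_ball) fun x => ?_
  by_cases hx : x ∈ ball p (2 * r)
  · simp [indicator_of_mem hx, cut_le_one]
  · rw [indicator_of_notMem hx, cut_eq_zero hr hx]

lemma le_integral_cut (ν : Measure (E 3)) [IsFiniteMeasure ν] (p : E 3) {r : ℝ} (hr : 0 < r) :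
    ν.real (ball p r) ≤ ∫ x, cut p r x ∂ν := by
  rw [← integral_indicator_one measurableSet_ball]
  refine integral_mono ((integrable_const (1 : ℝ)).indicator measurableSet_ball)
    (integrable_cut ν p r) fun x => ?_
  by_cases hx : x ∈ ball p r
  · simp [indicator_of_mem hx, cut_eq_one hr hx]
  · rw [indicator_of_notMem hx]; exact cut_nonneg p r x

/-- A sequence of phase fields with converging energy measures. -/
structure PhaseSeq (Ω : Set (E 3)) (ε : ℕ → ℝ) (u : ℕ → E 3 → ℝ) (μ α : Measure (E 3)) : Prop where
  isOpen : IsOpen Ω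
  pos : ∀ k, 0 < ε k
  lim : Tendsto ε atTop (nhds 0)
  diff : ∀ k, ContDiffOn ℝ 2 (u k) Ω
  area : weakConvA Ω ε u μ
  will : weakConvW Ω ε u α

namespace PhaseSeq

variable {Ω : Set (E 3)} {ε : ℕ → ℝ} {u : ℕ → E 3 → ℝ} {μ α : Measure (E 3)}

lemma comp (S : PhaseSeq Ω ε u μ α) {φ : ℕ → ℕ} (hφ : StrictMono φ) :
    PhaseSeq Ω (ε ∘ φ) (u ∘ φ) μ α where
  isOpen := S.isOpen
  pos _ := S.pos _
  lim := S.lim.comp hφ.tendsto_atTop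
  diff _ := S.diff _
  area f := (S.area f).comp hφ.tendsto_atTop
  will f := (S.will f).comp hφ.tendsto_atTop

lemma eventually_aE_lt [IsFiniteMeasure μ] (S : PhaseSeq Ω ε u μ α) {p : E 3} {r t : ℝ} (hr : 0 < r)
    (hb : closedBall p (2 * r) ⊆ Ω) (ht : μ.real (ball p (2 * r)) < t) :
    ∀ᶠ k in atTop, aE (ε k) (u k) p r < c0 * t := by
  have h1 := S.area (cutB p r)
  simp only [cutB_apply] at h1
  filter_upwards [h1.eventually_lt_const ((integral_cut_le μ p hr).trans_lt ht)] with k hk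
  have h2 := setIntegral_ball_le_cut S.isOpen (continuousOn_areaDensity S.isOpen (S.diff k) (ε k))
    (areaDensity_nonneg (S.pos k) (u k)) hr hb
  rw [one_div, inv_mul_lt_iff₀ c0_pos] at hk
  exact h2.trans_lt hk

lemma eventually_wE_lt [IsFiniteMeasure α] (S : PhaseSeq Ω ε u μ α) {p : E 3} {r t : ℝ} (hr : 0 < r)
    (hb : closedBall p (2 * r) ⊆ Ω) (ht : α.real (ball p (2 * r)) < t) :
    ∀ᶠ k in atTop, wE (ε k) (u k) p r < c0 * t := by
  have h1 := S.will (cutB p r)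
  simp only [cutB_apply] at h1
  filter_upwards [h1.eventually_lt_const ((integral_cut_le α p hr).trans_lt ht)] with k hk
  have h2 := setIntegral_ball_le_cut S.isOpen (continuousOn_willDensity S.isOpen (S.diff k) (ε k))
    (willDensity_nonneg (ε k) (u k)) hr hb
  have hk0 := S.pos k
  have hc := c0_pos
  unfold wE
  calc _ ≤ 1 / ε k * ∫ x in Ω, cut p r x * willDensity (ε k) (u k) x := by gcongr
    _ = c0 * (1 / (c0 * ε k) * ∫ x in Ω, cut p r x * willDensity (ε k) (u k) x) := by field_simp
    _ < _ := by gcongr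

lemma real_ball_le [IsFiniteMeasure μ] (S : PhaseSeq Ω ε u μ α) {p : E 3} {r t : ℝ} (hr : 0 < r)
    (hb : closedBall p (2 * r) ⊆ Ω) (h : ∃ᶠ k in atTop, aE (ε k) (u k) p (2 * r) ≤ t) :
    μ.real (ball p r) ≤ t / c0 := by
  have h1 := S.area (cutB p r)
  simp only [cutB_apply] at h1
  refine (le_integral_cut μ p hr).trans (le_of_tendsto_of_frequently h1 (h.mono fun k hk => ?_))
  have h2 := setIntegral_cut_le_ball S.isOpen (continuousOn_areaDensity S.isOpen (S.diff k) (ε k))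
    (areaDensity_nonneg (S.pos k) (u k)) hr hb
  rw [one_div, inv_mul_eq_div]
  exact div_le_div_of_nonneg_right (h2.trans hk) c0_pos.le

end PhaseSeq

lemma exists_small_closedBall (ν : Measure (E 3)) [IsFiniteMeasure ν] {x : E 3} {t : ℝ}
    (h : ν.real {x} < t) : ∃ r > 0, ∀ s ≤ r, ν.real (ball x s) < t := by
  have h1 := tendsto_measure_cthickening_of_isClosed (μ := ν) (s := {x})
    ⟨1, one_pos, measure_ne_top _ _⟩ isClosed_singleton
  have h2 := (ENNReal.tendsto_toReal (measure_ne_top ν {x})).comp h1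
  have h3 := h2.eventually_lt_const h
  obtain ⟨r, hr, hlt⟩ := Metric.eventually_nhds_iff.1 h3
  refine ⟨r / 2, by positivity, fun s hs => lt_of_le_of_lt ?_ (hlt (y := r / 2) ?_)⟩
  · refine measureReal_mono ?_ (measure_ne_top _ _)
    rw [cthickening_singleton _ (by positivity)]
    exact ball_subset_closedBall.trans (closedBall_subset_closedBall hs)
  · rw [Real.dist_eq, sub_zero, abs_of_pos (by positivity)]; linarith

lemma exists_closedBall_subset {Ω : Set (E 3)} (hΩ : IsOpen Ω) {x : E 3} (hx : x ∈ Ω) :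
    ∃ r > 0, closedBall x r ⊆ Ω := nhds_basis_closedBall.mem_iff.1 (hΩ.mem_nhds hx)

namespace PhaseSeq

variable {Ω : Set (E 3)} {ε : ℕ → ℝ} {u : ℕ → E 3 → ℝ} {μ α : Measure (E 3)}

/-- Points off the support at which transition layers accumulate carry residual mass. -/
lemma exists_le_real_singleton [IsFiniteMeasure μ] [IsFiniteMeasure α] (S : PhaseSeq Ω ε u μ α)
    {β : ℝ} (hβ : 0 < β) (hβ1 : β ≤ 1) : ∃ η : ℝ, 0 < η ∧ ∀ x ∈ Ω, x ∉ sptM μ →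
      (∀ δ > 0, ∃ᶠ k in atTop, ∃ y ∈ ball x δ, |u k y| ≤ 1 - β) → η ≤ α.real {x} := by
  obtain ⟨η, hη, hclear⟩ := exists_clearing_scaled hβ hβ1
  have hc := c0_pos
  refine ⟨η / c0, by positivity, fun x hx hxs hfr => ?_⟩
  by_contra! hlt
  obtain ⟨r₁, hr₁, h₁⟩ := exists_small_closedBall α hlt
  obtain ⟨r₂, hr₂, h₂⟩ := exists_closedBall_subset S.isOpen hx
  obtain ⟨r₃, hr₃, h₃⟩ : ∃ r > 0, μ (ball x r) = 0 := by
    simpa [sptM] using hxs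
  set r := min r₁ (min r₂ r₃) / 4 with hr
  have hr0 : 0 < r := by positivity
  have hra : 4 * r ≤ r₁ := by rw [hr]; linarith [min_le_left r₁ (min r₂ r₃)]
  have hrb : 4 * r ≤ r₂ := by
    rw [hr]; linarith [min_le_right r₁ (min r₂ r₃), min_le_left r₂ r₃]
  have hrc : 4 * r ≤ r₃ := by
    rw [hr]; linarith [min_le_right r₁ (min r₂ r₃), min_le_right r₂ r₃]
  have hb : closedBall x (2 * (2 * r)) ⊆ Ω :=
    (closedBall_subset_closedBall (by linarith)).trans h₂
  have hb2 : closedBall x (2 * r) ⊆ Ω := (closedBall_subset_closedBall (by linarith)).trans hb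
  have hμ0 : μ.real (ball x (2 * (2 * r))) = 0 := by
    rw [measureReal_eq_zero_iff]
    exact measure_mono_null (ball_subset_ball (by linarith)) h₃
  have e1 := S.eventually_aE_lt (p := x) (r := 2 * r) (t := η * r ^ 2 / c0) (by positivity) hb
    (by rw [hμ0]; positivity)
  have e2 := S.eventually_wE_lt (p := x) (r := 2 * r) (t := η / c0) (by positivity) hb
    (h₁ _ (by linarith))
  obtain ⟨ε₁, hε₁, hclear⟩ := hclear r hr0
  have e3 := S.lim.eventually_lt_const hε₁
  obtain ⟨k, ⟨y, hy, hyu⟩, k1, k2, k3⟩ := ((hfr r hr0).and_eventually (e1.and (e2.and e3))).exists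
  rw [mul_div_cancel₀ _ hc.ne'] at k1 k2
  rw [mem_ball] at hy
  have hyb : ball y r ⊆ ball x (2 * r) := ball_subset_ball' (by linarith)
  have := hclear Ω S.isOpen (u k) (S.diff k) y
    ((closedBall_subset_closedBall' (by linarith)).trans hb) (ε k) (S.pos k) k3
    ((aE_mono S.isOpen (S.diff k) (S.pos k) hb2 hyb).trans k1.le)
    ((wE_mono S.isOpen (S.diff k) (S.pos k) hb2 hyb).trans k2.le)
  linarith

/-- If a value is omitted near a point of small residual mass, the area measure vanishes there. -/
lemma exists_real_ball_eq_zero [IsFiniteMeasure μ] [IsFiniteMeasure α] (S : PhaseSeq Ω ε u μ α)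
    {s : ℝ} (hs : s ∈ Ioo (-1 : ℝ) 1) : ∃ δ : ℝ, 0 < δ ∧ ∀ q r, 0 < r → closedBall q (8 * r) ⊆ Ω →
      (∃ᶠ k in atTop, ∀ y ∈ ball q (4 * r), u k y ≠ s) → α.real (ball q (8 * r)) < δ →
      μ (ball q (r / 2)) = 0 := by
  obtain ⟨δ, hδ, hgap⟩ := exists_gap_scaled hs (β := 1 / 2) (by norm_num) (by norm_num)
  have hc := c0_pos
  refine ⟨δ / c0, by positivity, fun q r hr hb hne hα => ?_⟩
  have hb' : ∀ t, t ≤ 8 * r → closedBall q t ⊆ Ω := fun t ht =>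
    (closedBall_subset_closedBall ht).trans hb
  set C₀ := c0 * (μ.real univ + 1) with hC₀
  have hC₀0 : 0 ≤ C₀ := by positivity
  have e0 : 2 * (4 * r) = 8 * r := by ring
  have hμu : μ.real (ball q (2 * (4 * r))) ≤ μ.real univ :=
    measureReal_mono (subset_univ _) (measure_ne_top μ _)
  have e1 := S.eventually_aE_lt (p := q) (r := 4 * r) (t := μ.real univ + 1) (by positivity)
    (by rwa [e0]) (by linarith)
  have e2 := S.eventually_wE_lt (p := q) (r := 4 * r) (t := δ / c0) (by positivity)
    (by rwa [e0]) (by rwa [e0])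
  obtain ⟨ε₁, hε₁, hgap⟩ := hgap r hr C₀ hC₀0
  have e3 := S.lim.eventually_lt_const hε₁
  have hL := one_le_cutConst
  set M := 16 * (δ + 2 * cutConst / r ^ 2 * C₀) with hM
  have hM0 : 0 < M := by positivity
  have hfr : ∃ᶠ k in atTop, aE (ε k) (u k) q r ≤ M * ε k ^ 2 := by
    refine (hne.and_eventually (e1.and (e2.and e3))).mono fun k ⟨hk, k1, k2, k3⟩ => ?_
    rw [mul_div_cancel₀ _ hc.ne'] at k2
    have hpos := S.pos k
    have hfar : ∀ y ∈ ball q (2 * r), 1 / 2 < |u k y| := by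
      intro y hy
      rw [mem_ball] at hy
      have hyb : ball y r ⊆ ball q (4 * r) := ball_subset_ball' (by linarith)
      have := hgap Ω S.isOpen (u k) (S.diff k) y
        ((closedBall_subset_closedBall' (by linarith)).trans hb) (ε k) hpos k3
        (fun z hz => hk z (hyb hz))
        ((aE_mono S.isOpen (S.diff k) hpos (hb' _ (by linarith)) hyb).trans k1.le)
        ((wE_mono S.isOpen (S.diff k) hpos (hb' _ (by linarith)) hyb).trans k2.le)
      linarith
    have h1 := aE_decay S.isOpen (S.diff k) hr (hb' _ (by linarith)) hpos hfar
    have hsub : ball q (2 * r) ⊆ ball q (4 * r) := ball_subset_ball (by linarith)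
    have h2 := (aE_mono S.isOpen (S.diff k) hpos (hb' _ (by linarith)) hsub).trans k1.le
    have h3 := (wE_mono S.isOpen (S.diff k) hpos (hb' _ (by linarith)) hsub).trans k2.le
    calc _ ≤ _ := h1
      _ ≤ 16 * ε k ^ 2 * (δ + 2 * cutConst / r ^ 2 * C₀) := by gcongr
      _ = _ := by rw [hM]; ring
  have hlim : Tendsto (fun k => M * ε k ^ 2) atTop (nhds 0) := by
    simpa using (S.lim.pow 2).const_mul M
  have hle : ∀ t, 0 < t → μ.real (ball q (r / 2)) ≤ 0 + t := by
    intro t ht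
    have h1 := hlim.eventually_lt_const (show 0 < t * c0 by positivity)
    have h2 := S.real_ball_le (p := q) (r := r / 2) (t := t * c0) (by positivity)
      (hb' _ (by linarith)) (by
        rw [show 2 * (r / 2) = r by ring]
        exact (hfr.and_eventually h1).mono fun k hk => hk.1.trans hk.2.le)
    rwa [mul_div_cancel_right₀ _ hc.ne', ← zero_add t] at h2
  have := le_antisymm (le_of_forall_pos_le_add hle) measureReal_nonneg
  rwa [measureReal_eq_zero_iff] at this

lemma measure_singleton_eq_zero [IsFiniteMeasure μ] [IsFiniteMeasure α] (S : PhaseSeq Ω ε u μ α)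
    {p : E 3} (hp : p ∈ Ω) : μ {p} = 0 := by
  obtain ⟨C, hC, hdens⟩ := exists_density_scaled
  obtain ⟨R', hR', hb⟩ := exists_closedBall_subset S.isOpen hp
  set R := R' / 2 with hR
  have hR0 : 0 < R := by positivity
  have hbR : closedBall p (2 * R) ⊆ Ω := by rwa [hR, mul_div_cancel₀ _ (by norm_num)]
  have hc := c0_pos
  have hl := two_le_lam
  have e1 := S.eventually_aE_lt (p := p) (r := R) (t := μ.real univ + 1) hR0 hbR
    (by linarith [measureReal_mono (subset_univ (ball p (2 * R))) (measure_ne_top μ _)])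
  have e2 := S.eventually_wE_lt (p := p) (r := R) (t := α.real univ + 1) hR0 hbR
    (by linarith [measureReal_mono (subset_univ (ball p (2 * R))) (measure_ne_top α _)])
  set M := C * (c0 * (μ.real univ + 1) / R ^ 2 + c0 * (α.real univ + 1)) with hM
  have hM0 : 0 ≤ M := by positivity
  have key : ∀ r, 0 < r → lam ^ 4 * r ≤ R → μ.real {p} ≤ M * r ^ 2 / c0 := by
    intro r hr hrR
    have hrR' : r ≤ R := by
      have : 1 ≤ lam ^ 4 := one_le_pow₀ (by linarith)
      nlinarith
    obtain ⟨ε₁, hε₁, hdens⟩ := hdens r hr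
    have e3 := S.lim.eventually_lt_const hε₁
    have h1 := S.real_ball_le (p := p) (r := r / 2) (t := M * r ^ 2) (by positivity)
      ((closedBall_subset_closedBall (by linarith)).trans hbR) (by
        rw [show 2 * (r / 2) = r by ring]
        refine (e1.and (e2.and e3)).frequently.mono fun k ⟨k1, k2, k3⟩ => ?_
        refine (hdens Ω S.isOpen (u k) (S.diff k) p R hrR hbR (ε k) (S.pos k) k3).trans ?_
        calc _ ≤ C * r ^ 2 * (c0 * (μ.real univ + 1) / R ^ 2 + c0 * (α.real univ + 1)) := by gcongr
          _ = _ := by rw [hM]; ring)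
    exact (measureReal_mono (singleton_subset_iff.2 (mem_ball_self (by positivity)))
      (measure_ne_top μ _)).trans h1
  have hlim : Tendsto (fun r : ℝ => M * r ^ 2 / c0) (nhdsWithin 0 (Ioi 0)) (nhds 0) := by
    have : Tendsto (fun r : ℝ => M * r ^ 2 / c0) (nhds 0) (nhds (M * 0 ^ 2 / c0)) :=
      Continuous.tendsto (by fun_prop) 0
    simp only [ne_eq, OfNat.ofNat_ne_zero, not_false_eq_true, zero_pow, mul_zero, zero_div] at this
    exact this.mono_left nhdsWithin_le_nhds
  have hle : μ.real {p} ≤ 0 := by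
    refine ge_of_tendsto hlim ?_
    filter_upwards [Ioo_mem_nhdsGT (show (0 : ℝ) < R / lam ^ 4 by positivity)] with r hr
    refine key r hr.1 ?_
    have := hr.2.le
    rw [le_div_iff₀ (by positivity)] at this
    linarith
  have := le_antisymm hle measureReal_nonneg
  rwa [measureReal_eq_zero_iff] at this

/-- A value omitted near a point of `Ω` forces the point off the support. -/
lemma notMem_sptM [IsFiniteMeasure μ] [IsFiniteMeasure α] (S : PhaseSeq Ω ε u μ α)
    {s : ℝ} (hs : s ∈ Ioo (-1 : ℝ) 1) {p : E 3} (hp : p ∈ Ω) {r₀ : ℝ} (hr₀ : 0 < r₀)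
    (hne : ∃ᶠ k in atTop, ∀ y ∈ ball p r₀, y ∈ Ω → u k y ≠ s) : p ∉ sptM μ := by
  obtain ⟨δ, hδ, hzero⟩ := S.exists_real_ball_eq_zero hs
  obtain ⟨r₁, hr₁, h₁⟩ := exists_small_closedBall α (x := p) (t := α.real {p} + δ) (by linarith)
  obtain ⟨r₂, hr₂, h₂⟩ := exists_closedBall_subset S.isOpen hp
  set r := min r₀ (min r₁ r₂) with hr
  have hr0 : 0 < r := by positivity
  have hra : r ≤ r₀ := min_le_left _ _
  have hrb : r ≤ r₁ := (min_le_right _ _).trans (min_le_left _ _)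
  have hrc : r ≤ r₂ := (min_le_right _ _).trans (min_le_right _ _)
  have hsub : ball p r ⊆ Ω :=
    ball_subset_closedBall.trans ((closedBall_subset_closedBall hrc).trans h₂)
  have hα : α.real (ball p r \ {p}) < δ := by
    rw [measureReal_sdiff (singleton_subset_iff.2 (mem_ball_self hr0)) (measurableSet_singleton p)]
    linarith [h₁ r hrb]
  have hnull : μ (ball p r \ {p}) = 0 := by
    refine measure_null_of_locally_null _ fun q hq => ?_
    have hd : 0 < dist q p := dist_pos.2 hq.2
    have hd2 : dist q p < r := hq.1
    set t := min (dist q p) (r - dist q p) / 9 with ht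
    have ht0 : 0 < t := by have := sub_pos.2 hd2; positivity
    have ht1 : 9 * t ≤ dist q p := by
      rw [ht]; linarith [min_le_left (dist q p) (r - dist q p)]
    have ht2 : 9 * t ≤ r - dist q p := by
      rw [ht]; linarith [min_le_right (dist q p) (r - dist q p)]
    have hin : closedBall q (8 * t) ⊆ ball p r := closedBall_subset_ball' (by linarith)
    refine ⟨ball q (t / 2), mem_nhdsWithin_of_mem_nhds (ball_mem_nhds q (by positivity)),
      hzero q t ht0 (hin.trans hsub) ?_ ?_⟩
    · refine hne.mono fun k hk y hy => ?_
      have : y ∈ ball p r := hin ((ball_subset_ball (by linarith)).trans ball_subset_closedBall hy)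
      exact hk y (ball_subset_ball hra this) (hsub this)
    · refine lt_of_le_of_lt (measureReal_mono ?_ (measure_ne_top _ _)) hα
      intro y hy
      refine ⟨hin (ball_subset_closedBall hy), fun h => ?_⟩
      rw [mem_singleton_iff] at h
      rw [h, mem_ball, dist_comm] at hy
      linarith
  intro hspt
  have h3 := hspt r hr0
  have h4 : μ (ball p r) ≤ μ (ball p r \ {p}) + μ {p} := by
    refine (measure_mono fun y hy => ?_).trans (measure_union_le _ _)
    by_cases h : y = p
    · exact Or.inr h
    · exact Or.inl ⟨hy, h⟩
  rw [hnull, S.measure_singleton_eq_zero hp, add_zero] at h4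
  exact absurd h3 (not_lt.2 h4)

end PhaseSeq

/-- Blaschke selection inside a fixed compact set. -/
lemma exists_subseq_hausdorffDist_tendsto {X : Type*} [MetricSpace X] {C : Set X}
    (hC : IsCompact C) (A : ℕ → Set X) (hAC : ∀ k, A k ⊆ C) (hA : ∀ k, (A k).Nonempty) :
    ∃ φ : ℕ → ℕ, StrictMono φ ∧ ∃ K : Set X, IsCompact K ∧ K.Nonempty ∧ K ⊆ C ∧
      Tendsto (fun j => hausdorffDist (closure (A (φ j))) K) atTop (nhds 0) := by
  have : CompactSpace C := isCompact_iff_compactSpace.1 hC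
  have hcl : ∀ k, closure (A k) ⊆ C := fun k => closure_minimal (hAC k) hC.isClosed
  let F : ℕ → TopologicalSpace.NonemptyCompacts C := fun k =>
    ⟨⟨Subtype.val ⁻¹' closure (A k), (isClosed_closure.preimage continuous_subtype_val).isCompact⟩,
      by
        obtain ⟨a, ha⟩ := hA k
        exact ⟨⟨a, hAC k ha⟩, subset_closure ha⟩⟩
  obtain ⟨G, -, φ, hφ, hlim⟩ := isCompact_univ.tendsto_subseq (fun k => mem_univ (F k))
  refine ⟨φ, hφ, Subtype.val '' (G : Set C), G.isCompact.image continuous_subtype_val,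
    G.nonempty.image _, by rintro _ ⟨y, -, rfl⟩; exact y.2, ?_⟩
  refine (tendsto_iff_dist_tendsto_zero.1 hlim).congr fun j => ?_
  rw [Metric.NonemptyCompacts.dist_eq, ← hausdorffDist_image isometry_subtype_coe]
  congr 1
  change Subtype.val '' (Subtype.val ⁻¹' closure (A (φ j))) = _
  rw [Subtype.image_preimage_coe]
  exact inter_eq_right.2 (hcl _)

/-- Points of the Hausdorff limit are approximated by points of the approximating sets. -/
lemma eventually_exists_mem_ball {X : Type*} [MetricSpace X] {A : ℕ → Set X} {K : Set X}
    (hK : IsCompact K) (hKne : K.Nonempty) (hA : ∀ k, (A k).Nonempty)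
    (hAb : ∀ k, Bornology.IsBounded (A k))
    (h : Tendsto (fun j => hausdorffDist (closure (A j)) K) atTop (nhds 0))
    {x : X} (hx : x ∈ K) {δ : ℝ} (hδ : 0 < δ) : ∀ᶠ j in atTop, ∃ y ∈ ball x δ, y ∈ A j := by
  filter_upwards [h.eventually_lt_const (half_pos hδ)] with j hj
  have hfin := hausdorffEDist_ne_top_of_nonempty_of_bounded (hA j).closure hKne
    (hAb j).closure hK.isBounded
  obtain ⟨y, hy, hxy⟩ := exists_dist_lt_of_hausdorffDist_lt' hx hj hfin
  obtain ⟨z, hz, hyz⟩ := Metric.mem_closure_iff.1 hy _ (half_pos hδ)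
  refine ⟨z, ?_, hz⟩
  rw [mem_ball']
  linarith [dist_triangle x y z, dist_comm x y]

/-- Near a point off the Hausdorff limit the approximating sets are eventually absent. -/
lemma exists_eventually_ball_disjoint {X : Type*} [MetricSpace X] {A : ℕ → Set X} {K : Set X}
    (hK : IsCompact K) (hKne : K.Nonempty) (hA : ∀ k, (A k).Nonempty)
    (hAb : ∀ k, Bornology.IsBounded (A k))
    (h : Tendsto (fun j => hausdorffDist (closure (A j)) K) atTop (nhds 0))
    {p : X} (hp : p ∉ K) : ∃ r > 0, ∀ᶠ j in atTop, ∀ y ∈ ball p r, y ∉ A j := by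
  obtain ⟨r, hr, hball⟩ := Metric.isOpen_iff.1 hK.isClosed.isOpen_compl p hp
  refine ⟨r / 2, half_pos hr, ?_⟩
  filter_upwards [h.eventually_lt_const (half_pos hr)] with j hj y hy hyA
  have hfin := hausdorffEDist_ne_top_of_nonempty_of_bounded (hA j).closure hKne
    (hAb j).closure hK.isBounded
  obtain ⟨z, hz, hyz⟩ := exists_dist_lt_of_hausdorffDist_lt (subset_closure hyA) hj hfin
  refine hball ?_ hz
  rw [mem_ball] at hy ⊢
  linarith [dist_triangle z y p, dist_comm y z]

/-- A finite measure has only finitely many atoms above a positive threshold. -/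
lemma finite_of_le_real_singleton {X : Type*} [MeasurableSpace X] [MeasurableSingletonClass X]
    (α : Measure X) [IsFiniteMeasure α] {η : ℝ} (hη : 0 < η) {T : Set X}
    (hT : ∀ x ∈ T, η ≤ α.real {x}) : T.Finite := by
  refine (Measure.finite_const_le_meas_of_disjoint_iUnion α (ENNReal.ofReal_pos.2 hη)
    (As := fun x : X => {x}) (fun x => measurableSet_singleton x)
    (fun x y hxy => by simpa using hxy) (measure_ne_top α _)).subset fun x hx => ?_
  have := hT x hx
  simpa [Measure.real, ENNReal.ofReal_le_iff_le_toReal (measure_ne_top α {x})] using this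

/-- A compact subset of `(-1, 1)` stays at a positive distance from `±1`. -/
lemma exists_abs_le_one_sub {I : Set ℝ} (hIne : I.Nonempty) (hIc : IsCompact I)
    (hIsub : I ⊆ Ioo (-1) 1) : ∃ β : ℝ, 0 < β ∧ β ≤ 1 ∧ ∀ t ∈ I, |t| ≤ 1 - β := by
  obtain ⟨t₀, ht₀, hmax⟩ := hIc.exists_isMaxOn hIne continuous_abs.continuousOn
  refine ⟨1 - |t₀|, ?_, by linarith [abs_nonneg t₀], fun t ht => ?_⟩
  · linarith [abs_lt.2 (hIsub ht₀)]
  · have := hmax ht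
    simp only [mem_ofPred_eq] at this
    linarith

theorem stmt16 (Ω : Set (E 3)) (hΩo : IsOpen Ω) (hΩb : Bornology.IsBounded Ω)
    (ε : ℕ → ℝ) (hεpos : ∀ k, 0 < ε k) (hε0 : Tendsto ε atTop (nhds 0))
    (u : ℕ → E 3 → ℝ) (hu : ∀ k, ContDiffOn ℝ 2 (u k) (closure Ω))
    (A : ℝ) (hA : ∀ k, Se (ε k) Ω (u k) + We (ε k) Ω (u k) ≤ A)
    (θ : ℝ) (hθ : 1 ≤ θ) (hbd : ∀ k, ∀ x ∈ frontier Ω, |u k x| ≤ θ)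
    (μ α : Measure (E 3)) [IsFiniteMeasure μ] [IsFiniteMeasure α]
    (hμ : weakConvA Ω ε u μ) (hα : weakConvW Ω ε u α)
    (ulim : E 3 → ℝ)
    (hL1 : Tendsto (fun k => ∫ x in Ω, |u k x - ulim x|) atTop (nhds 0))
    (hpm : ∀ x ∈ Ω \ sptM μ, ulim x = 1 ∨ ulim x = -1)
    (hlc : ∀ x ∈ Ω \ sptM μ, ∃ ρ > 0, ∀ y ∈ ball x ρ, y ∈ Ω \ sptM μ → ulim y = ulim x)
    (I : Set ℝ) (hIne : I.Nonempty) (hIc : IsCompact I) (hIsub : I ⊆ Set.Ioo (-1) 1) :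
    ∃ φ : ℕ → ℕ, StrictMono φ ∧
      ∃ K : Set (E 3), IsCompact K ∧ K ⊆ closure Ω ∧
        ∃ (N : ℕ) (xs : Fin N → E 3), (∀ i, xs i ∈ Ω) ∧
          Tendsto (fun j => Metric.hausdorffDist (closure (Ω ∩ u (φ j) ⁻¹' I)) K)
            atTop (nhds 0) ∧
          K ∩ Ω = (sptM μ ∩ Ω) ∪ Set.range xs := by
  have S : PhaseSeq Ω ε u μ α :=
    ⟨hΩo, hεpos, hε0, fun k => (hu k).mono subset_closure, hμ, hα⟩
  obtain ⟨β, hβ, hβ1, hIβ⟩ := exists_abs_le_one_sub hIne hIc hIsub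
  obtain ⟨s, hsI⟩ := hIne
  by_cases hfr : ∃ᶠ k in atTop, Ω ∩ u k ⁻¹' I = ∅
  · obtain ⟨φ, hφ, hempty⟩ := extraction_of_frequently_atTop hfr
    have hspt : sptM μ ∩ Ω = ∅ := by
      refine eq_empty_of_forall_notMem fun p ⟨hpμ, hpΩ⟩ => ?_
      refine S.notMem_sptM (hIsub hsI) hpΩ one_pos (hfr.mono fun k hk y _ hyΩ hys => ?_) hpμ
      have hy : y ∈ Ω ∩ u k ⁻¹' I := ⟨hyΩ, by rwa [mem_preimage, hys]⟩
      rwa [hk] at hy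
    refine ⟨φ, hφ, ∅, isCompact_empty, empty_subset _, 0, Fin.elim0, fun i => i.elim0, ?_, ?_⟩
    · simp [hempty]
    · simp [hspt]
  · rw [not_frequently] at hfr
    obtain ⟨m, hm⟩ := eventually_atTop.1 hfr
    obtain ⟨ψ, hψ, K, hK, hKne, hKsub, hlim⟩ := exists_subseq_hausdorffDist_tendsto
      (hΩb.isCompact_closure) (fun k => Ω ∩ u (k + m) ⁻¹' I)
      (fun k => inter_subset_left.trans subset_closure)
      (fun k => nonempty_iff_ne_empty.2 (hm _ (Nat.le_add_left _ _)))
    have hφ : StrictMono fun j => ψ j + m := fun a b hab => Nat.add_lt_add_right (hψ hab) m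
    have Sφ := S.comp hφ
    have hne : ∀ j, (Ω ∩ u (ψ j + m) ⁻¹' I).Nonempty := fun j =>
      nonempty_iff_ne_empty.2 (hm _ (Nat.le_add_left _ _))
    have hbdd : ∀ j, Bornology.IsBounded (Ω ∩ u (ψ j + m) ⁻¹' I) := fun j =>
      hΩb.subset inter_subset_left
    obtain ⟨η, hη, hatom⟩ := Sφ.exists_le_real_singleton hβ hβ1
    have hfin : ((K ∩ Ω) \ sptM μ).Finite := by
      refine finite_of_le_real_singleton α hη fun x ⟨⟨hxK, hxΩ⟩, hxμ⟩ =>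
        hatom x hxΩ hxμ fun δ hδ => Eventually.frequently ?_
      filter_upwards [eventually_exists_mem_ball hK hKne hne hbdd hlim hxK hδ] with j
      rintro ⟨y, hy, -, hyI⟩
      exact ⟨y, hy, hIβ _ hyI⟩
    have hspt : sptM μ ∩ Ω ⊆ K := by
      rintro p ⟨hpμ, hpΩ⟩
      by_contra hpK
      obtain ⟨r, hr, hmiss⟩ := exists_eventually_ball_disjoint hK hKne hne hbdd hlim hpK
      refine Sφ.notMem_sptM (hIsub hsI) hpΩ hr
        (hmiss.mono fun j hj y hy hyΩ hys => hj y hy ⟨hyΩ, ?_⟩).frequently hpμ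
      change u (ψ j + m) y = s at hys
      rwa [mem_preimage, hys]
    obtain ⟨N, xs, -, hxs⟩ := hfin.fin_param
    have hrange : range xs = (K ∩ Ω) \ sptM μ := hxs
    refine ⟨_, hφ, K, hK, hKsub, N, xs, fun i => ?_, hlim, ?_⟩
    · exact (hrange ▸ mem_range_self i : xs i ∈ (K ∩ Ω) \ sptM μ).1.2
    · rw [hrange]
      ext x
      constructor
      · intro hx
        by_cases hxμ : x ∈ sptM μ
        · exact Or.inl ⟨hxμ, hx.2⟩
        · exact Or.inr ⟨hx, hxμ⟩
      · rintro (hx | hx)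
        · exact ⟨hspt hx, hx.2⟩
        · exact hx.1

end
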